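/- arXiv:1710.05485 — 2 statements merged into one kernel-verified Lean document; each statement's English description precedes it below -/
import Mathlib

section
/- Fix constants d, r > 0 and h, k ∈ (0,1). Suppose c* > 0 is such that for every c ≥ 0 a semi-wave with speed c exists if and only if c < c*, and for c ∈ [0, c*) let (φ_c, ψ_c) denote the unique semi-wave with speed c. Then for every γ > 0 there exists a unique c(γ) ∈ (0, c*) such that γ·φ'_{c(γ)}(0⁺) = c(γ), where φ'_{c}(0⁺) is the right derivative of φ_c at 0. Moreover the function γ ↦ c(γ) is strictly increasing on (0,∞), and c(γ) → c* as γ → ∞. -/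
open Real Filter Set

noncomputable def uStar (h k : ℝ) : ℝ := (1 - k) / (1 - h * k)
noncomputable def vStar (h k : ℝ) : ℝ := (1 - h) / (1 - h * k)

/-- A semi-wave with speed `c` for the system
`φ'' - cφ' + φ(1 - φ - kψ) = 0` on `(0,∞)`,
`dψ'' - cψ' + rψ(1 - ψ - hφ) = 0` on `ℝ`,
with `φ ≡ 0` on `(-∞,0]`, `ψ(-∞) = 1`, `(φ,ψ)(∞) = (u*, v*)`. -/
structure IsSemiWave (d r h k c : ℝ) (φ ψ : ℝ → ℝ) : Prop where
  cont_phi : Continuous φ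
  smooth_phi : ContDiffOn ℝ 2 φ (Set.Ici 0)
  phi_zero : ∀ s ≤ (0:ℝ), φ s = 0
  smooth_psi : ContDiff ℝ 2 ψ
  ode_phi : ∀ s > (0:ℝ),
    deriv (deriv φ) s - c * deriv φ s + φ s * (1 - φ s - k * ψ s) = 0
  phi_deriv_pos : ∀ s > (0:ℝ), 0 < deriv φ s
  ode_psi : ∀ s : ℝ,
    d * deriv (deriv ψ) s - c * deriv ψ s + r * ψ s * (1 - ψ s - h * φ s) = 0
  psi_deriv_neg : ∀ s : ℝ, deriv ψ s < 0
  psi_atBot : Filter.Tendsto ψ Filter.atBot (nhds 1)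
  phi_atTop : Filter.Tendsto φ Filter.atTop (nhds (uStar h k))
  psi_atTop : Filter.Tendsto ψ Filter.atTop (nhds (vStar h k))

/-! ### General calculus helpers -/

lemma localMin_second {f f' : ℝ → ℝ} {x a : ℝ} (h1 : ∀ᶠ y in nhds x, HasDerivAt f (f' y) y)
    (h2 : HasDerivAt f' a x) (hm : IsLocalMin f x) : f' x = 0 ∧ 0 ≤ a := by
  have h0 : f' x = 0 := hm.hasDerivAt_eq_zero h1.self_of_nhds
  refine ⟨h0, ?_⟩
  by_contra hneg
  push Not at hneg
  have hd : deriv f =ᶠ[nhds x] f' := h1.mono fun y hy => hy.deriv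
  have hdd : deriv (deriv f) x = a := by rw [hd.deriv_eq, h2.deriv]
  have hmax : IsLocalMax f x :=
    isLocalMax_of_deriv_deriv_neg (by rw [hdd]; exact hneg)
      (by rw [hd.self_of_nhds, h0]) h1.self_of_nhds.continuousAt
  have hc : f =ᶠ[nhds x] fun _ => f x := by
    filter_upwards [hm, hmax] with y hy1 hy2
    exact le_antisymm hy2 hy1
  have h3 : deriv f =ᶠ[nhds x] deriv (fun _ => f x) := hc.deriv
  have h4 := h3.deriv_eq
  simp at h4
  linarith [hdd, h4]

lemma localMax_second {f f' : ℝ → ℝ} {x a : ℝ} (h1 : ∀ᶠ y in nhds x, HasDerivAt f (f' y) y)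
    (h2 : HasDerivAt f' a x) (hm : IsLocalMax f x) : f' x = 0 ∧ a ≤ 0 := by
  have := localMin_second (f := fun y => - f y) (f' := fun y => - f' y) (a := -a)
    (h1.mono fun y hy => hy.neg) h2.neg hm.neg
  exact ⟨by linarith [this.1], by linarith [this.2]⟩

/-- `u ≥ 0`, `u'' ≤ c u' + K u`, `u(a) = u'(a) = 0` force `u ≤ 0`. -/
lemma zero_of_ineq {u v w : ℝ → ℝ} {a c K : ℝ} (hK : 0 ≤ K) (hc : 0 ≤ c)
    (hu : ContinuousOn u (Ici a)) (hv : ContinuousOn v (Ici a))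
    (h1 : ∀ s > a, HasDerivAt u (v s) s) (h2 : ∀ s > a, HasDerivAt v (w s) s)
    (hpos : ∀ s > a, 0 ≤ u s) (hw : ∀ s > a, w s ≤ c * v s + K * u s)
    (hua : u a = 0) (hva : v a = 0) : ∀ s ≥ a, u s ≤ 0 := by
  obtain ⟨l, hl0, hl⟩ : ∃ l : ℝ, 0 ≤ l ∧ K ≤ (l - c) * l :=
    ⟨c + K + 1, by linarith, by nlinarith [mul_nonneg hc hK]⟩
  have hy : ∀ s ≥ a, v s - l * u s ≤ 0 := by
    have hanti : AntitoneOn (fun s => (v s - l * u s) * exp ((l - c) * s)) (Ici a) := by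
      apply antitoneOn_of_deriv_nonpos (convex_Ici a)
      · exact (hv.sub (continuousOn_const.mul hu)).mul (by fun_prop)
      · intro s hs
        rw [interior_Ici] at hs
        have : HasDerivAt (fun s => (v s - l * u s) * exp ((l - c) * s)) _ s :=
          ((h2 s hs).sub ((h1 s hs).const_mul l)).mul (((hasDerivAt_id s).const_mul (l - c)).exp)
        exact this.differentiableAt.differentiableWithinAt
      · intro s hs
        rw [interior_Ici] at hs
        have : HasDerivAt (fun s => (v s - l * u s) * exp ((l - c) * s)) _ s :=
          ((h2 s hs).sub ((h1 s hs).const_mul l)).mul (((hasDerivAt_id s).const_mul (l - c)).exp)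
        rw [this.deriv]
        have e := exp_pos ((l - c) * s)
        have h3 := hw s hs
        have h4 := hpos s hs
        simp only [id, Pi.sub_apply]
        have : (w s - l * v s) + (v s - l * u s) * (l - c) ≤ 0 := by nlinarith
        nlinarith
    intro s hs
    have := hanti (mem_Ici.2 le_rfl) (mem_Ici.2 hs) hs
    simp only [hua, hva] at this
    have e := exp_pos ((l - c) * s)
    by_contra hcon
    push Not at hcon
    nlinarith [mul_pos hcon e]
  have hanti : AntitoneOn (fun s => u s * exp (-l * s)) (Ici a) := by
    apply antitoneOn_of_deriv_nonpos (convex_Ici a)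
    · exact hu.mul (by fun_prop)
    · intro s hs
      rw [interior_Ici] at hs
      have : HasDerivAt (fun s => u s * exp (-l * s)) _ s :=
        (h1 s hs).mul (((hasDerivAt_id s).const_mul (-l)).exp)
      exact this.differentiableAt.differentiableWithinAt
    · intro s hs
      rw [interior_Ici] at hs
      have : HasDerivAt (fun s => u s * exp (-l * s)) _ s :=
        (h1 s hs).mul (((hasDerivAt_id s).const_mul (-l)).exp)
      rw [this.deriv]
      have e := exp_pos (-l * s)
      have h3 := hy s (le_of_lt hs)
      simp only [id]
      nlinarith
  intro s hs
  have := hanti (mem_Ici.2 le_rfl) (mem_Ici.2 hs) hs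
  simp only [hua] at this
  have e := exp_pos (-l * s)
  by_contra hcon
  push Not at hcon
  nlinarith [mul_pos hcon e]

lemma linear_growth {y z : ℝ → ℝ} {S e : ℝ} (h1 : ∀ s > S, HasDerivAt y (z s) s)
    (hz : ∀ s > S, e ≤ z s) : ∀ s > S, ∀ t ≥ s, y s + e * (t - s) ≤ y t := by
  intro s hs t ht
  have := (convex_Ici s).mul_sub_le_image_sub_of_le_deriv (f := y) (C := e)
    (fun x hx => (h1 x (lt_of_lt_of_le hs hx)).continuousAt.continuousWithinAt)
    (fun x hx => by
      rw [interior_Ici] at hx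
      exact (h1 x (lt_trans hs hx)).differentiableAt.differentiableWithinAt)
    (fun x hx => by
      rw [interior_Ici] at hx
      rw [(h1 x (lt_trans hs hx)).deriv]; exact hz x (lt_trans hs hx))
    s (mem_Ici.2 le_rfl) t (mem_Ici.2 ht) ht
  linarith

lemma asym_nonneg {u v q : ℝ → ℝ} {c C L : ℝ} (hb : ∀ s > 0, |u s| ≤ C)
    (h1 : ∀ s > 0, HasDerivAt u (v s) s) (h2 : ∀ s > 0, HasDerivAt v (c * v s - q s) s)
    (hq : Tendsto q atTop (nhds L)) : 0 ≤ L := by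
  by_contra hL
  push Not at hL
  have h3 : ∀ᶠ s in atTop, q s < L / 2 := hq.eventually_lt_const (by linarith)
  obtain ⟨S, hS⟩ := (h3.and (eventually_gt_atTop 0)).exists_forall_of_atTop
  have hS0 : 0 < S := (hS S le_rfl).2
  have g1 := linear_growth (y := fun s => v s - c * u s) (z := fun s => - q s) (S := S) (e := -L/2)
    (fun s hs => by
      have hs0 : s > 0 := lt_trans hS0 hs
      have := (h2 s hs0).sub ((h1 s hs0).const_mul c)
      exact this.congr_deriv (by ring))
    (fun s hs => by have := (hS s hs.le).1; linarith)
  have g2 := g1 (S + 1) (by linarith)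
  obtain ⟨R, hR, hR1⟩ : ∃ R ≥ S + 1, ∀ t ≥ R, 1 ≤ v t := by
    set B := v (S + 1) - c * u (S + 1)
    refine ⟨max (S + 1) (S + 1 + (1 - B + |c| * C) / (-L / 2)), le_max_left _ _, ?_⟩
    intro t ht
    have ht1 := le_trans (le_max_left _ _) ht
    have ht2 := le_trans (le_max_right _ _) ht
    have h5 := g2 t ht1
    have h6 : 1 - B + |c| * C ≤ (-L / 2) * (t - (S + 1)) := by
      have : (1 - B + |c| * C) / (-L / 2) ≤ t - (S + 1) := by linarith
      rw [div_le_iff₀ (by linarith)] at this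
      linarith
    have h7 : |c * u t| ≤ |c| * C := by
      rw [abs_mul]; exact mul_le_mul_of_nonneg_left (hb t (by linarith)) (abs_nonneg _)
    have := neg_abs_le (c * u t)
    linarith
  have g3 := linear_growth (y := u) (z := v) (S := R) (e := 1)
    (fun s hs => h1 s (by linarith)) (fun s hs => hR1 s hs.le)
  have g4 := g3 (R + 1) (by linarith) (R + 1 + (2 * C + 1)) (by
    have := hb (R+1) (by linarith)
    have := abs_nonneg (u (R+1)); linarith)
  have b1 := abs_le.1 (hb (R+1) (by linarith))
  have b2 := abs_le.1 (hb (R + 1 + (2 * C + 1)) (by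
    have := abs_nonneg (u (R+1)); linarith [hb (R+1) (by linarith)]))
  linarith [b1.1, b2.2]

lemma asym_zero {u v q : ℝ → ℝ} {c C L : ℝ} (hb : ∀ s > 0, |u s| ≤ C)
    (h1 : ∀ s > 0, HasDerivAt u (v s) s) (h2 : ∀ s > 0, HasDerivAt v (c * v s - q s) s)
    (hq : Tendsto q atTop (nhds L)) : L = 0 := by
  have a1 := asym_nonneg hb h1 h2 hq
  have a2 := asym_nonneg (u := fun s => - u s) (v := fun s => - v s) (q := fun s => - q s)
    (c := c) (C := C) (L := -L)
    (fun s hs => by simpa using hb s hs) (fun s hs => (h1 s hs).neg)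
    (fun s hs => by
      exact (h2 s hs).neg.congr_deriv (by ring)) hq.neg
  linarith

/-! ### Integral form, limits and regularity -/

lemma reg_lemma {I : Set ℝ} {u q : ℝ → ℝ} {m c : ℝ} (h0 : 0 ∈ I) (hI : I.OrdConnected)
    (hu : Continuous u) (hq : Continuous q)
    (hint : ∀ s ∈ I, u s = u 0 + ∫ t in (0:ℝ)..s, (m + c * u t - ∫ x in (0:ℝ)..t, q x)) :
    ∃ W : ℝ → ℝ, ContDiff ℝ 2 W ∧ (∀ s ∈ I, u s = W s) ∧ deriv W 0 = m + c * u 0 ∧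
      ∀ s ∈ I, deriv (deriv W) s = c * deriv W s - q s := by
  set Q : ℝ → ℝ := fun t => ∫ x in (0:ℝ)..t, q x with hQ
  have dQ : ∀ t, HasDerivAt Q (q t) t := fun t =>
    intervalIntegral.integral_hasDerivAt_right (hq.intervalIntegrable _ _)
      (hq.stronglyMeasurableAtFilter _ _) hq.continuousAt
  have cQ : Continuous Q := continuous_iff_continuousAt.2 fun t => (dQ t).continuousAt
  set U : ℝ → ℝ := fun s => u 0 + ∫ t in (0:ℝ)..s, (m + c * u t - Q t) with hU
  have cU' : Continuous fun t => m + c * u t - Q t := by fun_prop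
  have dU : ∀ t, HasDerivAt U (m + c * u t - Q t) t := fun t =>
    (intervalIntegral.integral_hasDerivAt_right (cU'.intervalIntegrable _ _)
      (cU'.stronglyMeasurableAtFilter _ _) cU'.continuousAt).const_add _
  have cU : Continuous U := continuous_iff_continuousAt.2 fun t => (dU t).continuousAt
  have huU : ∀ s ∈ I, u s = U s := hint
  set V : ℝ → ℝ := fun t => m + c * U t - Q t with hV
  have cV : Continuous V := by fun_prop
  have dV : ∀ t, HasDerivAt V (c * (m + c * u t - Q t) - q t) t := fun t =>
    (((dU t).const_mul c).const_add m).sub (dQ t)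
  set W : ℝ → ℝ := fun s => u 0 + ∫ t in (0:ℝ)..s, V t with hW
  have dW : ∀ t, HasDerivAt W (V t) t := fun t =>
    (intervalIntegral.integral_hasDerivAt_right (cV.intervalIntegrable _ _)
      (cV.stronglyMeasurableAtFilter _ _) cV.continuousAt).const_add _
  have eW : deriv W = V := funext fun t => (dW t).deriv
  have eV : deriv V = fun t => c * (m + c * u t - Q t) - q t := funext fun t => (dV t).deriv
  refine ⟨W, ?_, ?_, ?_, ?_⟩
  · rw [show (2 : WithTop ℕ∞) = 1 + 1 by norm_num, contDiff_succ_iff_deriv]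
    refine ⟨fun t => (dW t).differentiableAt, by simp, ?_⟩
    rw [eW, contDiff_one_iff_deriv]
    refine ⟨fun t => (dV t).differentiableAt, ?_⟩
    rw [eV]; fun_prop
  · intro s hs
    rw [huU s hs]
    simp only [hU, hW]
    congr 1
    apply intervalIntegral.integral_congr
    intro t ht
    have : t ∈ I := hI.uIcc_subset h0 hs ht
    simp only [hV, huU t this]
  · rw [eW]; simp [hV, ← huU 0 h0, hQ]
  · intro s hs
    rw [eW, eV]
    simp only [hV, huU s hs]

lemma cont_lemma {u q : ℝ → ℝ} {m c a C : ℝ} (hu : Measurable u) (hq : Measurable q)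
    (hub : ∀ s, |u s| ≤ C) (hqb : ∀ s, |q s| ≤ C) :
    Continuous fun s => a + ∫ t in (0:ℝ)..s, (m + c * u t - ∫ x in (0:ℝ)..t, q x) := by
  have iq : ∀ a b, IntervalIntegrable q MeasureTheory.volume a b := fun a b =>
    (intervalIntegrable_const (c := C)).mono_fun hq.aestronglyMeasurable
      (Filter.Eventually.of_forall fun x => by
        simpa using (hqb x).trans (le_abs_self C))
  have iu : ∀ a b, IntervalIntegrable u MeasureTheory.volume a b := fun a b =>
    (intervalIntegrable_const (c := C)).mono_fun hu.aestronglyMeasurable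
      (Filter.Eventually.of_forall fun x => by
        simpa using (hub x).trans (le_abs_self C))
  have cQ : Continuous fun t => ∫ x in (0:ℝ)..t, q x :=
    intervalIntegral.continuous_primitive iq 0
  refine continuous_const.add (intervalIntegral.continuous_primitive (fun a b => ?_) 0)
  exact ((intervalIntegrable_const).add ((iu a b).const_mul c)).sub (cQ.intervalIntegrable _ _)

lemma lim_lemma {I : Set ℝ} (h1I : (1:ℝ) ∈ I)
    {U Q : ℕ → ℝ → ℝ} {u q : ℝ → ℝ} {M Cn : ℕ → ℝ} {c C : ℝ}
    (hU : ∀ n, Continuous (U n)) (hQ : ∀ n, Continuous (Q n))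
    (hUb : ∀ n s, |U n s| ≤ C) (hQb : ∀ n s, |Q n s| ≤ C)
    (hint : ∀ n, ∀ s ∈ I, U n s = U n 0 +
      ∫ t in (0:ℝ)..s, (M n + Cn n * U n t - ∫ x in (0:ℝ)..t, Q n x))
    (hu : ∀ s, Tendsto (fun n => U n s) atTop (nhds (u s)))
    (hq : ∀ s, Tendsto (fun n => Q n s) atTop (nhds (q s)))
    (hc : Tendsto Cn atTop (nhds c)) :
    ∃ m, Tendsto M atTop (nhds m) ∧
      ∀ s ∈ I, u s = u 0 + ∫ t in (0:ℝ)..s, (m + c * u t - ∫ x in (0:ℝ)..t, q x) := by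
  have mu : Measurable u := measurable_of_tendsto_metrizable (fun n => (hU n).measurable)
    (tendsto_pi_nhds.2 hu)
  have mq : Measurable q := measurable_of_tendsto_metrizable (fun n => (hQ n).measurable)
    (tendsto_pi_nhds.2 hq)
  have ub : ∀ s, |u s| ≤ C := fun s => le_of_tendsto (hu s).abs (Eventually.of_forall fun n => hUb n s)
  have qb : ∀ s, |q s| ≤ C := fun s => le_of_tendsto (hq s).abs (Eventually.of_forall fun n => hQb n s)
  have iq : ∀ a b, IntervalIntegrable q MeasureTheory.volume a b := fun a b =>
    (intervalIntegrable_const (c := C)).mono_fun mq.aestronglyMeasurable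
      (Filter.Eventually.of_forall fun x => by
        simpa using (qb x).trans (le_abs_self C))
  have iu : ∀ a b, IntervalIntegrable u MeasureTheory.volume a b := fun a b =>
    (intervalIntegrable_const (c := C)).mono_fun mu.aestronglyMeasurable
      (Filter.Eventually.of_forall fun x => by
        simpa using (ub x).trans (le_abs_self C))
  have cQ : Continuous fun t => ∫ x in (0:ℝ)..t, q x :=
    intervalIntegral.continuous_primitive iq 0
  have cQn : ∀ n, Continuous fun t => ∫ x in (0:ℝ)..t, Q n x := fun n =>
    intervalIntegral.continuous_primitive (fun a b => (hQ n).intervalIntegrable a b) 0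
  have limQ : ∀ t, Tendsto (fun n => ∫ x in (0:ℝ)..t, Q n x) atTop (nhds (∫ x in (0:ℝ)..t, q x)) := by
    intro t
    apply intervalIntegral.tendsto_integral_filter_of_dominated_convergence (fun _ => C)
    · exact Eventually.of_forall fun n => (hQ n).aestronglyMeasurable
    · exact Eventually.of_forall fun n => Eventually.of_forall fun x _ => hQb n x
    · exact intervalIntegrable_const
    · exact Eventually.of_forall fun x _ => hq x
  obtain ⟨K, hK⟩ : ∃ K, ∀ n, |Cn n| ≤ K := by
    obtain ⟨K, hK⟩ := hc.abs.bddAbove_range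
    exact ⟨K, fun n => hK ⟨n, rfl⟩⟩
  have limJ : ∀ s, Tendsto (fun n => ∫ t in (0:ℝ)..s, (Cn n * U n t - ∫ x in (0:ℝ)..t, Q n x)) atTop
      (nhds (∫ t in (0:ℝ)..s, (c * u t - ∫ x in (0:ℝ)..t, q x))) := by
    intro s
    apply intervalIntegral.tendsto_integral_filter_of_dominated_convergence
      (fun t => K * C + C * |t|)
    · exact Eventually.of_forall fun n =>
        ((continuous_const.mul (hU n)).sub (cQn n)).aestronglyMeasurable
    · refine Eventually.of_forall fun n => Eventually.of_forall fun x _ => ?_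
      refine (norm_sub_le _ _).trans (add_le_add ?_ ?_)
      · rw [norm_mul]
        exact mul_le_mul (hK n) (hUb n x) (norm_nonneg _) ((abs_nonneg _).trans (hK n))
      · have := intervalIntegral.norm_integral_le_of_norm_le_const (a := 0) (b := x) (f := Q n)
          (C := C) (fun y _ => hQb n y)
        simpa using this
    · exact (by fun_prop : Continuous fun t : ℝ => K * C + C * |t|).intervalIntegrable _ _
    · exact Eventually.of_forall fun x _ => (hc.mul (hu x)).sub (limQ x)
  have split_n : ∀ n, ∀ s ∈ I, U n s = U n 0 + (M n * s +
      ∫ t in (0:ℝ)..s, (Cn n * U n t - ∫ x in (0:ℝ)..t, Q n x)) := by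
    intro n s hs
    rw [hint n s hs]
    congr 1
    have : (fun t => M n + Cn n * U n t - ∫ x in (0:ℝ)..t, Q n x) =
        fun t => M n + (Cn n * U n t - ∫ x in (0:ℝ)..t, Q n x) := by ext t; ring
    have hci : Continuous fun t => Cn n * U n t - ∫ x in (0:ℝ)..t, Q n x :=
      (continuous_const.mul (hU n)).sub (cQn n)
    rw [this, intervalIntegral.integral_add intervalIntegrable_const (hci.intervalIntegrable _ _)]
    simp [mul_comm]
  set J : ℝ → ℝ := fun s => ∫ t in (0:ℝ)..s, (c * u t - ∫ x in (0:ℝ)..t, q x) with hJ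
  have hM : Tendsto M atTop (nhds (u 1 - u 0 - J 1)) := by
    have e : M = fun n => U n 1 - U n 0 -
        ∫ t in (0:ℝ)..1, (Cn n * U n t - ∫ x in (0:ℝ)..t, Q n x) := by
      ext n; have := split_n n 1 h1I; linarith
    rw [e]
    exact ((hu 1).sub (hu 0)).sub (limJ 1)
  refine ⟨_, hM, fun s hs => ?_⟩
  have h1 : Tendsto (fun n => U n s) atTop (nhds (u 0 + ((u 1 - u 0 - J 1) * s + J s))) := by
    have e : (fun n => U n s) = fun n => U n 0 + (M n * s +
      ∫ t in (0:ℝ)..s, (Cn n * U n t - ∫ x in (0:ℝ)..t, Q n x)) := by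
      ext n; exact split_n n s hs
    rw [e]
    exact (hu 0).add ((hM.mul_const s).add (limJ s))
  rw [tendsto_nhds_unique (hu s) h1]
  congr 1
  have : (fun t => (u 1 - u 0 - J 1) + c * u t - ∫ x in (0:ℝ)..t, q x) =
        fun t => (u 1 - u 0 - J 1) + (c * u t - ∫ x in (0:ℝ)..t, q x) := by ext t; ring
  rw [this, intervalIntegral.integral_add intervalIntegrable_const
      (((iu _ _).const_mul c).sub (cQ.intervalIntegrable _ _))]
  rw [intervalIntegral.integral_const, smul_eq_mul]
  ring

/-! ### Basic facts on semi-waves -/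

lemma star_eqs {h k : ℝ} (hh : h ∈ Set.Ioo (0:ℝ) 1) (hk : k ∈ Set.Ioo (0:ℝ) 1) :
    1 - uStar h k - k * vStar h k = 0 ∧ 1 - vStar h k - h * uStar h k = 0 ∧
    0 < uStar h k ∧ uStar h k < 1 ∧ 0 < vStar h k ∧ vStar h k < 1 := by
  obtain ⟨h0, h1⟩ := hh
  obtain ⟨k0, k1⟩ := hk
  have hp : 0 < 1 - h * k := by nlinarith
  have hp' : 1 - h * k ≠ 0 := hp.ne'
  unfold uStar vStar
  refine ⟨?_, ?_, div_pos (by linarith) hp, ?_, div_pos (by linarith) hp, ?_⟩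
  · have e : (1 - h * k) / (1 - h * k) = 1 := div_self hp'
    simp only [div_eq_mul_inv] at e ⊢
    linear_combination -e
  · have e : (1 - h * k) / (1 - h * k) = 1 := div_self hp'
    simp only [div_eq_mul_inv] at e ⊢
    linear_combination -e
  · rw [div_lt_one hp]; nlinarith
  · rw [div_lt_one hp]; nlinarith

lemma contDiffAt_two_derivs {f : ℝ → ℝ} {s : ℝ} (hf : ContDiffAt ℝ 2 f s) :
    HasDerivAt f (deriv f s) s ∧ HasDerivAt (deriv f) (deriv (deriv f) s) s := by
  refine ⟨(hf.differentiableAt (by norm_num)).hasDerivAt, ?_⟩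
  have : ContDiffAt ℝ 1 (deriv f) s := hf.derivWithin (by norm_num)
  exact (this.differentiableAt (by norm_num)).hasDerivAt

section basics
variable {d r h k c : ℝ} {φ ψ : ℝ → ℝ}

lemma IsSemiWave.dphi (H : IsSemiWave d r h k c φ ψ) {s : ℝ} (hs : 0 < s) :
    HasDerivAt φ (deriv φ s) s ∧ HasDerivAt (deriv φ) (deriv (deriv φ) s) s :=
  contDiffAt_two_derivs (H.smooth_phi.contDiffAt (Ici_mem_nhds hs))

lemma IsSemiWave.dpsi (H : IsSemiWave d r h k c φ ψ) (s : ℝ) :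
    HasDerivAt ψ (deriv ψ s) s ∧ HasDerivAt (deriv ψ) (deriv (deriv ψ) s) s :=
  contDiffAt_two_derivs H.smooth_psi.contDiffAt

lemma IsSemiWave.psi_anti (H : IsSemiWave d r h k c φ ψ) : StrictAnti ψ :=
  strictAnti_of_deriv_neg H.psi_deriv_neg

lemma IsSemiWave.phi_strict (H : IsSemiWave d r h k c φ ψ) : StrictMonoOn φ (Ici 0) :=
  strictMonoOn_of_deriv_pos (convex_Ici 0) H.cont_phi.continuousOn
    (fun s hs => by rw [interior_Ici] at hs; exact H.phi_deriv_pos s hs)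

lemma IsSemiWave.phi_pos (H : IsSemiWave d r h k c φ ψ) {s : ℝ} (hs : 0 < s) : 0 < φ s := by
  have := H.phi_strict (mem_Ici.2 le_rfl) (mem_Ici.2 hs.le) hs
  rwa [H.phi_zero 0 le_rfl] at this

lemma IsSemiWave.phi_nonneg (H : IsSemiWave d r h k c φ ψ) (s : ℝ) : 0 ≤ φ s := by
  rcases le_or_gt s 0 with hs | hs
  · rw [H.phi_zero s hs]
  · exact (H.phi_pos hs).le

lemma IsSemiWave.phi_mono (H : IsSemiWave d r h k c φ ψ) : Monotone φ := by
  intro a b hab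
  rcases le_or_gt a 0 with ha | ha
  · rw [H.phi_zero a ha]; exact H.phi_nonneg b
  · exact H.phi_strict.monotoneOn (mem_Ici.2 ha.le) (mem_Ici.2 (ha.le.trans hab)) hab

lemma IsSemiWave.phi_lt (H : IsSemiWave d r h k c φ ψ) (s : ℝ) : φ s < uStar h k := by
  have h1 : φ s < φ (max s 0 + 1) := by
    have h2 : φ s ≤ φ (max s 0) := H.phi_mono (le_max_left _ _)
    have := H.phi_strict (mem_Ici.2 (le_max_right s 0))
      (mem_Ici.2 (by linarith [le_max_right s 0])) (lt_add_one (max s 0))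
    linarith
  exact lt_of_lt_of_le h1 (H.phi_mono.ge_of_tendsto H.phi_atTop _)

lemma IsSemiWave.lt_psi (H : IsSemiWave d r h k c φ ψ) (s : ℝ) : vStar h k < ψ s :=
  lt_of_le_of_lt (H.psi_anti.antitone.le_of_tendsto H.psi_atTop (s+1)) (H.psi_anti (lt_add_one s))

lemma IsSemiWave.psi_lt (H : IsSemiWave d r h k c φ ψ) (s : ℝ) : ψ s < 1 := by
  refine lt_of_lt_of_le (H.psi_anti (sub_one_lt s)) ?_
  refine ge_of_tendsto H.psi_atBot ?_
  filter_upwards [eventually_le_atBot (s-1)] with t ht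
  exact H.psi_anti.antitone ht

/-- The right derivative is continuous, and equals the derivative for positive argument. -/
lemma IsSemiWave.derivWithin_facts (H : IsSemiWave d r h k c φ ψ) :
    ContinuousOn (derivWithin φ (Ici 0)) (Ici 0) ∧
    (∀ s > 0, HasDerivAt φ (derivWithin φ (Ici 0) s) s) ∧
    (∀ s > 0, HasDerivAt (derivWithin φ (Ici 0))
      (c * derivWithin φ (Ici 0) s - φ s * (1 - φ s - k * ψ s)) s) := by
  have e : ∀ s > 0, derivWithin φ (Ici 0) s = deriv φ s := fun s hs =>
    derivWithin_of_mem_nhds (Ici_mem_nhds hs)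
  refine ⟨H.smooth_phi.continuousOn_derivWithin (uniqueDiffOn_Ici 0) (by norm_num), ?_, ?_⟩
  · intro s hs; rw [e s hs]; exact (H.dphi hs).1
  · intro s hs
    rw [e s hs]
    have h1 := (H.dphi hs).2
    have h2 : derivWithin φ (Ici 0) =ᶠ[nhds s] deriv φ := by
      filter_upwards [Ioi_mem_nhds hs] with t ht using e t ht
    exact (h1.congr_of_eventuallyEq h2).congr_deriv (by linarith [H.ode_phi s hs])

lemma IsSemiWave.phi_int (H : IsSemiWave d r h k c φ ψ) : ∀ s ∈ Ici (0:ℝ), φ s = φ 0 +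
    ∫ t in (0:ℝ)..s, (derivWithin φ (Ici 0) 0 + c * φ t -
      ∫ x in (0:ℝ)..t, φ x * (1 - φ x - k * ψ x)) := by
  obtain ⟨hP, hd1, hd2⟩ := H.derivWithin_facts
  have cpsi : Continuous ψ := H.smooth_psi.continuous
  have cphi := H.cont_phi
  have cf : Continuous fun x => φ x * (1 - φ x - k * ψ x) := by fun_prop
  have hP2 : ∀ t ∈ Ici (0:ℝ), derivWithin φ (Ici 0) t = derivWithin φ (Ici 0) 0 + c * φ t -
      ∫ x in (0:ℝ)..t, φ x * (1 - φ x - k * ψ x) := by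
    intro t ht
    have := intervalIntegral.integral_eq_sub_of_hasDerivAt_of_le (a := 0) (b := t) ht
      (f := fun s => c * φ s - derivWithin φ (Ici 0) s)
      (f' := fun x => φ x * (1 - φ x - k * ψ x))
      ((continuousOn_const.mul cphi.continuousOn).sub (hP.mono Icc_subset_Ici_self))
      (fun x hx => ((((hd1 x hx.1).const_mul c).sub (hd2 x hx.1))).congr_deriv (by ring))
      (cf.intervalIntegrable _ _)
    rw [this, H.phi_zero 0 le_rfl]; ring
  intro s hs
  have h1 := intervalIntegral.integral_eq_sub_of_hasDerivAt_of_le (a := 0) (b := s) hs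
      (f := φ) (f' := derivWithin φ (Ici 0)) cphi.continuousOn (fun x hx => hd1 x hx.1)
      (ContinuousOn.intervalIntegrable_of_Icc hs (hP.mono Icc_subset_Ici_self))
  have h2 : ∫ t in (0:ℝ)..s, (derivWithin φ (Ici 0) 0 + c * φ t -
      ∫ x in (0:ℝ)..t, φ x * (1 - φ x - k * ψ x)) = ∫ t in (0:ℝ)..s, derivWithin φ (Ici 0) t := by
    apply intervalIntegral.integral_congr
    intro t ht
    rw [uIcc_of_le hs] at ht
    exact (hP2 t ht.1).symm
  rw [h2, h1]; ring

lemma IsSemiWave.psi_int (hd : 0 < d) (H : IsSemiWave d r h k c φ ψ) :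
    ∀ s ∈ (univ : Set ℝ), ψ s = ψ 0 +
    ∫ t in (0:ℝ)..s, ((deriv ψ 0 - c / d * ψ 0) + c / d * ψ t -
      ∫ x in (0:ℝ)..t, r / d * ψ x * (1 - ψ x - h * φ x)) := by
  have cpsi : Continuous ψ := H.smooth_psi.continuous
  have cphi := H.cont_phi
  have cf : Continuous fun x => r / d * ψ x * (1 - ψ x - h * φ x) := by fun_prop
  have cd : Continuous (deriv ψ) := continuous_iff_continuousAt.2 fun s => (H.dpsi s).2.continuousAt
  have hP2 : ∀ t, deriv ψ t = (deriv ψ 0 - c / d * ψ 0) + c / d * ψ t -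
      ∫ x in (0:ℝ)..t, r / d * ψ x * (1 - ψ x - h * φ x) := by
    intro t
    have := intervalIntegral.integral_eq_sub_of_hasDerivAt (a := 0) (b := t)
      (f := fun s => c / d * ψ s - deriv ψ s)
      (f' := fun x => r / d * ψ x * (1 - ψ x - h * φ x))
      (fun x _ => ((((H.dpsi x).1.const_mul (c / d)).sub (H.dpsi x).2)).congr_deriv (by
        have := H.ode_psi x
        field_simp
        linarith))
      (cf.intervalIntegrable _ _)
    rw [this]; ring
  intro s _
  have h1 := intervalIntegral.integral_eq_sub_of_hasDerivAt (a := 0) (b := s)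
      (f := ψ) (f' := deriv ψ) (fun x _ => (H.dpsi x).1) (cd.intervalIntegrable _ _)
  have h2 : ∫ t in (0:ℝ)..s, ((deriv ψ 0 - c / d * ψ 0) + c / d * ψ t -
      ∫ x in (0:ℝ)..t, r / d * ψ x * (1 - ψ x - h * φ x)) = ∫ t in (0:ℝ)..s, deriv ψ t := by
    apply intervalIntegral.integral_congr
    intro t ht
    exact (hP2 t).symm
  rw [h2, h1]; ring

lemma IsSemiWave.m_pos (hh : h ∈ Set.Ioo (0:ℝ) 1) (hk : k ∈ Set.Ioo (0:ℝ) 1) (hc : 0 ≤ c)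
    (H : IsSemiWave d r h k c φ ψ) : 0 < derivWithin φ (Ici 0) 0 := by
  obtain ⟨hP, hd1, hd2⟩ := H.derivWithin_facts
  obtain ⟨-, -, -, hu1, hv0, -⟩ := star_eqs hh hk
  have hge : 0 ≤ derivWithin φ (Ici 0) 0 := (H.phi_mono.monotoneOn _).derivWithin_nonneg
  rcases hge.lt_or_eq with h1 | h1
  · exact h1
  exfalso
  have := zero_of_ineq (K := 2) (c := c) (a := 0) (by norm_num) hc H.cont_phi.continuousOn hP hd1 hd2
    (fun s hs => H.phi_nonneg s) (fun s hs => by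
      have a1 := H.phi_nonneg s
      have a2 := H.phi_lt s
      have a3 := H.psi_lt s
      have a4 := H.lt_psi s
      have : -2 ≤ 1 - φ s - k * ψ s := by nlinarith [hk.1, hk.2]
      nlinarith) (H.phi_zero 0 le_rfl) h1.symm 1 (by norm_num)
  linarith [H.phi_pos one_pos]
end basics

/-! ### Comparison of semi-waves with different speeds (sliding method) -/

section comparison
variable {d r h k c₁ c₂ : ℝ} {φ₁ ψ₁ φ₂ ψ₂ : ℝ → ℝ}

/-- At a minimum of `φ₁(·+τ) - φ₂`. -/
lemma phi_min (H₁ : IsSemiWave d r h k c₁ φ₁ ψ₁) (H₂ : IsSemiWave d r h k c₂ φ₂ ψ₂)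
    (hc : c₁ < c₂) {τ s : ℝ} (hτ : 0 ≤ τ) (hs : 0 < s)
    (hmin : IsLocalMin (fun t => φ₁ (t + τ) - φ₂ t) s) :
    φ₁ (s + τ) * (1 - φ₁ (s + τ) - k * ψ₁ (s + τ)) < φ₂ s * (1 - φ₂ s - k * ψ₂ s) := by
  obtain ⟨h1, h2⟩ := localMin_second (f := fun t => φ₁ (t + τ) - φ₂ t)
    (f' := fun t => deriv φ₁ (t + τ) - deriv φ₂ t)
    (a := deriv (deriv φ₁) (s + τ) - deriv (deriv φ₂) s)
    (by
      filter_upwards [Ioi_mem_nhds hs] with t ht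
      have ht0 : 0 < t := ht
      exact ((H₁.dphi (by linarith : 0 < t + τ)).1.comp_add_const t τ).sub (H₂.dphi ht0).1)
    (((H₁.dphi (by linarith : 0 < s + τ)).2.comp_add_const s τ).sub (H₂.dphi hs).2) hmin
  have o1 := H₁.ode_phi (s + τ) (by linarith)
  have o2 := H₂.ode_phi s hs
  have p := H₂.phi_deriv_pos s hs
  have e : deriv φ₁ (s + τ) = deriv φ₂ s := by linarith
  rw [e] at o1
  nlinarith [mul_pos (sub_pos.2 hc) p]

/-- At a minimum of `ψ₂ - ψ₁(·+τ)`. -/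
lemma psi_min (hd : 0 < d) (H₁ : IsSemiWave d r h k c₁ φ₁ ψ₁) (H₂ : IsSemiWave d r h k c₂ φ₂ ψ₂)
    (hc : c₁ < c₂) {τ s : ℝ}
    (hmin : IsLocalMin (fun t => ψ₂ t - ψ₁ (t + τ)) s) :
    r * ψ₂ s * (1 - ψ₂ s - h * φ₂ s) < r * ψ₁ (s + τ) * (1 - ψ₁ (s + τ) - h * φ₁ (s + τ)) := by
  obtain ⟨h1, h2⟩ := localMin_second (f := fun t => ψ₂ t - ψ₁ (t + τ))
    (f' := fun t => deriv ψ₂ t - deriv ψ₁ (t + τ))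
    (a := deriv (deriv ψ₂) s - deriv (deriv ψ₁) (s + τ))
    (Eventually.of_forall fun t => (H₂.dpsi t).1.sub ((H₁.dpsi (t + τ)).1.comp_add_const t τ))
    ((H₂.dpsi s).2.sub ((H₁.dpsi (s + τ)).2.comp_add_const s τ)) hmin
  have o1 := H₁.ode_psi (s + τ)
  have o2 := H₂.ode_psi s
  have p := H₂.psi_deriv_neg s
  have e : deriv ψ₁ (s + τ) = deriv ψ₂ s := by linarith
  rw [e] at o1
  nlinarith [mul_pos (sub_pos.2 hc) (neg_pos.2 p), mul_nonneg hd.le h2]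

lemma alg_a {a b p q k : ℝ} (k0 : 0 < k) (k1 : k < 1) (ha : 0 ≤ a) (hle : a - b ≤ q - p)
    (hab : a < b) (g4 : 1 - b - k * q < a * (1 - k)) :
    b * (1 - b - k * q) ≤ a * (1 - a - k * p) := by
  have g5 : 1 - b - k * q + (b - a) * (1 - k) ≤ 1 - a - k * p := by nlinarith
  have g6 := mul_le_mul_of_nonneg_left g5 ha
  have g7 := mul_pos (sub_pos.2 g4) (by linarith : 0 < b - a)
  linarith

lemma alg_b {a b p q h : ℝ} (h0 : 0 < h) (h1 : h < 1) (hp : 0 ≤ p) (hle : q - p ≤ a - b)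
    (hab : q < p) (g4 : 1 - q - h * b < p * (1 - h)) :
    p * (1 - p - h * a) ≤ q * (1 - q - h * b) := by
  have g5 : 1 - p - h * a ≤ 1 - q - h * b - (p - q) * (1 - h) := by nlinarith
  have g6 := mul_le_mul_of_nonneg_left g5 hp
  have g7 := mul_pos (sub_pos.2 g4) (by linarith : 0 < p - q)
  linarith

lemma alg_c {a p q h : ℝ} (h0 : 0 < h) (hp : 0 ≤ p) (ha : 0 ≤ a) (hab : q < p)
    (g1 : 1 / 2 < q) (hlt : q * (1 - q - h * 0) < p * (1 - p - h * a)) : False := by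
  have g2 : 0 ≤ p * (h * a) := by positivity
  have g3 := mul_pos (by linarith : 0 < p - q) (by linarith : 0 < p + q - 1)
  linarith

/-- Outside a fixed compact interval, order is automatic. -/
lemma far_order (hd : 0 < d) (hr : 0 < r) (hh : h ∈ Set.Ioo (0:ℝ) 1) (hk : k ∈ Set.Ioo (0:ℝ) 1)
    (H₁ : IsSemiWave d r h k c₁ φ₁ ψ₁) (H₂ : IsSemiWave d r h k c₂ φ₂ ψ₂) (hc : c₁ < c₂) :
    ∃ S > 0, ∀ τ ≥ 0, (∀ s ∈ Icc 0 S, φ₂ s < φ₁ (s + τ)) →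
      (∀ s ∈ Icc (-S) S, ψ₁ (s + τ) < ψ₂ s) →
      ∀ s, φ₂ s ≤ φ₁ (s + τ) ∧ ψ₁ (s + τ) ≤ ψ₂ s := by
  obtain ⟨e1, e2, hu0, hu1, hv0, hv1⟩ := star_eqs hh hk
  -- eventual conditions at `+∞`
  have E1 : ∀ᶠ s in atTop, 1 - φ₂ s - k * ψ₂ s < φ₁ 1 * (1 - k) := by
    have : Tendsto (fun s => 1 - φ₂ s - k * ψ₂ s) atTop (nhds (1 - uStar h k - k * vStar h k)) :=
      (tendsto_const_nhds.sub H₂.phi_atTop).sub (H₂.psi_atTop.const_mul k)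
    rw [e1] at this
    exact this.eventually_lt_const (mul_pos (H₁.phi_pos one_pos) (by linarith [hk.2]))
  have E2 : ∀ᶠ s in atTop, 1 - ψ₂ s - h * φ₂ s < vStar h k * (1 - h) := by
    have : Tendsto (fun s => 1 - ψ₂ s - h * φ₂ s) atTop (nhds (1 - vStar h k - h * uStar h k)) :=
      (tendsto_const_nhds.sub H₂.psi_atTop).sub (H₂.phi_atTop.const_mul h)
    rw [e2] at this
    exact this.eventually_lt_const (mul_pos hv0 (by linarith [hh.2]))
  have E3 : ∀ᶠ s in atBot, 1 / 2 < ψ₂ s := H₂.psi_atBot.eventually_const_lt (by norm_num)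
  obtain ⟨S₁, hS₁⟩ := (E1.and E2).exists_forall_of_atTop
  obtain ⟨S₂, hS₂⟩ := E3.exists_forall_of_atBot
  refine ⟨max 1 (max S₁ (-S₂)), lt_of_lt_of_le one_pos (le_max_left _ _), ?_⟩
  set S := max 1 (max S₁ (-S₂)) with hS
  have hSa : 1 ≤ S := le_max_left _ _
  have hSb : S₁ ≤ S := (le_max_left _ _).trans (le_max_right _ _)
  have hSc : -S₂ ≤ S := (le_max_right _ _).trans (le_max_right _ _)
  intro τ hτ hA hB
  set A : ℝ → ℝ := fun t => φ₁ (t + τ) - φ₂ t with hAdef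
  set B : ℝ → ℝ := fun t => ψ₂ t - ψ₁ (t + τ) with hBdef
  set M : ℝ → ℝ := fun t => min (A t) (B t) with hMdef
  have c1 := H₁.cont_phi
  have c2 := H₂.cont_phi
  have c3 := H₁.smooth_psi.continuous
  have c4 := H₂.smooth_psi.continuous
  have cM : Continuous M := by
    simp only [hMdef, hAdef, hBdef]; fun_prop
  have sh1 : Tendsto (fun t : ℝ => t + τ) atTop atTop := tendsto_atTop_add_const_right _ _ tendsto_id
  have sh2 : Tendsto (fun t : ℝ => t + τ) atBot atBot := tendsto_atBot_add_const_right _ _ tendsto_id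
  have MT : Tendsto M atTop (nhds 0) := by
    have t1 : Tendsto A atTop (nhds (uStar h k - uStar h k)) :=
      (H₁.phi_atTop.comp sh1).sub H₂.phi_atTop
    have t2 : Tendsto B atTop (nhds (vStar h k - vStar h k)) :=
      H₂.psi_atTop.sub (H₁.psi_atTop.comp sh1)
    rw [sub_self] at t1 t2
    simpa using t1.min t2
  have MB : Tendsto M atBot (nhds 0) := by
    have t1 : Tendsto A atBot (nhds 0) := by
      apply tendsto_const_nhds.congr'
      filter_upwards [eventually_le_atBot (-τ)] with t ht
      simp only [hAdef]
      rw [H₁.phi_zero _ (by linarith), H₂.phi_zero _ (by linarith)]; simp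
    have t2 : Tendsto B atBot (nhds (1 - 1)) :=
      H₂.psi_atBot.sub (H₁.psi_atBot.comp sh2)
    rw [sub_self] at t2
    simpa using t1.min t2
  have key : ∀ s, 0 ≤ M s := by
    by_contra hcon
    push Not at hcon
    obtain ⟨x, hx⟩ := hcon
    obtain ⟨s, hs⟩ := cM.exists_forall_le' x (by
      rw [cocompact_eq_atBot_atTop]
      exact Filter.eventually_sup.2 ⟨(MB.eventually_const_lt hx).mono fun _ => le_of_lt,
        (MT.eventually_const_lt hx).mono fun _ => le_of_lt⟩)
    have hsneg : M s < 0 := (hs x).trans_lt hx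
    have q1 := H₁.psi_lt (s + τ)
    have q2 := H₁.lt_psi (s + τ)
    have q3 := H₂.psi_lt s
    have q4 := H₂.lt_psi s
    have q5 := H₁.phi_nonneg (s + τ)
    have q6 := H₂.phi_nonneg s
    obtain ⟨h0, h1⟩ := hh
    obtain ⟨k0, k1⟩ := hk
    rcases le_total (A s) (B s) with hle | hle
    · have hMs : M s = A s := min_eq_left hle
      have hmin : IsLocalMin A s := Eventually.of_forall fun t => by
        have := hs t
        rw [hMs] at this
        exact this.trans (min_le_left _ _)
      have hAneg : A s < 0 := by rw [← hMs]; exact hsneg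
      simp only [hAdef, hBdef] at hle hAneg
      have hs0 : 0 < s := by
        by_contra hs0
        rw [H₂.phi_zero s (by linarith)] at hAneg
        linarith
      have hsS : S < s := by
        by_contra hsS
        have := hA s ⟨hs0.le, by linarith⟩
        linarith
      have hlt := phi_min H₁ H₂ hc hτ hs0 hmin
      have g1 := (hS₁ s (by linarith)).1
      have g2 : φ₁ 1 ≤ φ₁ (s + τ) := H₁.phi_mono (by linarith)
      have g3 := H₁.phi_pos one_pos
      have g4 := alg_a k0 k1 q5 hle (by linarith) (g1.trans_le (mul_le_mul_of_nonneg_right g2 (by linarith)))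
      linarith
    · have hMs : M s = B s := min_eq_right hle
      have hmin : IsLocalMin B s := Eventually.of_forall fun t => by
        have := hs t
        rw [hMs] at this
        exact this.trans (min_le_right _ _)
      have hBneg : B s < 0 := by rw [← hMs]; exact hsneg
      have hlt := psi_min hd H₁ H₂ hc hmin
      simp only [hAdef, hBdef] at hle hBneg
      have hlt' : ψ₂ s * (1 - ψ₂ s - h * φ₂ s) < ψ₁ (s + τ) * (1 - ψ₁ (s + τ) - h * φ₁ (s + τ)) := by
        rw [mul_assoc, mul_assoc] at hlt
        exact lt_of_mul_lt_mul_left hlt hr.le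
      rcases le_or_gt s 0 with hs0 | hs0
      · have hsS : s < -S := by
          by_contra hsS
          have := hB s ⟨by linarith, by linarith⟩
          linarith
        have g1 := hS₂ s (by linarith)
        rw [H₂.phi_zero s hs0] at hlt'
        have g2 := alg_c h0 (by linarith) q5 (by linarith) g1 hlt'
        exact g2
      · have hsS : S < s := by
          by_contra hsS
          have := hB s ⟨by linarith, by linarith⟩
          linarith
        have g1 := (hS₁ s (by linarith)).2
        have g4 := alg_b h0 h1 (by linarith) hle (by linarith) (g1.trans_le (mul_le_mul_of_nonneg_right q2.le (by linarith)))
        linarith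
  intro s
  have := key s
  simp only [hMdef, hAdef, hBdef, le_min_iff] at this
  exact ⟨by linarith [this.1], by linarith [this.2]⟩

lemma wave_comparison (hd : 0 < d) (hr : 0 < r) (hh : h ∈ Set.Ioo (0:ℝ) 1)
    (hk : k ∈ Set.Ioo (0:ℝ) 1)
    (H₁ : IsSemiWave d r h k c₁ φ₁ ψ₁) (H₂ : IsSemiWave d r h k c₂ φ₂ ψ₂) (hc : c₁ < c₂) :
    ∀ s, φ₂ s ≤ φ₁ s ∧ ψ₁ s ≤ ψ₂ s := by
  obtain ⟨S, hS0, hS⟩ := far_order hd hr hh hk H₁ H₂ hc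
  obtain ⟨e1, e2, hu0, hu1, hv0, hv1⟩ := star_eqs hh hk
  have c1 := H₁.cont_phi
  have c2 := H₂.cont_phi
  have c3 := H₁.smooth_psi.continuous
  have c4 := H₂.smooth_psi.continuous
  set T : Set ℝ := {τ | 0 ≤ τ ∧ ∀ s, φ₂ s ≤ φ₁ (s + τ) ∧ ψ₁ (s + τ) ≤ ψ₂ s} with hT
  have Tne : T.Nonempty := by
    have f1 : ∀ᶠ τ in atTop, φ₂ S < φ₁ τ := H₁.phi_atTop.eventually_const_lt (H₂.phi_lt S)
    have f2 : ∀ᶠ τ in atTop, ψ₁ (τ - S) < ψ₂ S :=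
      (H₁.psi_atTop.comp (tendsto_atTop_add_const_right _ (-S) tendsto_id)).eventually_lt_const
        (H₂.lt_psi S)
    obtain ⟨τ, ⟨g1, g2⟩, g3⟩ := ((f1.and f2).and (eventually_ge_atTop 0)).exists
    refine ⟨τ, g3, hS τ g3 ?_ ?_⟩
    · intro s hs
      have a1 := H₂.phi_mono hs.2
      have a2 : φ₁ τ ≤ φ₁ (s + τ) := H₁.phi_mono (by linarith [hs.1])
      linarith
    · intro s hs
      have a1 := H₂.psi_anti.antitone hs.2
      have a2 : ψ₁ (s + τ) ≤ ψ₁ (τ - S) := H₁.psi_anti.antitone (by linarith [hs.1])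
      linarith
  have Tcl : IsClosed T := by
    have : T = {τ | 0 ≤ τ} ∩ ⋂ s, ({τ | φ₂ s ≤ φ₁ (s + τ)} ∩ {τ | ψ₁ (s + τ) ≤ ψ₂ s}) := by
      ext τ; simp [hT]
    rw [this]
    refine (isClosed_le continuous_const continuous_id).inter (isClosed_iInter fun s => ?_)
    exact (isClosed_le continuous_const (by fun_prop)).inter (isClosed_le (by fun_prop) continuous_const)
  have Tbd : BddBelow T := ⟨0, fun τ hτ => hτ.1⟩
  have hmem := Tcl.csInf_mem Tne Tbd
  set τ := sInf T with hτdef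
  rcases hmem.1.eq_or_lt with h0 | h0
  · intro s
    have := hmem.2 s
    rw [← h0] at this
    simpa using this
  exfalso
  -- strictness at τ
  have sA : ∀ s ∈ Icc 0 S, φ₂ s < φ₁ (s + τ) := by
    intro s hs
    rcases hs.1.eq_or_lt with hs0 | hs0
    · rw [← hs0, H₂.phi_zero 0 le_rfl]
      exact H₁.phi_pos (by linarith)
    · refine lt_of_le_of_ne (hmem.2 s).1 fun heq => ?_
      have hmin : IsLocalMin (fun t => φ₁ (t + τ) - φ₂ t) s := Eventually.of_forall fun t => by
        simp only [heq, sub_self]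
        linarith [(hmem.2 t).1]
      have := phi_min H₁ H₂ hc h0.le hs0 hmin
      rw [← heq] at this
      have p := H₂.phi_pos hs0
      have := lt_of_mul_lt_mul_left this p.le
      nlinarith [(hmem.2 s).2, hk.1]
  have sB : ∀ s ∈ Icc (-S) S, ψ₁ (s + τ) < ψ₂ s := by
    intro s hs
    refine lt_of_le_of_ne (hmem.2 s).2 fun heq => ?_
    have hmin : IsLocalMin (fun t => ψ₂ t - ψ₁ (t + τ)) s := Eventually.of_forall fun t => by
      simp only [heq, sub_self]
      linarith [(hmem.2 t).2]
    have := psi_min hd H₁ H₂ hc hmin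
    rw [heq] at this
    have p := H₂.lt_psi s
    have := lt_of_mul_lt_mul_left this (mul_pos hr (by linarith)).le
    nlinarith [(hmem.2 s).1, hh.1]
  have oA : ∀ᶠ t in nhds τ, ∀ s ∈ Icc 0 S, φ₂ s < φ₁ (s + t) := by
    apply isCompact_Icc.eventually_forall_of_forall_eventually
    intro s hs
    have : IsOpen {z : ℝ × ℝ | φ₂ z.2 < φ₁ (z.2 + z.1)} := isOpen_lt (by fun_prop) (by fun_prop)
    exact this.mem_nhds (sA s hs)
  have oB : ∀ᶠ t in nhds τ, ∀ s ∈ Icc (-S) S, ψ₁ (s + t) < ψ₂ s := by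
    apply isCompact_Icc.eventually_forall_of_forall_eventually
    intro s hs
    have : IsOpen {z : ℝ × ℝ | ψ₁ (z.2 + z.1) < ψ₂ z.2} := isOpen_lt (by fun_prop) (by fun_prop)
    exact this.mem_nhds (sB s hs)
  have oC : ∀ᶠ t in nhds τ, 0 < t := Ioi_mem_nhds h0
  have hall := (oA.and (oB.and oC))
  obtain ⟨t, ht, g1, g2, g3⟩ := (((hall.filter_mono nhdsWithin_le_nhds).and
    (self_mem_nhdsWithin : Iio τ ∈ nhdsWithin τ (Iio τ))).exists.imp fun t ht => ⟨ht.2, ht.1⟩ :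
      ∃ t, t ∈ Iio τ ∧ (∀ s ∈ Icc 0 S, φ₂ s < φ₁ (s + t)) ∧
        (∀ s ∈ Icc (-S) S, ψ₁ (s + t) < ψ₂ s) ∧ 0 < t)
  have : t ∈ T := ⟨g3.le, hS t g3.le g1 g2⟩
  exact absurd (csInf_le Tbd this) (not_le.2 ht)

end comparison

/-! ### Limits of semi-waves -/

lemma limit_wave {d r h k c c' : ℝ} (hd : 0 < d) (hr : 0 < r) (hh : h ∈ Set.Ioo (0:ℝ) 1)
    (hk : k ∈ Set.Ioo (0:ℝ) 1) (hc : 0 ≤ c) {C : ℕ → ℝ} {φn ψn : ℕ → ℝ → ℝ} {φ ψ φ' ψ' : ℝ → ℝ}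
    (H : ∀ n, IsSemiWave d r h k (C n) (φn n) (ψn n)) (hC : Tendsto C atTop (nhds c))
    (hφ : ∀ s, Tendsto (fun n => φn n s) atTop (nhds (φ s)))
    (hψ : ∀ s, Tendsto (fun n => ψn n s) atTop (nhds (ψ s)))
    (H' : IsSemiWave d r h k c' φ' ψ') (hle : ∀ n s, φn n s ≤ φ' s ∧ ψ' s ≤ ψn n s) :
    ∃ m, Tendsto (fun n => derivWithin (φn n) (Ici 0) 0) atTop (nhds m) ∧
      (0 < m → IsSemiWave d r h k c φ ψ ∧ derivWithin φ (Ici 0) 0 = m) := by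
  obtain ⟨e1, e2, hu0, hu1, hv0, hv1⟩ := star_eqs hh hk
  have hrd : 0 < r / d := div_pos hr hd
  have bφ : ∀ n s, |φn n s| ≤ 1 + r / d := fun n s => by
    have a1 := (H n).phi_nonneg s
    have a2 := (H n).phi_lt s
    rw [abs_of_nonneg a1]; linarith
  have bψ : ∀ n s, |ψn n s| ≤ 1 + r / d := fun n s => by
    have a1 := (H n).lt_psi s
    have a2 := (H n).psi_lt s
    rw [abs_of_nonneg (by linarith)]; linarith
  have bf : ∀ n s, |φn n s * (1 - φn n s - k * ψn n s)| ≤ 1 + r / d := fun n s => by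
    have a1 := (H n).phi_nonneg s
    have a2 := (H n).phi_lt s
    have a3 := (H n).lt_psi s
    have a4 := (H n).psi_lt s
    rw [abs_mul, abs_of_nonneg a1]
    have : |1 - φn n s - k * ψn n s| ≤ 1 := by
      rw [abs_le]; constructor <;> nlinarith [hk.1, hk.2]
    nlinarith [abs_nonneg (1 - φn n s - k * ψn n s)]
  have bg : ∀ n s, |r / d * ψn n s * (1 - ψn n s - h * φn n s)| ≤ 1 + r / d := fun n s => by
    have a1 := (H n).phi_nonneg s
    have a2 := (H n).phi_lt s
    have a3 := (H n).lt_psi s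
    have a4 := (H n).psi_lt s
    have hx : 0 ≤ r / d * ψn n s := mul_nonneg hrd.le (by linarith)
    have hx1 : r / d * ψn n s ≤ r / d := by nlinarith
    rw [abs_mul, abs_of_nonneg hx]
    have : |1 - ψn n s - h * φn n s| ≤ 1 := by
      rw [abs_le]; constructor <;> nlinarith [hh.1, hh.2]
    nlinarith [abs_nonneg (1 - ψn n s - h * φn n s)]
  have cφn := fun n => (H n).cont_phi
  have cψn := fun n => (H n).smooth_psi.continuous
  have limf : ∀ s, Tendsto (fun n => φn n s * (1 - φn n s - k * ψn n s)) atTop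
      (nhds (φ s * (1 - φ s - k * ψ s))) := fun s =>
    (hφ s).mul ((tendsto_const_nhds.sub (hφ s)).sub ((hψ s).const_mul k))
  have limg : ∀ s, Tendsto (fun n => r / d * ψn n s * (1 - ψn n s - h * φn n s)) atTop
      (nhds (r / d * ψ s * (1 - ψ s - h * φ s))) := fun s =>
    ((hψ s).const_mul _).mul ((tendsto_const_nhds.sub (hψ s)).sub ((hφ s).const_mul h))
  obtain ⟨m, hm, intφ⟩ := lim_lemma (I := Ici (0:ℝ)) (U := φn)
    (Q := fun n s => φn n s * (1 - φn n s - k * ψn n s)) (u := φ)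
    (q := fun s => φ s * (1 - φ s - k * ψ s)) (M := fun n => derivWithin (φn n) (Ici 0) 0)
    (Cn := C) (c := c) (C := 1 + r / d) (mem_Ici.2 zero_le_one) cφn
    (fun n => by have := cφn n; have := cψn n; fun_prop) bφ bf (fun n => (H n).phi_int) hφ limf hC
  obtain ⟨m', -, intψ⟩ := lim_lemma (I := (univ : Set ℝ)) (U := ψn)
    (Q := fun n s => r / d * ψn n s * (1 - ψn n s - h * φn n s)) (u := ψ)
    (q := fun s => r / d * ψ s * (1 - ψ s - h * φ s))
    (M := fun n => deriv (ψn n) 0 - C n / d * ψn n 0)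
    (Cn := fun n => C n / d) (c := c / d) (C := 1 + r / d) (mem_univ _) cψn
    (fun n => by have := cφn n; have := cψn n; fun_prop) bψ bg (fun n => (H n).psi_int hd) hψ limg
    (hC.div_const d)
  refine ⟨m, hm, fun hm0 => ?_⟩
  -- order facts
  have φ0 : ∀ s ≤ 0, φ s = 0 := fun s hs =>
    tendsto_nhds_unique (hφ s) (by simp [fun n => (H n).phi_zero s hs])
  have φnn : ∀ s, 0 ≤ φ s := fun s => ge_of_tendsto' (hφ s) fun n => (H n).phi_nonneg s
  have φlt : ∀ s, φ s < uStar h k := fun s =>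
    (le_of_tendsto' (hφ s) fun n => (hle n s).1).trans_lt (H'.phi_lt s)
  have ψge : ∀ s, ψ' s ≤ ψ s := fun s => ge_of_tendsto' (hψ s) fun n => (hle n s).2
  have ψgt : ∀ s, vStar h k < ψ s := fun s => (H'.lt_psi s).trans_le (ψge s)
  have ψpos : ∀ s, 0 < ψ s := fun s => hv0.trans (ψgt s)
  have ψle : ∀ s, ψ s ≤ 1 := fun s => le_of_tendsto' (hψ s) fun n => ((H n).psi_lt s).le
  have φmono : Monotone φ := fun a b hab =>
    le_of_tendsto_of_tendsto' (hφ a) (hφ b) fun n => (H n).phi_mono hab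
  have ψanti : Antitone ψ := fun a b hab =>
    le_of_tendsto_of_tendsto' (hψ b) (hψ a) fun n => (H n).psi_anti.antitone hab
  -- continuity
  have muφ : Measurable φ := φmono.measurable
  have muψ : Measurable ψ := ψanti.measurable
  have cφ : Continuous φ := by
    have hG := cont_lemma (a := φ 0) (m := m) (c := c) (u := φ)
      (q := fun s => φ s * (1 - φ s - k * ψ s)) (C := 1 + r / d) muφ
      (by fun_prop) (fun s => le_of_tendsto' (hφ s).abs fun n => bφ n s)
      (fun s => le_of_tendsto' (limf s).abs fun n => bf n s)
    have : φ = fun s => (fun s => φ 0 + ∫ t in (0:ℝ)..s, (m + c * φ t -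
        ∫ x in (0:ℝ)..t, φ x * (1 - φ x - k * ψ x))) (max s 0) := by
      ext s
      simp only
      rw [← intφ (max s 0) (mem_Ici.2 (le_max_right _ _))]
      rcases le_total s 0 with hs | hs
      · rw [max_eq_right hs, φ0 s hs, φ0 0 le_rfl]
      · rw [max_eq_left hs]
    rw [this]
    exact hG.comp (by fun_prop)
  have cψ : Continuous ψ := by
    have hG := cont_lemma (a := ψ 0) (m := m') (c := c / d) (u := ψ)
      (q := fun s => r / d * ψ s * (1 - ψ s - h * φ s)) (C := 1 + r / d) muψ
      (by fun_prop) (fun s => le_of_tendsto' (hψ s).abs fun n => bψ n s)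
      (fun s => le_of_tendsto' (limg s).abs fun n => bg n s)
    exact (funext fun s => intψ s (mem_univ s) : ψ = _) ▸ hG
  -- regularity
  obtain ⟨W, W2, φW, W0, Wode⟩ := reg_lemma (I := Ici (0:ℝ)) (mem_Ici.2 le_rfl) ordConnected_Ici cφ
    (by fun_prop) intφ
  obtain ⟨Z, Z2, ψZ, -, Zode⟩ := reg_lemma (I := (univ : Set ℝ)) (mem_univ _) ordConnected_univ cψ
    (by fun_prop) intψ
  have eZ : ψ = Z := funext fun s => ψZ s (mem_univ s)
  rw [← eZ] at Z2 Zode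
  clear ψZ
  have dWφ : ∀ s > 0, deriv φ s = deriv W s := fun s hs => by
    apply Filter.EventuallyEq.deriv_eq
    filter_upwards [Ioi_mem_nhds hs] with t ht using φW t (mem_Ici.2 (le_of_lt ht))
  have smφ : ContDiffOn ℝ 2 φ (Ici 0) := W2.contDiffOn.congr φW
  have dφ : ∀ s > 0, HasDerivAt φ (deriv φ s) s := fun s hs =>
    (contDiffAt_two_derivs (smφ.contDiffAt (Ici_mem_nhds hs))).1
  have ddφ : ∀ s > 0, HasDerivAt (deriv φ) (c * deriv φ s - φ s * (1 - φ s - k * ψ s)) s := by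
    intro s hs
    have h1 := (contDiffAt_two_derivs (smφ.contDiffAt (Ici_mem_nhds hs))).2
    have h2 : deriv (deriv φ) s = deriv (deriv W) s := by
      apply Filter.EventuallyEq.deriv_eq
      filter_upwards [Ioi_mem_nhds hs] with t ht using dWφ t ht
    refine h1.congr_deriv ?_
    rw [h2, Wode s (mem_Ici.2 (le_of_lt hs)), dWφ s hs]
  have dψ : ∀ s, HasDerivAt ψ (deriv ψ s) s := fun s =>
    (contDiffAt_two_derivs Z2.contDiffAt).1
  have ddψ : ∀ s, HasDerivAt (deriv ψ) (c / d * deriv ψ s - r / d * ψ s * (1 - ψ s - h * φ s)) s :=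
    fun s => (contDiffAt_two_derivs Z2.contDiffAt).2.congr_deriv (Zode s (mem_univ s))
  have hm' : derivWithin φ (Ici 0) 0 = m := by
    rw [derivWithin_congr φW (φW 0 (mem_Ici.2 le_rfl)),
      ((W2.differentiable (by norm_num)) 0).derivWithin (uniqueDiffOn_Ici 0 0 (mem_Ici.2 le_rfl)),
      W0, φ0 0 le_rfl]
    ring
  have φpos : ∀ s > 0, 0 < φ s := by
    intro s hs
    by_contra hcon
    have h0 : φ =ᶠ[nhds 0] fun _ => 0 := by
      filter_upwards [Iio_mem_nhds hs] with t ht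
      have := φmono (le_of_lt ht)
      linarith [φnn t]
    have h1 : HasDerivAt φ 0 0 := (hasDerivAt_const (0:ℝ) (0:ℝ)).congr_of_eventuallyEq h0
    rw [h1.hasDerivWithinAt.derivWithin (uniqueDiffOn_Ici 0 0 (mem_Ici.2 le_rfl))] at hm'
    linarith
  have dφnn : ∀ s, 0 ≤ deriv φ s := fun s => φmono.deriv_nonneg
  have dψnp : ∀ s, deriv ψ s ≤ 0 := fun s => ψanti.deriv_nonpos
  -- limits at infinity
  have limφ : ∃ a, Tendsto φ atTop (nhds a) :=
    ⟨_, tendsto_atTop_ciSup φmono ⟨uStar h k, by rintro _ ⟨s, rfl⟩; exact (φlt s).le⟩⟩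
  have limψ : ∃ b, Tendsto ψ atTop (nhds b) :=
    ⟨_, tendsto_atTop_ciInf ψanti ⟨vStar h k, by rintro _ ⟨s, rfl⟩; exact (ψgt s).le⟩⟩
  obtain ⟨a, ha⟩ := limφ
  obtain ⟨b, hb⟩ := limψ
  have apos : 0 < a := (φpos 1 one_pos).trans_le (φmono.ge_of_tendsto ha 1)
  have bpos : 0 < b := hv0.trans_le (ge_of_tendsto' hb fun s => (ψgt s).le)
  have z1 : a * (1 - a - k * b) = 0 :=
    asym_zero (u := φ) (v := deriv φ) (q := fun s => φ s * (1 - φ s - k * ψ s)) (c := c)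
      (C := 1 + r / d) (fun s _ => le_of_tendsto' (hφ s).abs fun n => bφ n s) dφ ddφ
      (ha.mul ((tendsto_const_nhds.sub ha).sub (hb.const_mul k)))
  have z2 : r / d * b * (1 - b - h * a) = 0 :=
    asym_zero (u := ψ) (v := deriv ψ) (q := fun s => r / d * ψ s * (1 - ψ s - h * φ s)) (c := c / d)
      (C := 1 + r / d) (fun s _ => le_of_tendsto' (hψ s).abs fun n => bψ n s) (fun s _ => dψ s)
      (fun s _ => ddψ s)
      ((hb.const_mul _).mul ((tendsto_const_nhds.sub hb).sub (ha.const_mul h)))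
  have z1' : 1 - a - k * b = 0 := (mul_eq_zero.1 z1).resolve_left apos.ne'
  have z2' : 1 - b - h * a = 0 := (mul_eq_zero.1 z2).resolve_left (mul_pos hrd bpos).ne'
  have hp : 0 < 1 - h * k := by nlinarith [hh.1, hh.2, hk.1, hk.2]
  have au : a = uStar h k := by
    unfold uStar; rw [eq_div_iff hp.ne']; linear_combination k * z2' - z1'
  have bv : b = vStar h k := by
    unfold vStar; rw [eq_div_iff hp.ne']; linear_combination h * z1' - z2'
  rw [au] at ha
  rw [bv] at hb
  -- strict upper bound of ψ
  have ψlt : ∀ s, ψ s < 1 := by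
    intro s0
    refine lt_of_le_of_ne (ψle s0) fun heq => ?_
    have hmax : IsLocalMax ψ s0 := Eventually.of_forall fun t => by rw [heq]; exact ψle t
    have hz := zero_of_ineq (u := fun s => 1 - ψ s) (v := fun s => - deriv ψ s)
      (w := fun s => -(c / d * deriv ψ s - r / d * ψ s * (1 - ψ s - h * φ s))) (a := s0)
      (c := c / d) (K := r / d) hrd.le (div_nonneg hc hd.le) (by fun_prop)
      (fun s _ => (ddψ s).continuousAt.neg.continuousWithinAt)
      (fun s _ => ((dψ s).const_sub 1)) (fun s _ => (ddψ s).neg)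
      (fun s _ => by linarith [ψle s]) (fun s _ => by
        have h1 : ψ s * (1 - ψ s - h * φ s) ≤ 1 - ψ s := by
          have := mul_nonneg (ψpos s).le (mul_nonneg hh.1.le (φnn s))
          nlinarith [ψle s, ψpos s]
        have := mul_le_mul_of_nonneg_left h1 hrd.le
        linarith)
      (by simp [heq]) (by simp [hmax.deriv_eq_zero])
    have : 1 ≤ vStar h k := by
      apply ge_of_tendsto hb
      filter_upwards [eventually_ge_atTop s0] with s hs
      linarith [hz s hs]
    linarith
  -- strict monotonicity
  have sφ : ∀ s > 0, deriv φ s = 0 → 1 - φ s - k * ψ s = 0 ∧ deriv ψ s = 0 := by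
    intro s hs h0
    have hE : HasDerivAt (fun s => c * deriv φ s - φ s * (1 - φ s - k * ψ s)) _ s :=
      ((ddφ s hs).const_mul c).sub
        ((dφ s hs).mul (((dφ s hs).const_sub 1).sub ((dψ s).const_mul k)))
    have hmin : IsLocalMin (deriv φ) s := Eventually.of_forall fun t => by rw [h0]; exact dφnn t
    obtain ⟨y1, y2⟩ := localMin_second (by
      filter_upwards [Ioi_mem_nhds hs] with t ht using ddφ t ht) hE hmin
    rw [h0] at y1 y2
    have y3 : 1 - φ s - k * ψ s = 0 := by
      have : φ s * (1 - φ s - k * ψ s) = 0 := by linarith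
      exact (mul_eq_zero.1 this).resolve_left (φpos s hs).ne'
    refine ⟨y3, le_antisymm (dψnp s) ?_⟩
    rw [y3] at y2
    have y4 : 0 ≤ (φ s * k) * deriv ψ s := by linarith
    exact nonneg_of_mul_nonneg_right y4 (mul_pos (φpos s hs) hk.1)
  have sψ : ∀ s, deriv ψ s = 0 → 1 - ψ s - h * φ s = 0 := by
    intro s h0
    have hmax : IsLocalMax (deriv ψ) s := Eventually.of_forall fun t => by rw [h0]; exact dψnp t
    have := hmax.hasDerivAt_eq_zero (ddψ s)
    rw [h0] at this
    have h1 : r / d * ψ s * (1 - ψ s - h * φ s) = 0 := by linarith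
    exact (mul_eq_zero.1 h1).resolve_left (mul_pos hrd (ψpos s)).ne'
  have sφ' : ∀ s > 0, deriv φ s ≠ 0 := by
    intro s hs h0
    obtain ⟨y1, y2⟩ := sφ s hs h0
    have y3 := sψ s y2
    have : φ s = uStar h k := by
      unfold uStar; rw [eq_div_iff hp.ne']; linear_combination k * y3 - y1
    linarith [φlt s]
  have sψ' : ∀ s, deriv ψ s ≠ 0 := by
    intro s h0
    have y3 := sψ s h0
    rcases le_or_gt s 0 with hs | hs
    · rw [φ0 s hs] at y3
      linarith [ψlt s]
    have hE : HasDerivAt (fun s => c / d * deriv ψ s - r / d * ψ s * (1 - ψ s - h * φ s)) _ s :=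
      ((ddψ s).const_mul (c / d)).sub
        (((dψ s).const_mul (r / d)).mul (((dψ s).const_sub 1).sub ((dφ s hs).const_mul h)))
    have hmax : IsLocalMax (deriv ψ) s := Eventually.of_forall fun t => by rw [h0]; exact dψnp t
    obtain ⟨y1, y2⟩ := localMax_second (Eventually.of_forall ddψ) hE hmax
    rw [h0, y3] at y2
    have y4 : (r / d * ψ s * h) * deriv φ s ≤ 0 := by linarith
    have y5 : 0 < (r / d * ψ s * h) * deriv φ s :=
      mul_pos (mul_pos (mul_pos hrd (ψpos s)) hh.1) (lt_of_le_of_ne (dφnn s) (sφ' s hs).symm)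
    linarith
  refine ⟨⟨cφ, smφ, φ0, Z2, ?_, ?_, ?_, ?_, ?_, ha, hb⟩, hm'⟩
  · intro s hs
    rw [(ddφ s hs).deriv]; ring
  · intro s hs
    exact lt_of_le_of_ne (dφnn s) (sφ' s hs).symm
  · intro s
    rw [(ddψ s).deriv]; field_simp; ring
  · intro s
    exact lt_of_le_of_ne (dψnp s) (sψ' s)
  · exact tendsto_of_tendsto_of_tendsto_of_le_of_le H'.psi_atBot tendsto_const_nhds ψge ψle

theorem stmt12 (d r h k cs : ℝ) (hd : 0 < d) (hr : 0 < r)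
    (hh : h ∈ Set.Ioo (0:ℝ) 1) (hk : k ∈ Set.Ioo (0:ℝ) 1) (hcs : 0 < cs)
    -- a semi-wave with speed `c ≥ 0` exists iff `c < cs`
    (hiff : ∀ c : ℝ, 0 ≤ c → ((∃ φ ψ : ℝ → ℝ, IsSemiWave d r h k c φ ψ) ↔ c < cs))
    -- `(Φ c, Ψ c)` is the unique semi-wave with speed `c ∈ [0, cs)`
    (Φ Ψ : ℝ → ℝ → ℝ)
    (hsw : ∀ c : ℝ, 0 ≤ c → c < cs → IsSemiWave d r h k c (Φ c) (Ψ c))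
    (huniq : ∀ c : ℝ, 0 ≤ c → c < cs →
      ∀ φ ψ : ℝ → ℝ, IsSemiWave d r h k c φ ψ → φ = Φ c ∧ ψ = Ψ c) :
    ∃ cγ : ℝ → ℝ,
      (∀ γ : ℝ, 0 < γ →
        cγ γ ∈ Set.Ioo 0 cs ∧
        γ * derivWithin (Φ (cγ γ)) (Set.Ici 0) 0 = cγ γ ∧
        (∀ c' : ℝ, c' ∈ Set.Ioo 0 cs →
          γ * derivWithin (Φ c') (Set.Ici 0) 0 = c' → c' = cγ γ)) ∧
      StrictMonoOn cγ (Set.Ioi 0) ∧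
      Filter.Tendsto cγ Filter.atTop (nhds cs) := by
  have comp : ∀ c₁ c₂, 0 ≤ c₁ → c₁ < c₂ → c₂ < cs → ∀ s, Φ c₂ s ≤ Φ c₁ s ∧ Ψ c₁ s ≤ Ψ c₂ s :=
    fun c₁ c₂ h0 h1 h2 => wave_comparison hd hr hh hk (hsw c₁ h0 (h1.trans h2))
      (hsw c₂ (h0.trans h1.le) h2) h1
  have comp' : ∀ c₁ c₂, 0 ≤ c₁ → c₁ ≤ c₂ → c₂ < cs → ∀ s, Φ c₂ s ≤ Φ c₁ s ∧ Ψ c₁ s ≤ Ψ c₂ s := by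
    intro c₁ c₂ h0 h1 h2 s
    rcases h1.eq_or_lt with h3 | h3
    · subst h3; exact ⟨le_rfl, le_rfl⟩
    · exact comp c₁ c₂ h0 h3 h2 s
  set m : ℝ → ℝ := fun c => derivWithin (Φ c) (Set.Ici 0) 0 with hmdef
  have mpos : ∀ c, 0 ≤ c → c < cs → 0 < m c := fun c h0 h1 => (hsw c h0 h1).m_pos hh hk h0
  have manti : ∀ c₁ c₂, 0 ≤ c₁ → c₁ ≤ c₂ → c₂ < cs → m c₂ ≤ m c₁ := by
    intro c₁ c₂ h0 h1 h2
    have H₁ := hsw c₁ h0 (h1.trans_lt h2)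
    have H₂ := hsw c₂ (h0.trans h1) h2
    have D₁ : HasDerivWithinAt (Φ c₁) (m c₁) (Ici 0) 0 :=
      ((H₁.smooth_phi.differentiableOn (by norm_num)) 0 (mem_Ici.2 le_rfl)).hasDerivWithinAt
    have D₂ : HasDerivWithinAt (Φ c₂) (m c₂) (Ici 0) 0 :=
      ((H₂.smooth_phi.differentiableOn (by norm_num)) 0 (mem_Ici.2 le_rfl)).hasDerivWithinAt
    have T₁ := hasDerivWithinAt_iff_tendsto_slope.1 D₁
    have T₂ := hasDerivWithinAt_iff_tendsto_slope.1 D₂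
    rw [show Ici (0:ℝ) \ {0} = Ioi 0 by ext x; simp [lt_iff_le_and_ne, eq_comm]] at T₁ T₂
    refine le_of_tendsto_of_tendsto T₂ T₁ ?_
    filter_upwards [self_mem_nhdsWithin] with s hs
    have hs0 : (0:ℝ) < s := hs
    rw [slope_def_field, slope_def_field, H₁.phi_zero 0 le_rfl, H₂.phi_zero 0 le_rfl]
    exact div_le_div_of_nonneg_right (by linarith [(comp' c₁ c₂ h0 h1 h2 s).1]) (by linarith)
  -- limits along monotone sequences
  have lim : ∀ (C : ℕ → ℝ) (c e : ℝ), (Monotone C ∨ Antitone C) → (∀ n, 0 ≤ C n ∧ C n < cs) →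
      Tendsto C atTop (nhds c) → 0 < e → (∀ n, e ≤ m (C n)) →
      c < cs ∧ Tendsto (fun n => m (C n)) atTop (nhds (m c)) := by
    intro C c e hmon hC hlim he hem
    have hc0 : 0 ≤ c := ge_of_tendsto' hlim fun n => (hC n).1
    have HC : ∀ n, IsSemiWave d r h k (C n) (Φ (C n)) (Ψ (C n)) := fun n => hsw _ (hC n).1 (hC n).2
    have bdφ : ∀ s n, |Φ (C n) s| ≤ 1 := fun s n => by
      obtain ⟨-, -, hu0, hu1, hv0, hv1⟩ := star_eqs hh hk
      rw [abs_of_nonneg ((HC n).phi_nonneg s)]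
      linarith [(HC n).phi_lt s]
    have bdψ : ∀ s n, |Ψ (C n) s| ≤ 1 := fun s n => by
      obtain ⟨-, -, hu0, hu1, hv0, hv1⟩ := star_eqs hh hk
      rw [abs_of_nonneg (by linarith [(HC n).lt_psi s])]
      linarith [(HC n).psi_lt s]
    have conv : ∀ f : ℕ → ℝ, (∀ n, |f n| ≤ 1) → (Monotone f ∨ Antitone f) →
        ∃ l, Tendsto f atTop (nhds l) := by
      intro f hf hm
      rcases hm with hm | hm
      · exact ⟨_, tendsto_atTop_ciSup hm ⟨1, by rintro _ ⟨n, rfl⟩; exact (abs_le.1 (hf n)).2⟩⟩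
      · exact ⟨_, tendsto_atTop_ciInf hm ⟨-1, by rintro _ ⟨n, rfl⟩; exact (abs_le.1 (hf n)).1⟩⟩
    have exφ : ∀ s, ∃ l, Tendsto (fun n => Φ (C n) s) atTop (nhds l) := by
      intro s
      apply conv _ (bdφ s)
      rcases hmon with hm | hm
      · exact Or.inr fun a b hab => (comp' _ _ (hC a).1 (hm hab) (hC b).2 s).1
      · exact Or.inl fun a b hab => (comp' _ _ (hC b).1 (hm hab) (hC a).2 s).1
    have exψ : ∀ s, ∃ l, Tendsto (fun n => Ψ (C n) s) atTop (nhds l) := by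
      intro s
      apply conv _ (bdψ s)
      rcases hmon with hm | hm
      · exact Or.inl fun a b hab => (comp' _ _ (hC a).1 (hm hab) (hC b).2 s).2
      · exact Or.inr fun a b hab => (comp' _ _ (hC b).1 (hm hab) (hC a).2 s).2
    choose φ hφ using exφ
    choose ψ hψ using exψ
    obtain ⟨l, hl, hw⟩ := limit_wave hd hr hh hk hc0 HC hlim hφ hψ (hsw 0 le_rfl hcs)
      (fun n s => comp' 0 (C n) le_rfl (hC n).1 (hC n).2 s)
    have hl0 : 0 < l := he.trans_le (ge_of_tendsto' hl hem)
    obtain ⟨w1, w2⟩ := hw hl0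
    have hccs : c < cs := (hiff c hc0).1 ⟨φ, ψ, w1⟩
    refine ⟨hccs, ?_⟩
    have := (huniq c hc0 hccs φ ψ w1).1
    have hmc : m c = l := by simp only [hmdef]; rw [← this, w2]
    rw [hmc]; exact hl
  -- right limit
  have right_lim : ∀ c, 0 ≤ c → c < cs → ∀ γ > 0, (∀ c', c < c' → c' < cs → γ * m c' ≤ c') →
      γ * m c ≤ c := by
    intro c h0 h1 γ hγ hF
    obtain ⟨C, Ca, Cm, Cl⟩ := exists_seq_strictAnti_tendsto' (show c < (c + cs) / 2 by linarith)
    have hb : ∀ n, c < C n ∧ C n < (c + cs) / 2 := fun n => Cm n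
    obtain ⟨-, hl⟩ := lim C c (m ((c + cs) / 2)) (Or.inr Ca.antitone)
      (fun n => ⟨by linarith [(hb n).1], by linarith [(hb n).2]⟩) Cl
      (mpos _ (by linarith) (by linarith))
      (fun n => manti _ _ (by linarith [(hb n).1]) (hb n).2.le (by linarith))
    exact le_of_tendsto_of_tendsto' (hl.const_mul γ) Cl
      fun n => hF _ (hb n).1 (by linarith [(hb n).2])
  have left_lim : ∀ c, 0 < c → c ≤ cs → ∀ γ > 0, (∀ c', 0 < c' → c' < c → c' ≤ γ * m c') →
      c < cs ∧ c ≤ γ * m c := by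
    intro c h0 h1 γ hγ hF
    obtain ⟨C, Ca, Cm, Cl⟩ := exists_seq_strictMono_tendsto' (show c / 2 < c by linarith)
    have hb : ∀ n, c / 2 < C n ∧ C n < c := fun n => Cm n
    obtain ⟨h2, hl⟩ := lim C c (c / 2 / γ) (Or.inl Ca.monotone)
      (fun n => ⟨by linarith [(hb n).1], by linarith [(hb n).2]⟩) Cl
      (by positivity)
      (fun n => by
        rw [div_le_iff₀ hγ]
        have := hF (C n) (by linarith [(hb n).1]) (hb n).2
        linarith [(hb n).1])
    exact ⟨h2, le_of_tendsto_of_tendsto' Cl (hl.const_mul γ)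
      fun n => hF _ (by linarith [(hb n).1]) (hb n).2⟩
  have exist : ∀ γ : ℝ, 0 < γ → ∃ c, c ∈ Set.Ioo 0 cs ∧ γ * m c = c := by
    intro γ hγ
    set T : Set ℝ := {c | 0 ≤ c ∧ c < cs ∧ c ≤ γ * m c} with hT
    have T0 : (0:ℝ) ∈ T := ⟨le_rfl, hcs, (mul_pos hγ (mpos 0 le_rfl hcs)).le⟩
    have Tb : BddAbove T := ⟨cs, fun c hc => hc.2.1.le⟩
    have b0 : 0 ≤ sSup T := le_csSup Tb T0
    have b1 : sSup T ≤ cs := csSup_le ⟨0, T0⟩ fun c hc => hc.2.1.le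
    have below : ∀ c', 0 < c' → c' < sSup T → c' ≤ γ * m c' := by
      intro c' h0 h1
      obtain ⟨c, hc, hlt⟩ := exists_lt_of_lt_csSup ⟨0, T0⟩ h1
      have := manti c' c h0.le hlt.le hc.2.1
      have := mul_le_mul_of_nonneg_left this hγ.le
      linarith [hc.2.2]
    have above : ∀ c', sSup T < c' → c' < cs → γ * m c' ≤ c' := by
      intro c' h0 h1
      by_contra hcon
      exact absurd (le_csSup Tb ⟨b0.trans h0.le, h1, (not_le.1 hcon).le⟩) (not_le.2 h0)
    have pos : 0 < sSup T := by
      rcases b0.lt_or_eq with h0 | h0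
      · exact h0
      · exfalso
        rw [← h0] at above
        have := right_lim 0 le_rfl hcs γ hγ above
        have := mul_pos hγ (mpos 0 le_rfl hcs)
        linarith
    obtain ⟨h1, h2⟩ := left_lim _ pos b1 γ hγ below
    exact ⟨sSup T, ⟨pos, h1⟩, le_antisymm (right_lim _ b0 h1 γ hγ above) h2⟩
  -- strict comparison: `c₁ ≤ γ m(c₁)`, `γ' m(c₂) ≤ c₂` etc.
  have key : ∀ γ c₁ c₂, 0 < γ → 0 < c₁ → c₁ ≤ c₂ → c₂ < cs → c₂ ≤ γ * m c₂ → γ * m c₁ ≤ c₁ →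
      c₁ = c₂ := by
    intro γ c₁ c₂ hγ h0 h1 h2 h3 h4
    have := mul_le_mul_of_nonneg_left (manti c₁ c₂ h0.le h1 h2) hγ.le
    linarith
  choose! cγ hcγ using exist
  have mono : StrictMonoOn cγ (Set.Ioi 0) := by
    intro γ₁ g1 γ₂ g2 hlt
    have p1 : 0 < γ₁ := g1
    have p2 : 0 < γ₂ := g2
    obtain ⟨m1, q1⟩ := hcγ γ₁ p1
    obtain ⟨m2, q2⟩ := hcγ γ₂ p2
    by_contra hcon
    have hcon := not_lt.1 hcon
    have a1 := manti _ _ m2.1.le hcon m1.2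
    have a2 := mpos _ m1.1.le m1.2
    nlinarith
  refine ⟨cγ, ?_, mono, ?_⟩
  · intro γ hγ
    obtain ⟨m1, q1⟩ := hcγ γ hγ
    refine ⟨m1, q1, ?_⟩
    intro c' hc' hq
    have hq' : γ * m c' = c' := hq
    rcases le_total c' (cγ γ) with hle | hle
    · exact key γ _ _ hγ hc'.1 hle m1.2 q1.ge hq'.le
    · exact (key γ _ _ hγ m1.1 hle hc'.2 hq'.ge q1.le).symm
  · rw [tendsto_order]
    constructor
    · intro a ha
      set b := max a (cs / 2) with hb
      have b1 : b < cs := max_lt ha (by linarith)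
      have b0 : 0 < b := lt_of_lt_of_le (by linarith) (le_max_right _ _)
      have mb := mpos b b0.le b1
      filter_upwards [eventually_gt_atTop (b / m b), eventually_gt_atTop 0] with γ h1 h2
      obtain ⟨m1, q1⟩ := hcγ γ h2
      refine lt_of_le_of_lt (le_max_left a (cs / 2)) ?_
      rw [← hb]
      by_contra hcon
      have hcon := not_lt.1 hcon
      have a1 := manti _ _ m1.1.le hcon b1
      rw [div_lt_iff₀ mb] at h1
      have := mul_le_mul_of_nonneg_left a1 h2.le
      linarith
    · intro a ha
      filter_upwards [eventually_gt_atTop 0] with γ h2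
      exact (hcγ γ h2).1.2.trans ha
end

section
/- Fix constants d, r > 0 and h, k ∈ (0,1). Assume there exists c* ≥ 2√(1-k) such that for every c ≥ 0 an entire wave with speed c exists if and only if c ≥ c*. Then for every c with 0 ≤ c < c* there exists exactly one semi-wave with speed c, and for every c ≥ c* there is no semi-wave with speed c. -/
open Real Filter Set

/-- An entire (traveling) wave with speed `c` for the system
`Φ'' - cΦ' + Φ(1 - Φ - kΨ) = 0`, `dΨ'' - cΨ' + rΨ(1 - Ψ - hΦ) = 0` on `ℝ`,
with `(Φ,Ψ)(-∞) = (0,1)` and `(Φ,Ψ)(∞) = (u*, v*)`. -/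
structure IsEntireWave (d r h k c : ℝ) (Φ Ψ : ℝ → ℝ) : Prop where
  smooth_Phi : ContDiff ℝ 2 Φ
  smooth_Psi : ContDiff ℝ 2 Ψ
  ode_Phi : ∀ s : ℝ,
    deriv (deriv Φ) s - c * deriv Φ s + Φ s * (1 - Φ s - k * Ψ s) = 0
  Phi_deriv_pos : ∀ s : ℝ, 0 < deriv Φ s
  ode_Psi : ∀ s : ℝ,
    d * deriv (deriv Ψ) s - c * deriv Ψ s + r * Ψ s * (1 - Ψ s - h * Φ s) = 0
  Psi_deriv_neg : ∀ s : ℝ, deriv Ψ s < 0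
  Phi_atBot : Filter.Tendsto Φ Filter.atBot (nhds 0)
  Psi_atBot : Filter.Tendsto Ψ Filter.atBot (nhds 1)
  Phi_atTop : Filter.Tendsto Φ Filter.atTop (nhds (uStar h k))
  Psi_atTop : Filter.Tendsto Ψ Filter.atTop (nhds (vStar h k))

section

lemma sw_roots (c K : ℝ) (hK : 0 < K) : ∃ α β : ℝ, 0 < α ∧ 0 < β ∧ β - α = c ∧ α * β = K := by
  have h1 : 0 ≤ c ^ 2 + 4 * K := by positivity
  have h2 := Real.sq_sqrt h1
  have h3 : |c| < Real.sqrt (c ^ 2 + 4 * K) := by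
    apply Real.lt_sqrt_of_sq_lt
    rw [sq_abs]; linarith
  have h4 := abs_lt.1 h3
  refine ⟨(-c + Real.sqrt (c ^ 2 + 4 * K)) / 2, (c + Real.sqrt (c ^ 2 + 4 * K)) / 2,
    by linarith, by linarith, by ring, by nlinarith⟩

/-- second derivative test at a local minimum -/
lemma sw_second {p p1 : ℝ → ℝ} {s0 p2 : ℝ} (hm : IsLocalMin p s0)
    (h1 : ∀ᶠ s in nhds s0, HasDerivAt p (p1 s) s) (h2 : HasDerivAt p1 p2 s0) :
    p1 s0 = 0 ∧ 0 ≤ p2 := by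
  have e1 : p1 s0 = 0 := hm.hasDerivAt_eq_zero h1.self_of_nhds
  refine ⟨e1, ?_⟩
  by_contra hneg
  push Not at hneg
  have ed : deriv p =ᶠ[nhds s0] p1 := h1.mono fun s hs => hs.deriv
  have hdd : deriv (deriv p) s0 = p2 := by
    rw [ed.deriv_eq]; exact h2.deriv
  have hmax : IsLocalMax p s0 := by
    apply isLocalMax_of_deriv_deriv_neg
    · rw [hdd]; exact hneg
    · rw [h1.self_of_nhds.deriv, e1]
    · exact h1.self_of_nhds.continuousAt
  have hc : p =ᶠ[nhds s0] fun _ => p s0 := by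
    filter_upwards [hm, hmax] with s a b
    exact le_antisymm b a
  have hc1 : deriv p =ᶠ[nhds s0] fun _ => 0 := by
    have := hc.deriv
    simpa using this
  have : deriv (deriv p) s0 = 0 := by
    rw [hc1.deriv_eq]; simp
  linarith

/-- strong maximum principle, to the right -/
lemma sw_smp {c K s0 t : ℝ} (hK : 0 < K) (hst : s0 ≤ t) {p p1 p2 : ℝ → ℝ}
    (h1 : ∀ s ∈ Icc s0 t, HasDerivAt p (p1 s) s)
    (h2 : ∀ s ∈ Icc s0 t, HasDerivAt p1 (p2 s) s)
    (h3 : ∀ s ∈ Icc s0 t, p2 s ≤ c * p1 s + K * p s)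
    (h4 : p s0 = 0) (h5 : p1 s0 = 0) : p t ≤ 0 := by
  obtain ⟨α, β, hα, hβ, e1, e2⟩ := sw_roots c K hK
  have dα : ∀ s, HasDerivAt (fun s => Real.exp (α * s)) (Real.exp (α * s) * α) s := fun s => by
    simpa using ((hasDerivAt_id s).const_mul α).exp
  have dβ : ∀ s, HasDerivAt (fun s => Real.exp (-β * s)) (Real.exp (-β * s) * (-β)) s := fun s => by
    simpa using ((hasDerivAt_id s).const_mul (-β)).exp
  have D1 : ∀ s ∈ Icc s0 t, HasDerivAt (fun s => Real.exp (α * s) * (p1 s - β * p s))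
      (Real.exp (α * s) * α * (p1 s - β * p s) + Real.exp (α * s) * (p2 s - β * p1 s)) s :=
    fun s hs => (dα s).mul ((h2 s hs).sub ((h1 s hs).const_mul β))
  have A1 : AntitoneOn (fun s => Real.exp (α * s) * (p1 s - β * p s)) (Icc s0 t) := by
    apply antitoneOn_of_deriv_nonpos (convex_Icc _ _)
    · exact fun s hs => (D1 s hs).continuousAt.continuousWithinAt
    · intro s hs; rw [interior_Icc] at hs
      exact (D1 s (Ioo_subset_Icc_self hs)).differentiableAt.differentiableWithinAt
    · intro s hs; rw [interior_Icc] at hs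
      rw [(D1 s (Ioo_subset_Icc_self hs)).deriv]
      have := h3 s (Ioo_subset_Icc_self hs)
      have h6 : Real.exp (α * s) * α * (p1 s - β * p s) + Real.exp (α * s) * (p2 s - β * p1 s)
        = Real.exp (α * s) * (p2 s - c * p1 s - K * p s) := by rw [← e1, ← e2]; ring
      rw [h6]
      exact mul_nonpos_of_nonneg_of_nonpos (Real.exp_pos _).le (by linarith)
  have B1 : ∀ s ∈ Icc s0 t, p1 s - β * p s ≤ 0 := by
    intro s hs
    have := A1 (left_mem_Icc.2 hst) hs hs.1
    simp only [h4, h5] at this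
    have h7 := Real.exp_pos (α * s)
    by_contra hc
    push Not at hc
    have := mul_pos h7 hc
    linarith
  have D2 : ∀ s ∈ Icc s0 t, HasDerivAt (fun s => Real.exp (-β * s) * p s)
      (Real.exp (-β * s) * (-β) * p s + Real.exp (-β * s) * p1 s) s :=
    fun s hs => (dβ s).mul (h1 s hs)
  have A2 : AntitoneOn (fun s => Real.exp (-β * s) * p s) (Icc s0 t) := by
    apply antitoneOn_of_deriv_nonpos (convex_Icc _ _)
    · exact fun s hs => (D2 s hs).continuousAt.continuousWithinAt
    · intro s hs; rw [interior_Icc] at hs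
      exact (D2 s (Ioo_subset_Icc_self hs)).differentiableAt.differentiableWithinAt
    · intro s hs; rw [interior_Icc] at hs
      rw [(D2 s (Ioo_subset_Icc_self hs)).deriv]
      have := B1 s (Ioo_subset_Icc_self hs)
      have h6 : Real.exp (-β * s) * (-β) * p s + Real.exp (-β * s) * p1 s
        = Real.exp (-β * s) * (p1 s - β * p s) := by ring
      rw [h6]
      exact mul_nonpos_of_nonneg_of_nonpos (Real.exp_pos _).le this
  have := A2 (left_mem_Icc.2 hst) (right_mem_Icc.2 hst) hst
  simp only [h4, mul_zero] at this
  by_contra hc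
  push Not at hc
  have := mul_pos (Real.exp_pos (-β * t)) hc
  linarith

/-- strong maximum principle, to the left -/
lemma sw_smp_left {c K s0 t : ℝ} (hK : 0 < K) (hst : t ≤ s0) {p p1 p2 : ℝ → ℝ}
    (h1 : ∀ s ∈ Icc t s0, HasDerivAt p (p1 s) s)
    (h2 : ∀ s ∈ Icc t s0, HasDerivAt p1 (p2 s) s)
    (h3 : ∀ s ∈ Icc t s0, p2 s ≤ c * p1 s + K * p s)
    (h4 : p s0 = 0) (h5 : p1 s0 = 0) : p t ≤ 0 := by
  have key := sw_smp (c := -c) (K := K) (s0 := -s0) (t := -t) hK (by linarith)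
    (p := fun s => p (-s)) (p1 := fun s => - p1 (-s)) (p2 := fun s => p2 (-s)) ?_ ?_ ?_
    (by simpa using h4) (by simpa using h5)
  · simpa using key
  · intro s hs
    have := (h1 (-s) ⟨by linarith [hs.2], by linarith [hs.1]⟩).comp s (hasDerivAt_neg s)
    simpa [Function.comp_def] using this
  · intro s hs
    have := ((h2 (-s) ⟨by linarith [hs.2], by linarith [hs.1]⟩).comp s (hasDerivAt_neg s)).neg
    simp only [mul_neg, mul_one, neg_neg] at this
    exact this
  · intro s hs
    have := h3 (-s) ⟨by linarith [hs.2], by linarith [hs.1]⟩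
    linarith

/-- common part of semi-waves and entire waves, in terms of `w = 1 - ψ` -/
structure SwProf (d r h k c U : ℝ) (φ φ1 w w1 : ℝ → ℝ) : Prop where
  cont : Continuous φ
  mono : Monotone φ
  nonneg : ∀ s, 0 ≤ φ s
  lt : ∀ s, φ s < U
  wmono : Monotone w
  wnonneg : ∀ s, 0 ≤ w s
  wlt : ∀ s, w s < h * U
  d1 : ∀ s, 0 < φ s → HasDerivAt φ (φ1 s) s
  d2 : ∀ s, 0 < φ s → HasDerivAt φ1 (c * φ1 s - φ s * (1 - k - φ s + k * w s)) s
  e1 : ∀ s, HasDerivAt w (w1 s) s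
  e2 : ∀ s, HasDerivAt w1 ((c * w1 s + r * (1 - w s) * (w s - h * φ s)) / d) s
  top : Tendsto φ atTop (nhds U)
  wbot : Tendsto w atBot (nhds 0)
  wtop : Tendsto w atTop (nhds (h * U))

lemma SwProf.wcont {d r h k c U : ℝ} {φ φ1 w w1 : ℝ → ℝ} (P : SwProf d r h k c U φ φ1 w w1) :
    Continuous w := continuous_iff_continuousAt.2 fun s => (P.e1 s).continuousAt

lemma SwProf.shift {d r h k c U : ℝ} {φ φ1 w w1 : ℝ → ℝ} (P : SwProf d r h k c U φ φ1 w w1) (τ : ℝ) :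
    SwProf d r h k c U (fun s => φ (s + τ)) (fun s => φ1 (s + τ)) (fun s => w (s + τ))
      (fun s => w1 (s + τ)) where
  cont := P.cont.comp (continuous_id.add continuous_const)
  mono := fun a b hab => P.mono (by linarith)
  nonneg := fun s => P.nonneg _
  lt := fun s => P.lt _
  wmono := fun a b hab => P.wmono (by linarith)
  wnonneg := fun s => P.wnonneg _
  wlt := fun s => P.wlt _
  d1 := fun s hs => (P.d1 _ hs).comp_add_const s τ
  d2 := fun s hs => (P.d2 _ hs).comp_add_const s τ
  e1 := fun s => (P.e1 _).comp_add_const s τ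
  e2 := fun s => (P.e2 _).comp_add_const s τ
  top := P.top.comp (tendsto_atTop_add_const_right _ _ tendsto_id)
  wbot := P.wbot.comp (tendsto_atBot_add_const_right _ _ tendsto_id)
  wtop := P.wtop.comp (tendsto_atTop_add_const_right _ _ tendsto_id)

/-- propagate the order from a compact set to the whole line -/
lemma sw_ends {d r h k c U M : ℝ} {φ φ1 w w1 Φ Φ1 W W1 : ℝ → ℝ} (hd : 0 < d) (hr : 0 < r)
    (hh : 0 < h) (hh1 : h < 1) (hk : 0 < k) (hU : h * U < 1)
    (P : SwProf d r h k c U φ φ1 w w1) (Q : SwProf d r h k c U Φ Φ1 W W1)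
    (hz : ∀ s ≤ 0, φ s = 0) (hp : ∀ s > 0, 0 < φ s) (hM : 0 ≤ M) (hQM : 0 < Φ M)
    (c1 : ∀ s ≥ M, 1 - k - φ s + k * w s < (1 - k) * Φ s)
    (c2 : ∀ s ≥ M, w s - h * φ s < (1 - h * U) * (1 - h))
    (c3 : ∀ s ≤ -M, w s < 1 / 2)
    (i1 : ∀ s ∈ Icc 0 M, φ s ≤ Φ s) (i2 : ∀ s ∈ Icc (-M) M, w s ≤ W s) :
    (∀ s, φ s ≤ Φ s) ∧ (∀ s, w s ≤ W s) := by
  suffices hmain : ∀ s, 0 ≤ min (Φ s - φ s) (W s - w s) by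
    refine ⟨fun s => ?_, fun s => ?_⟩
    · linarith [(le_min_iff.1 (hmain s)).1]
    · linarith [(le_min_iff.1 (hmain s)).2]
  by_contra hcon
  push Not at hcon
  obtain ⟨s1, hs1⟩ := hcon
  have hpl : ∀ s ≤ 0, 0 ≤ Φ s - φ s := fun s hs => by rw [hz s hs]; linarith [Q.nonneg s]
  have hcont : Continuous fun s => min (Φ s - φ s) (W s - w s) :=
    (Q.cont.sub P.cont).min (Q.wcont.sub P.wcont)
  obtain ⟨s0, hs0⟩ := hcont.exists_forall_le' s1 (by
    rw [cocompact_eq_atBot_atTop, eventually_sup]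
    constructor
    · have t1 : Tendsto (fun s => W s - w s) atBot (nhds 0) := by simpa using Q.wbot.sub P.wbot
      filter_upwards [t1.eventually_const_lt hs1, eventually_le_atBot 0] with s a b
      exact le_min (hs1.le.trans (hpl s b)) a.le
    · have t1 : Tendsto (fun s => W s - w s) atTop (nhds 0) := by simpa using Q.wtop.sub P.wtop
      have t2 : Tendsto (fun s => Φ s - φ s) atTop (nhds 0) := by simpa using Q.top.sub P.top
      filter_upwards [t1.eventually_const_lt hs1, t2.eventually_const_lt hs1] with s a b
      exact le_min b.le a.le)
  have hneg : min (Φ s0 - φ s0) (W s0 - w s0) < 0 := lt_of_le_of_lt (hs0 s1) hs1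
  have hW1 := Q.wlt s0
  have hw1 := P.wlt s0
  have lmq : W s0 - w s0 ≤ Φ s0 - φ s0 → IsLocalMin (fun s => W s - w s) s0 := fun hle => by
    refine Eventually.of_forall fun s => ?_
    have := hs0 s
    rw [min_eq_right hle] at this
    exact this.trans (min_le_right _ _)
  have lmp : Φ s0 - φ s0 ≤ W s0 - w s0 → IsLocalMin (fun s => Φ s - φ s) s0 := fun hle => by
    refine Eventually.of_forall fun s => ?_
    have := hs0 s
    rw [min_eq_left hle] at this
    exact this.trans (min_le_left _ _)
  have secq := fun hle => sw_second (lmq hle)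
    (Eventually.of_forall fun s => (Q.e1 s).sub (P.e1 s)) ((Q.e2 s0).sub (P.e2 s0))
  have secq' : W s0 - w s0 ≤ Φ s0 - φ s0 → 
      0 ≤ (1 - W s0) * (W s0 - h * Φ s0) - (1 - w s0) * (w s0 - h * φ s0) := fun hle => by
    obtain ⟨a, b⟩ := secq hle
    rw [← sub_div] at b
    have b' : 0 ≤ c * W1 s0 + r * (1 - W s0) * (W s0 - h * Φ s0) -
      (c * w1 s0 + r * (1 - w s0) * (w s0 - h * φ s0)) := by
      by_contra hc
      push Not at hc
      have := div_neg_of_neg_of_pos hc hd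
      linarith
    have a' : W1 s0 = w1 s0 := by simpa [sub_eq_zero] using a
    rw [a'] at b'
    by_contra hc
    push Not at hc
    have := mul_neg_of_pos_of_neg hr hc
    linarith
  rcases lt_or_ge s0 (-M) with hl | hl
  · -- left
    have hps := hpl s0 (by linarith)
    have hle : W s0 - w s0 ≤ Φ s0 - φ s0 := by
      by_contra hc
      push Not at hc
      rw [min_eq_left hc.le] at hneg
      linarith
    rw [min_eq_right hle] at hneg
    have h0 := secq' hle
    rw [hz s0 (by linarith)] at h0
    have hw2 := c3 s0 hl.le
    have h1 : 0 ≤ (1 - W s0) * (h * Φ s0) :=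
      mul_nonneg (by linarith) (mul_nonneg hh.le (Q.nonneg _))
    have h2 : (W s0 - w s0) * (1 - W s0 - w s0) < 0 :=
      mul_neg_of_neg_of_pos hneg (by linarith)
    nlinarith
  rcases le_or_gt s0 M with hr' | hr'
  · have hq := i2 s0 ⟨hl, hr'⟩
    have hp0 : 0 ≤ Φ s0 - φ s0 := by
      rcases le_or_gt s0 0 with h0 | h0
      · exact hpl s0 h0
      · linarith [i1 s0 ⟨h0.le, hr'⟩]
    have := le_min hp0 (sub_nonneg.2 hq)
    linarith
  · have hφpos := hp s0 (by linarith)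
    have hΦpos : 0 < Φ s0 := lt_of_lt_of_le hQM (Q.mono hr'.le)
    rcases le_total (Φ s0 - φ s0) (W s0 - w s0) with hle | hle
    · rw [min_eq_left hle] at hneg
      have hA := c1 s0 hr'.le
      have ev : ∀ᶠ s in nhds s0, HasDerivAt (fun s => Φ s - φ s) (Φ1 s - φ1 s) s := by
        filter_upwards [P.cont.continuousAt.eventually_const_lt hφpos,
          Q.cont.continuousAt.eventually_const_lt hΦpos] with s a b
        exact (Q.d1 s b).sub (P.d1 s a)
      obtain ⟨a, b⟩ := sw_second (lmp hle) ev ((Q.d2 s0 hΦpos).sub (P.d2 s0 hφpos))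
      have a' : Φ1 s0 = φ1 s0 := by simpa [sub_eq_zero] using a
      rw [a'] at b
      obtain ⟨ε, hε⟩ : ∃ ε, ε = φ s0 - Φ s0 := ⟨_, rfl⟩
      have hεp : 0 < ε := by linarith
      have h1 : Φ s0 * (k * (W s0 - w s0 + ε)) ≥ 0 :=
        mul_nonneg hΦpos.le (mul_nonneg hk.le (by linarith))
      have h2 : ε * (1 - k - φ s0 + k * w s0 - (1 - k) * Φ s0) < 0 :=
        mul_neg_of_pos_of_neg hεp (by linarith)
      have e : Φ s0 = φ s0 - ε := by linarith
      rw [e] at b h1 h2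
      nlinarith
    · rw [min_eq_right hle] at hneg
      have hB := c2 s0 hr'.le
      have h0 := secq' hle
      obtain ⟨ε, hε⟩ : ∃ ε, ε = w s0 - W s0 := ⟨_, rfl⟩
      have hεp : 0 < ε := by linarith
      have h1 : 0 ≤ (1 - W s0) * (h * (Φ s0 - φ s0 + ε)) :=
        mul_nonneg (by linarith) (mul_nonneg hh.le (by linarith))
      have h3 : (1 - h * U) * (1 - h) ≤ (1 - W s0) * (1 - h) :=
        mul_le_mul_of_nonneg_right (by linarith) (by linarith)
      have h2 : ε * (w s0 - h * φ s0 - (1 - W s0) * (1 - h)) < 0 :=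
        mul_neg_of_pos_of_neg hεp (by linarith)
      have e : W s0 = w s0 - ε := by linarith
      rw [e] at h0 h1 h2
      nlinarith

/-- touching is impossible -/
lemma sw_strict {d r h k c U : ℝ} {φ φ1 w w1 Φ Φ1 W W1 : ℝ → ℝ} (hd : 0 < d) (hr : 0 < r)
    (hh : 0 < h) (hk : 0 < k) (hU : h * U < 1) (hU1 : U < 1) (hk1 : k < 1) (hh1 : h < 1)
    (P : SwProf d r h k c U φ φ1 w w1) (Q : SwProf d r h k c U Φ Φ1 W W1)
    (hz : ∀ s ≤ 0, φ s = 0) (hp : ∀ s > 0, 0 < φ s) (hQ0 : 0 < Φ 0)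
    (o1 : ∀ s, φ s ≤ Φ s) (o2 : ∀ s, w s ≤ W s) :
    (∀ s, 0 ≤ s → φ s < Φ s) ∧ (∀ s, w s < W s) := by
  have hΦpos : ∀ s, 0 ≤ s → 0 < Φ s := fun s hs => lt_of_lt_of_le hQ0 (Q.mono hs)
  have part1 : ∀ s, 0 ≤ s → φ s < Φ s := by
    intro s0 hs0
    rcases hs0.eq_or_lt with h0 | h0
    · rw [← h0, hz 0 le_rfl]; exact hQ0
    refine lt_of_le_of_ne (o1 s0) fun heq => ?_
    have hlm : IsLocalMin (fun s => Φ s - φ s) s0 := by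
      refine Eventually.of_forall fun s => ?_
      simp only [heq, sub_self]; linarith [o1 s]
    have dp : ∀ s > 0, HasDerivAt (fun s => Φ s - φ s) (Φ1 s - φ1 s) s := fun s hs =>
      (Q.d1 s (hΦpos s hs.le)).sub (P.d1 s (hp s hs))
    have dp1 : Φ1 s0 - φ1 s0 = 0 := hlm.hasDerivAt_eq_zero (dp s0 h0)
    have hle : ∀ t ∈ Ioc 0 s0, Φ t - φ t ≤ 0 := by
      intro t ht
      apply sw_smp_left (c := c) (K := 2) (s0 := s0) (t := t) (by norm_num) ht.2
        (p := fun s => Φ s - φ s) (p1 := fun s => Φ1 s - φ1 s)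
        (fun s hs => dp s (lt_of_lt_of_le ht.1 hs.1))
        (fun s hs => (Q.d2 s (hΦpos s (ht.1.le.trans hs.1))).sub
          (P.d2 s (hp s (lt_of_lt_of_le ht.1 hs.1)))) ?_ (by simp [heq]) dp1
      intro s hs
      have a1 := o1 s
      have a2 := o2 s
      have a3 := P.lt s
      have a4 := Q.lt s
      have a5 := Q.nonneg s
      have a6 := P.wnonneg s
      have a7 := P.nonneg s
      have b1 : 0 ≤ Φ s * (k * (W s - w s)) := mul_nonneg a5 (mul_nonneg hk.le (by linarith))
      have b2 : 0 ≤ (Φ s - φ s) * (2 + (1 - k) - (Φ s + φ s) + k * w s) :=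
        mul_nonneg (by linarith) (by nlinarith)
      show _ ≤ c * (Φ1 s - φ1 s) + 2 * (Φ s - φ s)
      nlinarith
    have hc : Continuous fun s => Φ s - φ s := Q.cont.sub P.cont
    have : Φ 0 - φ 0 ≤ 0 := by
      have ht : Tendsto (fun s => Φ s - φ s) (nhdsWithin 0 (Ioi 0)) (nhds (Φ 0 - φ 0)) :=
        (hc.tendsto 0).mono_left nhdsWithin_le_nhds
      refine le_of_tendsto ht ?_
      filter_upwards [Ioc_mem_nhdsGT h0] with t ht using hle t ht
    rw [hz 0 le_rfl] at this
    linarith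
  refine ⟨part1, fun s0 => lt_of_le_of_ne (o2 s0) fun heq => ?_⟩
  have hlm : IsLocalMin (fun s => W s - w s) s0 := by
    refine Eventually.of_forall fun s => ?_
    simp only [heq, sub_self]; linarith [o2 s]
  have dq : ∀ s, HasDerivAt (fun s => W s - w s) (W1 s - w1 s) s := fun s =>
    (Q.e1 s).sub (P.e1 s)
  have dq1 : W1 s0 - w1 s0 = 0 := hlm.hasDerivAt_eq_zero (dq s0)
  have hle : ∀ t, s0 ≤ t → W t - w t ≤ 0 := by
    intro t ht
    apply sw_smp (c := c / d) (K := 2 * r / d) (s0 := s0) (t := t) (by positivity) ht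
      (p := fun s => W s - w s) (p1 := fun s => W1 s - w1 s)
      (fun s hs => dq s) (fun s hs => (Q.e2 s).sub (P.e2 s)) ?_ (by simp [heq]) dq1
    intro s hs
    have a1 := o1 s
    have a2 := o2 s
    have a3 := P.wlt s
    have a4 := Q.wlt s
    have a5 := Q.nonneg s
    have a6 := P.wnonneg s
    have a7 := P.nonneg s
    have a8 := P.lt s
    have b1 : 0 ≤ (1 - W s) * (h * (Φ s - φ s)) :=
      mul_nonneg (by linarith) (mul_nonneg hh.le (by linarith))
    have b0 : h * φ s ≤ 1 := by nlinarith
    have b2 : 0 ≤ (W s - w s) * (2 - (1 - W s - w s + h * φ s)) :=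
      mul_nonneg (by linarith) (by nlinarith)
    have b3 : (1 - W s) * (W s - h * Φ s) - (1 - w s) * (w s - h * φ s) ≤ 2 * (W s - w s) := by
      nlinarith
    have b4 := mul_le_mul_of_nonneg_left b3 hr.le
    show _ ≤ c / d * (W1 s - w1 s) + 2 * r / d * (W s - w s)
    rw [← sub_div, div_mul_eq_mul_div, div_mul_eq_mul_div, ← add_div]
    apply div_le_div_of_nonneg_right _ hd.le
    linarith
  -- so `W = w` to the right of `s0`
  have heqr : ∀ t, s0 ≤ t → W t - w t = 0 := fun t ht =>
    le_antisymm (hle t ht) (by linarith [o2 t])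
  obtain ⟨t, ht0, ht1⟩ : ∃ t, s0 < t ∧ 0 < t := ⟨max s0 0 + 1, by
    linarith [le_max_left s0 0], by linarith [le_max_right s0 0]⟩
  have z0 : (fun s => W s - w s) =ᶠ[nhds t] fun _ => 0 := by
    filter_upwards [Ioi_mem_nhds ht0] with s hs using heqr s (le_of_lt hs)
  have z1 : ∀ s > s0, W1 s - w1 s = 0 := by
    intro s hs
    have z0 : (fun s => W s - w s) =ᶠ[nhds s] fun _ => 0 := by
      filter_upwards [Ioi_mem_nhds hs] with s hs using heqr s (le_of_lt hs)
    rw [← (dq s).deriv, z0.deriv_eq]; simp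
  have z2 : (fun s => W1 s - w1 s) =ᶠ[nhds t] fun _ => 0 := by
    filter_upwards [Ioi_mem_nhds ht0] with s hs using z1 s hs
  have z3 := ((Q.e2 t).sub (P.e2 t)).deriv
  rw [show W1 - w1 = fun s => W1 s - w1 s from rfl, z2.deriv_eq] at z3
  simp only [deriv_const] at z3
  have y0 : W t = w t := by linarith [heqr t ht0.le]
  have y1 : W1 t = w1 t := by linarith [z1 t ht0]
  rw [y0, y1, ← sub_div, eq_comm, div_eq_zero_iff] at z3
  rcases z3 with z3 | z3
  · have a3 := P.wlt t
    have a := part1 t ht1.le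
    have : 0 < r * (1 - w t) * (h * (Φ t - φ t)) :=
      mul_pos (mul_pos hr (by linarith)) (mul_pos hh (by linarith))
    linarith
  · linarith

/-- sliding -/
lemma sw_slide {d r h k c U : ℝ} {φ φ1 w w1 Φ Φ1 W W1 : ℝ → ℝ} (hd : 0 < d) (hr : 0 < r)
    (hh : 0 < h) (hk : 0 < k) (hU : h * U < 1) (hU0 : 0 < U) (hU1 : U < 1) (hk1 : k < 1)
    (hh1 : h < 1) (hUeq : 1 - k - U + k * (h * U) = 0)
    (P : SwProf d r h k c U φ φ1 w w1) (Q : SwProf d r h k c U Φ Φ1 W W1)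
    (hz : ∀ s ≤ 0, φ s = 0) (hp : ∀ s > 0, 0 < φ s) (τ1 : ℝ) (hQ0 : 0 < Φ τ1) :
    (∀ s, φ s ≤ Φ (s + τ1)) ∧ (∀ s, w s ≤ W (s + τ1)) := by
  -- choice of M
  obtain ⟨M, hM, hc1, hc2, hc3⟩ : ∃ M : ℝ, 0 ≤ M ∧
      (∀ s ≥ M, 1 - k - φ s + k * w s < (1 - k) * Φ (s + τ1)) ∧
      (∀ s ≥ M, w s - h * φ s < (1 - h * U) * (1 - h)) ∧
      (∀ s ≤ -M, w s < 1 / 2) := by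
    have t1 : Tendsto (fun s => (1 - k) * Φ (s + τ1) - (1 - k - φ s + k * w s)) atTop
        (nhds ((1 - k) * U - (1 - k - U + k * (h * U)))) :=
      ((Q.shift τ1).top.const_mul (1 - k)).sub ((tendsto_const_nhds.sub P.top).add
        (P.wtop.const_mul k))
    have t2 : Tendsto (fun s => w s - h * φ s) atTop (nhds (h * U - h * U)) :=
      P.wtop.sub (P.top.const_mul h)
    rw [hUeq, sub_zero] at t1
    rw [sub_self] at t2
    have p1 : 0 < (1 - k) * U := mul_pos (by linarith) hU0
    have p2 : 0 < (1 - h * U) * (1 - h) := mul_pos (by linarith) (by linarith)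
    have E1 := t1.eventually_const_lt p1
    have E2 := t2.eventually_lt_const p2
    have E3 := P.wbot.eventually_lt_const (show (0:ℝ) < 1 / 2 by norm_num)
    obtain ⟨M1, h1⟩ := eventually_atTop.1 E1
    obtain ⟨M2, h2⟩ := eventually_atTop.1 E2
    obtain ⟨M3, h3⟩ := eventually_atBot.1 E3
    refine ⟨max (max 0 M1) (max M2 (-M3)), (le_max_left _ _).trans (le_max_left _ _), ?_, ?_, ?_⟩
    · intro s hs
      have := h1 s (((le_max_right _ _).trans (le_max_left _ _)).trans hs)
      linarith
    · intro s hs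
      exact h2 s (((le_max_left _ _).trans (le_max_right _ _)).trans hs)
    · intro s hs
      apply h3
      have : -M3 ≤ max (max 0 M1) (max M2 (-M3)) := (le_max_right _ _).trans (le_max_right _ _)
      linarith
  -- from the compact set to the line
  have ends : ∀ τ ≥ τ1, (∀ s ∈ Icc 0 M, φ s ≤ Φ (s + τ)) → (∀ s ∈ Icc (-M) M, w s ≤ W (s + τ)) →
      (∀ s, φ s ≤ Φ (s + τ)) ∧ (∀ s, w s ≤ W (s + τ)) := by
    intro τ hτ i1 i2
    refine sw_ends hd hr hh hh1 hk hU P (Q.shift τ) hz hp hM ?_ ?_ hc2 hc3 i1 i2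
    · exact lt_of_lt_of_le hQ0 (Q.mono (by linarith))
    · intro s hs
      refine (hc1 s hs).trans_le (mul_le_mul_of_nonneg_left (Q.mono (by linarith)) (by linarith))
  -- start
  obtain ⟨τ2, h12, g1, g2⟩ : ∃ τ2 ≥ τ1, (∀ s, φ s ≤ Φ (s + τ2)) ∧ (∀ s, w s ≤ W (s + τ2)) := by
    have E1 := Q.top.eventually_const_lt (P.lt M)
    have E2 := (Q.shift (-M)).wtop.eventually_const_lt (P.wlt M)
    obtain ⟨τ2, a, b, e⟩ := (E1.and (E2.and (eventually_ge_atTop τ1))).exists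
    refine ⟨τ2, e, ends τ2 e ?_ ?_⟩
    · intro s hs
      exact (P.mono hs.2).trans (a.le.trans (Q.mono (by linarith [hs.1])))
    · intro s hs
      exact (P.wmono hs.2).trans (b.le.trans (Q.wmono (by linarith [hs.1])))
  have key : Icc (-τ2) (-τ1) ⊆ {σ : ℝ | (∀ s, φ s ≤ Φ (s + -σ)) ∧ (∀ s, w s ≤ W (s + -σ))} := by
    apply IsClosed.Icc_subset_of_forall_exists_gt
    · refine IsClosed.inter ?_ isClosed_Icc
      simp only [ofPred_and, ofPred_forall]
      refine IsClosed.inter (isClosed_iInter fun s => ?_) (isClosed_iInter fun s => ?_)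
      · exact isClosed_le continuous_const (Q.cont.comp (by fun_prop))
      · exact isClosed_le continuous_const (Q.wcont.comp (by fun_prop))
    · exact ⟨by simpa using g1, by simpa using g2⟩
    · rintro σ ⟨⟨o1, o2⟩, hσ⟩ y hy
      have hst := sw_strict hd hr hh hk hU hU1 hk1 hh1 P (Q.shift (-σ)) hz hp
        (lt_of_lt_of_le hQ0 (Q.mono (by linarith [hσ.2]))) o1 o2
      have ev1 : ∀ᶠ x in nhds σ, ∀ s ∈ Icc 0 M, φ s < Φ (s + -x) := by
        apply isCompact_Icc.eventually_forall_of_forall_eventually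
        intro s hs
        have hP : Continuous fun z : ℝ × ℝ => φ z.2 := P.cont.comp continuous_snd
        have hQ : Continuous fun z : ℝ × ℝ => Φ (z.2 + -z.1) := Q.cont.comp (by fun_prop)
        exact (isOpen_lt hP hQ).mem_nhds (x := (σ, s)) (hst.1 s hs.1)
      have ev2 : ∀ᶠ x in nhds σ, ∀ s ∈ Icc (-M) M, w s < W (s + -x) := by
        apply isCompact_Icc.eventually_forall_of_forall_eventually
        intro s hs
        have hP : Continuous fun z : ℝ × ℝ => w z.2 := P.wcont.comp continuous_snd
        have hQ : Continuous fun z : ℝ × ℝ => W (z.2 + -z.1) := Q.wcont.comp (by fun_prop)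
        exact (isOpen_lt hP hQ).mem_nhds (x := (σ, s)) (hst.2 s)
      have ev3 : ∀ᶠ x in nhdsWithin σ (Ioi σ), x ∈ Ioo σ (min y (-τ1)) :=
        Ioo_mem_nhdsGT (lt_min hy hσ.2)
      obtain ⟨x, ⟨hx1, hx2⟩, hx3⟩ :=
        (((ev1.and ev2).filter_mono nhdsWithin_le_nhds).and ev3).exists
      refine ⟨x, ends (-x) ?_ (fun s hs => (hx1 s hs).le) (fun s hs => (hx2 s hs).le), hx3.1, ?_⟩
      · linarith [hx3.2, min_le_right y (-τ1)]
      · linarith [hx3.2, min_le_left y (-τ1)]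
  have := key (right_mem_Icc.2 (by linarith : -τ2 ≤ -τ1))
  simpa using this

end

section

/-- one-sided exponential averages -/
noncomputable def swE (α σ : ℝ) (y : ℝ → ℝ) (s : ℝ) : ℝ :=
  ∫ x in Ioi (0:ℝ), Real.exp (-α * x) * y (s + σ * x)

/-- monotone functions with values in `[0,M]` -/
structure SwMB (M : ℝ) (y : ℝ → ℝ) : Prop where
  mono : Monotone y
  nonneg : ∀ s, 0 ≤ y s
  le : ∀ s, y s ≤ M

lemma SwMB.comp_add {M : ℝ} {y : ℝ → ℝ} (h : SwMB M y) (τ : ℝ) : SwMB M (fun s => y (s + τ)) :=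
  ⟨fun a b hab => h.mono (by linarith), fun s => h.nonneg _, fun s => h.le _⟩

lemma SwMB.meas {M α σ s : ℝ} {y : ℝ → ℝ} (h : SwMB M y) :
    Measurable (fun x => Real.exp (-α * x) * y (s + σ * x)) := by
  have h1 : Measurable y := h.mono.measurable
  have h2 : Measurable fun x : ℝ => y (s + σ * x) := h1.comp (by fun_prop)
  exact (by fun_prop : Measurable fun x : ℝ => Real.exp (-α * x)).mul h2

lemma SwMB.norm_le {M α σ s : ℝ} {y : ℝ → ℝ} (h : SwMB M y) (x : ℝ) :
    ‖Real.exp (-α * x) * y (s + σ * x)‖ ≤ M * Real.exp (-α * x) := by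
  have := Real.exp_pos (-α * x)
  rw [Real.norm_of_nonneg (mul_nonneg this.le (h.nonneg _)), mul_comm]
  exact mul_le_mul_of_nonneg_right (h.le _) this.le

lemma SwMB.integrable {M α : ℝ} {y : ℝ → ℝ} (h : SwMB M y) (hα : 0 < α) (σ s a : ℝ) :
    MeasureTheory.IntegrableOn (fun x => Real.exp (-α * x) * y (s + σ * x)) (Ioi a) := by
  refine MeasureTheory.Integrable.mono' ((exp_neg_integrableOn_Ioi a hα).const_mul M)
    h.meas.aestronglyMeasurable (Eventually.of_forall fun x => h.norm_le x)

lemma swE_const {α : ℝ} (hα : 0 < α) (σ C s : ℝ) : swE α σ (fun _ => C) s = C / α := by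
  unfold swE
  rw [MeasureTheory.integral_mul_const, integral_exp_mul_Ioi (by linarith)]
  simp
  field_simp

lemma swE_mono {M M' α : ℝ} {y y' : ℝ → ℝ} (h : SwMB M y) (h' : SwMB M' y') (hα : 0 < α) (σ : ℝ)
    (hle : ∀ s, y s ≤ y' s) (s : ℝ) : swE α σ y s ≤ swE α σ y' s :=
  MeasureTheory.integral_mono (h.integrable hα σ s 0) (h'.integrable hα σ s 0)
    fun _ => mul_le_mul_of_nonneg_left (hle _) (Real.exp_pos _).le

lemma swE_shift (α σ : ℝ) (y : ℝ → ℝ) (τ s : ℝ) :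
    swE α σ (fun t => y (t + τ)) s = swE α σ y (s + τ) := by
  unfold swE
  congr 1; ext x; rw [add_right_comm]

lemma swConst_MB {M C : ℝ} (h : 0 ≤ C) (h' : C ≤ M) : SwMB M (fun _ => C) :=
  ⟨fun _ _ _ => le_rfl, fun _ => h, fun _ => h'⟩

lemma swE_ge {M α C : ℝ} {y : ℝ → ℝ} (h : SwMB M y) (hα : 0 < α) (σ : ℝ) (hC : 0 ≤ C)
    (hle : ∀ s, C ≤ y s) (s : ℝ) : C / α ≤ swE α σ y s := by
  rw [← swE_const hα σ C s]
  exact swE_mono (swConst_MB hC le_rfl) h hα σ hle s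

lemma SwMB.swE {M α : ℝ} {y : ℝ → ℝ} (h : SwMB M y) (hα : 0 < α) (σ : ℝ) :
    SwMB (M / α) (swE α σ y) where
  mono := fun a b hab => by
    have := swE_mono (h.comp_add a) (h.comp_add b) hα σ (fun s => h.mono (by linarith)) 0
    rw [swE_shift, swE_shift] at this
    simpa using this
  nonneg := fun s => MeasureTheory.integral_nonneg fun x =>
    mul_nonneg (Real.exp_pos _).le (h.nonneg _)
  le := fun s => by
    have hM : 0 ≤ M := (h.nonneg 0).trans (h.le 0)
    rw [← swE_const hα σ M s]
    exact swE_mono h (swConst_MB hM le_rfl) hα σ h.le s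

lemma swE_semi {M α : ℝ} {y : ℝ → ℝ} (h : SwMB M y) (hα : 0 < α) (σ s τ : ℝ) :
    swE α σ y s = (∫ x in (0:ℝ)..τ, Real.exp (-α * x) * y (s + σ * x))
      + Real.exp (-α * τ) * swE α σ y (s + σ * τ) := by
  have h1 := intervalIntegral.integral_interval_add_Ioi (h.integrable hα σ s 0)
    (h.integrable hα σ s τ)
  have h2 := (MeasureTheory.measurePreserving_add_right MeasureTheory.volume τ).setIntegral_preimage_emb
    (measurableEmbedding_addRight τ) (fun x => Real.exp (-α * x) * y (s + σ * x)) (Ioi τ)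
  have h3 : (fun x => x + τ) ⁻¹' Ioi τ = Ioi 0 := by ext x; simp
  rw [h3] at h2
  unfold swE
  rw [← h1, ← h2, ← MeasureTheory.integral_const_mul]
  congr 2
  ext x
  rw [← mul_assoc, ← Real.exp_add]
  congr 2 <;> ring_nf

lemma SwMB.intInt {M α : ℝ} {y : ℝ → ℝ} (h : SwMB M y) (hα : 0 < α) (σ s a b : ℝ) :
    IntervalIntegrable (fun x => Real.exp (-α * x) * y (s + σ * x)) MeasureTheory.volume a b := by
  rw [intervalIntegrable_iff]
  exact (h.integrable hα σ s (min a b)).mono_set fun x hx => by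
    have := hx.1
    simpa using this

lemma swE_hasDeriv {M α σ : ℝ} {y : ℝ → ℝ} (h : SwMB M y) (hα : 0 < α) (hσ : σ * σ = 1) {s : ℝ}
    (hc : ContinuousAt y s) : HasDerivAt (swE α σ y) (σ * (α * swE α σ y s - y s)) s := by
  have key : ∀ t, swE α σ y t = Real.exp (α * (σ * (t - s))) *
      (swE α σ y s - ∫ x in (0:ℝ)..(σ * (t - s)), Real.exp (-α * x) * y (s + σ * x)) := by
    intro t
    have h1 := swE_semi h hα σ s (σ * (t - s))
    have h2 : s + σ * (σ * (t - s)) = t := by rw [← mul_assoc, hσ]; ring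
    rw [h2] at h1
    rw [h1, add_sub_cancel_left, ← mul_assoc, ← Real.exp_add]
    have : α * (σ * (t - s)) + -α * (σ * (t - s)) = 0 := by ring
    rw [this]; simp
  have hc' : ContinuousAt (fun x => Real.exp (-α * x) * y (s + σ * x)) 0 := by
    have h4 : ContinuousAt (fun x : ℝ => s + σ * x) 0 := by fun_prop
    have h5 : ContinuousAt (fun x : ℝ => y (s + σ * x)) 0 :=
      ContinuousAt.comp (f := fun x : ℝ => s + σ * x) (by simpa using hc) h4
    exact (by fun_prop : ContinuousAt (fun x : ℝ => Real.exp (-α * x)) 0).mul h5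
  have d0 := intervalIntegral.integral_hasDerivAt_right (h.intInt hα σ s 0 0)
    (h.meas.stronglyMeasurable.stronglyMeasurableAtFilter) hc'
  have dl : HasDerivAt (fun t => σ * (t - s)) σ s := by
    simpa using ((hasDerivAt_id s).sub_const s).const_mul σ
  have z : σ * (s - s) = 0 := by simp
  have d1 := HasDerivAt.comp_of_eq s d0 dl z.symm
  have d2 : HasDerivAt (fun t => Real.exp (α * (σ * (t - s)))) (α * σ) s := by
    have := (dl.const_mul α).exp
    simpa using this
  have d3 := d2.mul (d1.const_sub (swE α σ y s))
  have e : swE α σ y = (fun t => Real.exp (α * (σ * (t - s)))) * fun t =>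
      (swE α σ y s - ((fun u => ∫ x in (0:ℝ)..u, Real.exp (-α * x) * y (s + σ * x)) ∘
        fun t => σ * (t - s)) t) := by
    funext t; exact key t
  rw [e]
  refine d3.congr_deriv ?_
  simp
  ring

lemma swE_lip {M α σ : ℝ} {y : ℝ → ℝ} (h : SwMB M y) (hα : 0 < α) (hσ : σ * σ = 1) :
    ∀ s t, |swE α σ y s - swE α σ y t| ≤ M * |s - t| := by
  have hM : 0 ≤ M := (h.nonneg 0).trans (h.le 0)
  have main : ∀ s τ, 0 ≤ τ → |swE α σ y (s + σ * τ) - swE α σ y s| ≤ M * τ := by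
    intro s τ hτ
    have h1 := swE_semi h hα σ s τ
    have I0 : 0 ≤ ∫ x in (0:ℝ)..τ, Real.exp (-α * x) * y (s + σ * x) :=
      intervalIntegral.integral_nonneg hτ fun x _ => mul_nonneg (Real.exp_pos _).le (h.nonneg _)
    have I1 : ∫ x in (0:ℝ)..τ, Real.exp (-α * x) * y (s + σ * x) ≤ M * τ := by
      have : ∫ x in (0:ℝ)..τ, Real.exp (-α * x) * y (s + σ * x) ≤ ∫ x in (0:ℝ)..τ, M := by
        apply intervalIntegral.integral_mono_on hτ (h.intInt hα σ s 0 τ) (by simp)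
        intro x hx
        have e1 : Real.exp (-α * x) ≤ 1 := Real.exp_le_one_iff.2 (by nlinarith [hx.1])
        calc _ ≤ 1 * y (s + σ * x) := mul_le_mul_of_nonneg_right e1 (h.nonneg _)
          _ ≤ M := by rw [one_mul]; exact h.le _
      refine this.trans (le_of_eq ?_)
      simp; ring
    have J0 := (h.swE hα σ).nonneg (s + σ * τ)
    have J1 := (h.swE hα σ).le (s + σ * τ)
    have e1 : Real.exp (-α * τ) ≤ 1 := Real.exp_le_one_iff.2 (by nlinarith)
    have e2 : -α * τ + 1 ≤ Real.exp (-α * τ) := Real.add_one_le_exp _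
    have k0 : 0 ≤ (1 - Real.exp (-α * τ)) * swE α σ y (s + σ * τ) :=
      mul_nonneg (by linarith) J0
    have k1 : (1 - Real.exp (-α * τ)) * swE α σ y (s + σ * τ) ≤ M * τ := by
      calc _ ≤ (α * τ) * (M / α) := mul_le_mul (by linarith) J1 J0 (by positivity)
        _ = M * τ := by field_simp
    rw [abs_le]
    constructor <;> linarith
  intro s t
  rcases le_total 0 (σ * (s - t)) with hc | hc
  · have := main t (σ * (s - t)) hc
    rw [← mul_assoc, hσ] at this
    have e : t + 1 * (s - t) = s := by ring
    rw [e] at this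
    refine this.trans (mul_le_mul_of_nonneg_left ?_ hM)
    have : |σ * (s - t)| = |s - t| := by
      rcases mul_self_eq_one_iff.1 hσ with h | h <;> simp [h, abs_sub_comm]
    rw [← this]; exact le_abs_self _
  · have := main s (σ * (t - s)) (by nlinarith)
    rw [← mul_assoc, hσ] at this
    have e : s + 1 * (t - s) = t := by ring
    rw [e, abs_sub_comm] at this
    refine this.trans (mul_le_mul_of_nonneg_left ?_ hM)
    have : |σ * (t - s)| = |s - t| := by
      rcases mul_self_eq_one_iff.1 hσ with h | h <;> simp [h, abs_sub_comm]
    rw [← this]; exact le_abs_self _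

lemma swE_continuous {M α σ : ℝ} {y : ℝ → ℝ} (h : SwMB M y) (hα : 0 < α) (hσ : σ * σ = 1) :
    Continuous (swE α σ y) := by
  have hM : 0 ≤ M := (h.nonneg 0).trans (h.le 0)
  refine (LipschitzWith.of_dist_le_mul (K := ⟨M, hM⟩) fun s t => ?_).continuous
  rw [Real.dist_eq, Real.dist_eq]
  exact swE_lip h hα hσ s t

lemma swE_tendsto {ι : Type*} {l : Filter ι} [l.IsCountablyGenerated] {M α σ : ℝ}
    {Y : ι → ℝ → ℝ} {y : ℝ → ℝ}
    (h : ∀ n, SwMB M (Y n)) (hα : 0 < α) (hσ : σ * σ = 1) (N : Set ℝ) (hN : N.Countable)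
    (hlim : ∀ t, t ∉ N → Tendsto (fun n => Y n t) l (nhds (y t))) (s : ℝ) :
    Tendsto (fun n => swE α σ (Y n) s) l (nhds (swE α σ y s)) := by
  apply MeasureTheory.tendsto_integral_filter_of_dominated_convergence
    (fun x => M * Real.exp (-α * x))
  · exact Eventually.of_forall fun n => (h n).meas.aestronglyMeasurable
  · exact Eventually.of_forall fun n => Eventually.of_forall fun x => (h n).norm_le x
  · exact (exp_neg_integrableOn_Ioi 0 hα).const_mul M
  · apply MeasureTheory.ae_restrict_of_ae
    have hinj : Function.Injective fun x : ℝ => s + σ * x := by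
      intro a b hab
      have hab' : s + σ * a = s + σ * b := hab
      have : σ * (σ * a) = σ * (σ * b) := by rw [add_left_cancel hab']
      rwa [← mul_assoc, ← mul_assoc, hσ, one_mul, one_mul] at this
    have hcount : ((fun x : ℝ => s + σ * x) ⁻¹' N).Countable := hN.preimage hinj
    filter_upwards [hcount.ae_notMem MeasureTheory.volume] with x hx
    exact (hlim _ hx).const_mul _

/-- behaviour at infinity -/
lemma swE_lim {l : Filter ℝ} [l.IsCountablyGenerated] {M α σ L : ℝ} {y : ℝ → ℝ}
    (h : SwMB M y) (hα : 0 < α) (hσ : σ * σ = 1)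
    (hl : ∀ t : ℝ, Tendsto (fun s => t + s) l l) (hlim : Tendsto y l (nhds L)) :
    Tendsto (swE α σ y) l (nhds (L / α)) := by
  have := swE_tendsto (l := l) (Y := fun s t => y (t + s)) (y := fun _ => L) (M := M)
    (fun s => h.comp_add s) hα hσ ∅ countable_empty (fun t _ => hlim.comp (hl t)) 0
  rw [swE_const hα] at this
  refine this.congr fun s => ?_
  rw [swE_shift, zero_add]

/-- if the derivative of the average vanishes then it is constant to the left -/
lemma swE_const_left {M α : ℝ} {y : ℝ → ℝ} (h : SwMB M y) (hα : 0 < α) {s : ℝ}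
    (hs : y s ≤ α * swE α (-1) y s) {t : ℝ} (ht : t ≤ s) : swE α (-1) y s ≤ swE α (-1) y t := by
  obtain ⟨τ, hτ, rfl⟩ : ∃ τ, 0 ≤ τ ∧ t = s + (-1) * τ := ⟨s - t, by linarith, by ring⟩
  have h1 := swE_semi h hα (-1) s τ
  have h2 := swE_semi (swConst_MB (h.nonneg s) (h.le s)) hα (-1) s τ
  rw [swE_const hα, swE_const hα] at h2
  have I1 : ∫ x in (0:ℝ)..τ, Real.exp (-α * x) * y (s + (-1) * x) ≤
      ∫ x in (0:ℝ)..τ, Real.exp (-α * x) * y s := by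
    apply intervalIntegral.integral_mono_on hτ (h.intInt hα (-1) s 0 τ)
      (Continuous.intervalIntegrable (by fun_prop) _ _)
    intro x hx
    exact mul_le_mul_of_nonneg_left (h.mono (by linarith [hx.1])) (Real.exp_pos _).le
  have e0 := Real.exp_pos (-α * τ)
  have e1 : Real.exp (-α * τ) ≤ 1 := Real.exp_le_one_iff.2 (by nlinarith)
  have h3 : y s / α ≤ swE α (-1) y s := by rw [div_le_iff₀ hα]; linarith
  have h4 : (1 - Real.exp (-α * τ)) * (y s / α) ≤ (1 - Real.exp (-α * τ)) * swE α (-1) y s :=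
    mul_le_mul_of_nonneg_left h3 (by linarith)
  have h5 : Real.exp (-α * τ) * swE α (-1) y s ≤ Real.exp (-α * τ) * swE α (-1) y (s + -1 * τ) := by
    linarith
  exact le_of_mul_le_mul_left h5 e0

lemma swE_pos {M β : ℝ} {y : ℝ → ℝ} (h : SwMB M y) (hβ : 0 < β) {s t : ℝ} (hst : s ≤ t)
    (ht : 0 < y t) : 0 < swE β 1 y s := by
  have h1 := swE_semi h hβ 1 s (t - s)
  have e : s + 1 * (t - s) = t := by ring
  rw [e] at h1
  have I0 : 0 ≤ ∫ x in (0:ℝ)..(t - s), Real.exp (-β * x) * y (s + 1 * x) :=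
    intervalIntegral.integral_nonneg (by linarith)
      fun x _ => mul_nonneg (Real.exp_pos _).le (h.nonneg _)
  have h2 := swE_semi (swConst_MB (h.nonneg t) (h.le t)) hβ 1 t 0
  have h3 : y t / β ≤ swE β 1 y t := by
    rw [← swE_const hβ 1 (y t) t]
    refine MeasureTheory.setIntegral_mono_on
      ((swConst_MB (h.nonneg t) (h.le t)).integrable hβ 1 t 0) (h.integrable hβ 1 t 0)
      measurableSet_Ioi fun x hx => ?_
    have hx' : 0 < x := hx
    exact mul_le_mul_of_nonneg_left (h.mono (by linarith)) (Real.exp_pos _).le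
  have h4 : 0 < y t / β := div_pos ht hβ
  have := mul_pos (Real.exp_pos (-β * (t - s))) (lt_of_lt_of_le h4 h3)
  linarith

end

section

noncomputable def swG (k u w : ℝ) : ℝ := u * (3 - k - u + k * w)
noncomputable def swH (d r h u w : ℝ) : ℝ := r * (w * (1 - h * u) + w ^ 2 + h * u) / d
noncomputable def swCut (a : EReal) (η : ℝ) (y : ℝ → ℝ) (t : ℝ) : ℝ :=
  max (if a < (t : EReal) then y t else 0) η

structure SwPar (d r h k c U α β γ δ : ℝ) : Prop where
  hd : 0 < d
  hr : 0 < r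
  hh : 0 < h
  hh1 : h < 1
  hk : 0 < k
  hk1 : k < 1
  hU : 0 < U
  hU1 : U < 1
  hUeq : 1 - k - U + k * (h * U) = 0
  hα : 0 < α
  hβ : 0 < β
  hγ : 0 < γ
  hδ : 0 < δ
  e1 : β - α = c
  e2 : α * β = 2
  e3 : δ - γ = c / d
  e4 : γ * δ = 2 * r / d

structure SwSol (d r h k U α β γ δ : ℝ) (a : EReal) (η : ℝ) (φ w : ℝ → ℝ) : Prop where
  mφ : SwMB U φ
  mw : SwMB (h * U) w
  eq1 : ∀ s, φ s = swE α (-1) (swCut a η (swE β 1 fun x => swG k (φ x) (w x))) s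
  eq2 : ∀ s, w s = swE γ (-1) (swE δ 1 fun x => swH d r h (φ x) (w x)) s

section
variable {d r h k c U α β γ δ : ℝ}

lemma SwPar.hU' (p : SwPar d r h k c U α β γ δ) : h * U < 1 := by
  have := p.hU; have := p.hU1; have := p.hh; have := p.hh1; nlinarith

lemma SwPar.G_mono (p : SwPar d r h k c U α β γ δ) {u w u' w' : ℝ} (h1 : 0 ≤ u) (h2 : u ≤ u')
    (h3 : u' ≤ U) (h4 : 0 ≤ w) (h5 : w ≤ w') : swG k u w ≤ swG k u' w' := by
  have := p.hU1; have := p.hk; have := p.hk1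
  unfold swG
  have a1 : 0 ≤ u' * (k * (w' - w)) :=
    mul_nonneg (by linarith) (mul_nonneg p.hk.le (by linarith))
  have a2 : 0 ≤ (u' - u) * (3 - k - u - u' + k * w) :=
    mul_nonneg (by linarith) (by nlinarith)
  nlinarith

lemma SwPar.H_mono (p : SwPar d r h k c U α β γ δ) {u w u' w' : ℝ} (h1 : 0 ≤ u) (h2 : u ≤ u')
    (h3 : u' ≤ U) (h4 : 0 ≤ w) (h5 : w ≤ w') (h6 : w' ≤ h * U) :
    swH d r h u w ≤ swH d r h u' w' := by
  have := p.hU1; have := p.hh; have := p.hh1; have := p.hU'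
  unfold swH
  apply div_le_div_of_nonneg_right _ p.hd.le
  apply mul_le_mul_of_nonneg_left _ p.hr.le
  have a1 : 0 ≤ (1 - w) * (h * (u' - u)) :=
    mul_nonneg (by linarith) (mul_nonneg p.hh.le (by linarith))
  have b0 : h * u' ≤ h * U := mul_le_mul_of_nonneg_left h3 p.hh.le
  have a2 : 0 ≤ (w' - w) * (1 - h * u' + w + w') :=
    mul_nonneg (by linarith) (by linarith)
  nlinarith

lemma SwPar.G_MB (p : SwPar d r h k c U α β γ δ) {φ w : ℝ → ℝ} (m1 : SwMB U φ)
    (m2 : SwMB (h * U) w) : SwMB (2 * U) (fun x => swG k (φ x) (w x)) where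
  mono := fun a b hab => p.G_mono (m1.nonneg _) (m1.mono hab) (m1.le _) (m2.nonneg _) (m2.mono hab)
  nonneg := fun s => by
    have := p.G_mono le_rfl (m1.nonneg s) (m1.le s) le_rfl (m2.nonneg s)
    simpa [swG] using this
  le := fun s => by
    have := p.G_mono (m1.nonneg s) (m1.le s) le_rfl (m2.nonneg s) (m2.le s)
    refine this.trans (le_of_eq ?_)
    unfold swG
    linear_combination U * p.hUeq

lemma SwPar.H_MB (p : SwPar d r h k c U α β γ δ) {φ w : ℝ → ℝ} (m1 : SwMB U φ)
    (m2 : SwMB (h * U) w) : SwMB (2 * r * (h * U) / d) (fun x => swH d r h (φ x) (w x)) where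
  mono := fun a b hab => p.H_mono (m1.nonneg _) (m1.mono hab) (m1.le _) (m2.nonneg _) (m2.mono hab)
    (m2.le _)
  nonneg := fun s => by
    have := p.H_mono le_rfl (m1.nonneg s) (m1.le s) le_rfl (m2.nonneg s) (m2.le s)
    simpa [swH] using this
  le := fun s => by
    have := p.H_mono (m1.nonneg s) (m1.le s) le_rfl (m2.nonneg s) (m2.le s) le_rfl
    refine this.trans (le_of_eq ?_)
    unfold swH
    ring

lemma SwPar.y_MB (p : SwPar d r h k c U α β γ δ) {φ w : ℝ → ℝ} (m1 : SwMB U φ)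
    (m2 : SwMB (h * U) w) : SwMB (α * U) (swE β 1 fun x => swG k (φ x) (w x)) := by
  have := (p.G_MB m1 m2).swE p.hβ 1
  have e : 2 * U / β = α * U := by
    rw [div_eq_iff p.hβ.ne', ← p.e2]; ring
  rwa [e] at this

lemma SwPar.z_MB (p : SwPar d r h k c U α β γ δ) {φ w : ℝ → ℝ} (m1 : SwMB U φ)
    (m2 : SwMB (h * U) w) : SwMB (γ * (h * U)) (swE δ 1 fun x => swH d r h (φ x) (w x)) := by
  have := (p.H_MB m1 m2).swE p.hδ 1
  have e : 2 * r * (h * U) / d / δ = γ * (h * U) := by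
    rw [div_eq_iff p.hδ.ne', mul_div_right_comm, ← p.e4]; ring
  rwa [e] at this

lemma swCut_MB {M : ℝ} {y : ℝ → ℝ} (a : EReal) {η : ℝ} (hy : SwMB M y) (h0 : 0 ≤ η) (h1 : η ≤ M) :
    SwMB M (swCut a η y) where
  mono := fun s t hst => by
    refine max_le_max ?_ le_rfl
    split_ifs with a1 a2 a2
    · exact hy.mono hst
    · exact absurd (lt_of_lt_of_le a1 (EReal.coe_le_coe_iff.2 hst)) a2
    · exact hy.nonneg t
    · exact le_rfl
  nonneg := fun s => h0.trans (le_max_right _ _)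
  le := fun s => by
    refine max_le ?_ h1
    split_ifs
    · exact hy.le s
    · exact h0.trans h1

lemma swCut_le {a : EReal} {η : ℝ} {y y' : ℝ → ℝ} (hle : ∀ s, y s ≤ y' s) (s : ℝ) :
    swCut a η y s ≤ swCut a η y' s := by
  refine max_le_max ?_ le_rfl
  split_ifs
  · exact hle s
  · exact le_rfl

/-- Knaster-Tarski -/
lemma swKT {U V : ℝ} (hU : 0 ≤ U) (hV : 0 ≤ V) (T1 T2 : (ℝ → ℝ) → (ℝ → ℝ) → ℝ → ℝ)
    (m1 : ∀ φ w, SwMB U φ → SwMB V w → SwMB U (T1 φ w))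
    (m2 : ∀ φ w, SwMB U φ → SwMB V w → SwMB V (T2 φ w))
    (hm : ∀ φ w φ' w', SwMB U φ → SwMB V w → SwMB U φ' → SwMB V w' → (∀ s, φ s ≤ φ' s) →
      (∀ s, w s ≤ w' s) → (∀ s, T1 φ w s ≤ T1 φ' w' s) ∧ (∀ s, T2 φ w s ≤ T2 φ' w' s)) :
    ∃ φ w, SwMB U φ ∧ SwMB V w ∧ (∀ s, φ s = T1 φ w s) ∧ (∀ s, w s = T2 φ w s) := by
  let ι := {p : (ℝ → ℝ) × (ℝ → ℝ) // SwMB U p.1 ∧ SwMB V p.2 ∧ (∀ s, p.1 s ≤ T1 p.1 p.2 s) ∧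
    (∀ s, p.2 s ≤ T2 p.1 p.2 s)}
  have z1 := swConst_MB (M := U) le_rfl hU
  have z2 := swConst_MB (M := V) le_rfl hV
  haveI : Nonempty ι := ⟨⟨(fun _ => 0, fun _ => 0), z1, z2,
    fun s => (m1 _ _ z1 z2).nonneg s, fun s => (m2 _ _ z1 z2).nonneg s⟩⟩
  let φ : ℝ → ℝ := fun s => ⨆ i : ι, i.1.1 s
  let w : ℝ → ℝ := fun s => ⨆ i : ι, i.1.2 s
  have b1 : ∀ s, BddAbove (range fun i : ι => i.1.1 s) := fun s =>
    ⟨U, by rintro _ ⟨i, rfl⟩; exact i.2.1.le s⟩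
  have b2 : ∀ s, BddAbove (range fun i : ι => i.1.2 s) := fun s =>
    ⟨V, by rintro _ ⟨i, rfl⟩; exact i.2.2.1.le s⟩
  have l1 : ∀ (i : ι) s, i.1.1 s ≤ φ s := fun i s => le_ciSup (b1 s) i
  have l2 : ∀ (i : ι) s, i.1.2 s ≤ w s := fun i s => le_ciSup (b2 s) i
  have M1 : SwMB U φ := ⟨fun s t hst => ciSup_mono (b1 t) fun i => i.2.1.mono hst,
    fun s => (Classical.arbitrary ι).2.1.nonneg s |>.trans (l1 _ s),
    fun s => ciSup_le fun i => i.2.1.le s⟩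
  have M2 : SwMB V w := ⟨fun s t hst => ciSup_mono (b2 t) fun i => i.2.2.1.mono hst,
    fun s => (Classical.arbitrary ι).2.2.1.nonneg s |>.trans (l2 _ s),
    fun s => ciSup_le fun i => i.2.2.1.le s⟩
  have p1 : ∀ s, φ s ≤ T1 φ w s := fun s => ciSup_le fun i => (i.2.2.2.1 s).trans
    ((hm _ _ _ _ i.2.1 i.2.2.1 M1 M2 (l1 i) (l2 i)).1 s)
  have p2 : ∀ s, w s ≤ T2 φ w s := fun s => ciSup_le fun i => (i.2.2.2.2 s).trans
    ((hm _ _ _ _ i.2.1 i.2.2.1 M1 M2 (l1 i) (l2 i)).2 s)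
  have N1 := m1 _ _ M1 M2
  have N2 := m2 _ _ M1 M2
  have q := hm _ _ _ _ M1 M2 N1 N2 p1 p2
  let j : ι := ⟨(T1 φ w, T2 φ w), N1, N2, q.1, q.2⟩
  exact ⟨φ, w, M1, M2, fun s => le_antisymm (p1 s) (l1 j s), fun s => le_antisymm (p2 s) (l2 j s)⟩

lemma SwPar.exists_sol (p : SwPar d r h k c U α β γ δ) (a : EReal) {η : ℝ} (h0 : 0 ≤ η)
    (h1 : η ≤ α * U) : ∃ φ w, SwSol d r h k U α β γ δ a η φ w := by
  have hU := p.hU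
  have hh := p.hh
  have q1 : ∀ φ w, SwMB U φ → SwMB (h * U) w →
      SwMB U (swE α (-1) (swCut a η (swE β 1 fun x => swG k (φ x) (w x)))) := by
    intro φ w m1 m2
    have := (swCut_MB a (p.y_MB m1 m2) h0 h1).swE p.hα (-1)
    rwa [mul_div_cancel_left₀ _ p.hα.ne'] at this
  have q2 : ∀ φ w, SwMB U φ → SwMB (h * U) w →
      SwMB (h * U) (swE γ (-1) (swE δ 1 fun x => swH d r h (φ x) (w x))) := by
    intro φ w m1 m2
    have := (p.z_MB m1 m2).swE p.hγ (-1)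
    rwa [mul_div_cancel_left₀ _ p.hγ.ne'] at this
  obtain ⟨φ, w, m1, m2, e1, e2⟩ := swKT hU.le (by positivity : 0 ≤ h * U)
    (fun φ w => swE α (-1) (swCut a η (swE β 1 fun x => swG k (φ x) (w x))))
    (fun φ w => swE γ (-1) (swE δ 1 fun x => swH d r h (φ x) (w x))) q1 q2 (by
      intro φ w φ' w' m1 m2 m1' m2' l1 l2
      constructor
      · apply swE_mono (swCut_MB a (p.y_MB m1 m2) h0 h1) (swCut_MB a (p.y_MB m1' m2') h0 h1) p.hα
        apply swCut_le
        apply swE_mono (p.G_MB m1 m2) (p.G_MB m1' m2') p.hβ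
        intro s
        exact p.G_mono (m1.nonneg s) (l1 s) (m1'.le s) (m2.nonneg s) (l2 s)
      · apply swE_mono (p.z_MB m1 m2) (p.z_MB m1' m2') p.hγ
        apply swE_mono (p.H_MB m1 m2) (p.H_MB m1' m2') p.hδ
        intro s
        exact p.H_mono (m1.nonneg s) (l1 s) (m1'.le s) (m2.nonneg s) (l2 s) (m2'.le s))
  exact ⟨φ, w, m1, m2, e1, e2⟩

lemma SwSol.shift {a η : ℝ} {φ w : ℝ → ℝ} (S : SwSol d r h k U α β γ δ (a : ℝ) η φ w) (τ : ℝ) :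
    SwSol d r h k U α β γ δ ((a - τ : ℝ) : EReal) η (fun s => φ (s + τ)) (fun s => w (s + τ)) where
  mφ := S.mφ.comp_add τ
  mw := S.mw.comp_add τ
  eq1 := fun s => by
    rw [S.eq1, ← swE_shift]
    congr 1
    funext t
    have : (swE β 1 fun x => swG k (φ (x + τ)) (w (x + τ))) t
      = (swE β 1 fun x => swG k (φ x) (w x)) (t + τ) :=
      swE_shift β 1 (fun x => swG k (φ x) (w x)) τ t
    unfold swCut
    rw [this]
    have e : ((a : EReal) < ((t + τ : ℝ) : EReal)) ↔ (((a - τ : ℝ) : EReal) < (t : EReal)) := by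
      rw [EReal.coe_lt_coe_iff, EReal.coe_lt_coe_iff]
      constructor <;> intro <;> linarith
    simp only [e]
  eq2 := fun s => by
    rw [S.eq2, ← swE_shift]
    congr 1
    funext t
    exact (swE_shift δ 1 (fun x => swH d r h (φ x) (w x)) τ t).symm

lemma neg_one_sq' : (-1 : ℝ) * (-1) = 1 := by norm_num

lemma SwSol.lim (p : SwPar d r h k c U α β γ δ) {a : EReal} {η : ℝ} (h0 : 0 ≤ η) (h1 : η ≤ α * U)
    {φ w : ℝ → ℝ} (S : SwSol d r h k U α β γ δ a η φ w) {l : Filter ℝ} [l.IsCountablyGenerated]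
    [l.NeBot] (hl : ∀ t : ℝ, Tendsto (fun s => t + s) l l) {A B : ℝ}
    (hA : Tendsto φ l (nhds A)) (hB : Tendsto w l (nhds B)) :
    B = h * A ∧ ((∀ᶠ t : ℝ in l, a < (t : EReal)) → A = 0 ∨ A = U) := by
  have A0 : 0 ≤ A := ge_of_tendsto' hA S.mφ.nonneg
  have A1 : A ≤ U := le_of_tendsto' hA S.mφ.le
  have B1 : B ≤ h * U := le_of_tendsto' hB S.mw.le
  have hG : Tendsto (fun x => swG k (φ x) (w x)) l (nhds (swG k A B)) :=
    hA.mul ((tendsto_const_nhds.sub hA).add (hB.const_mul k))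
  have hH : Tendsto (fun x => swH d r h (φ x) (w x)) l (nhds (swH d r h A B)) :=
    ((((hB.mul (tendsto_const_nhds.sub (hA.const_mul h))).add (hB.pow 2)).add
      (hA.const_mul h)).const_mul r).div_const d
  have y := swE_lim (p.G_MB S.mφ S.mw) p.hβ (one_mul 1) hl hG
  have z := swE_lim (p.H_MB S.mφ S.mw) p.hδ (one_mul 1) hl hH
  have z' := swE_lim (p.z_MB S.mφ S.mw) p.hγ neg_one_sq' hl z
  have hB' : B = swH d r h A B / δ / γ :=
    tendsto_nhds_unique hB (z'.congr fun s => (S.eq2 s).symm)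
  have hd := p.hd
  have hr := p.hr
  have hBA : B = h * A := by
    rw [div_div, mul_comm δ γ, p.e4] at hB'
    unfold swH at hB'
    have e0 : r * (B * (1 - h * A) + B ^ 2 + h * A) / d / (2 * r / d) =
        (B * (1 - h * A) + B ^ 2 + h * A) / 2 := by
      field_simp
    have e : B = (B * (1 - h * A) + B ^ 2 + h * A) / 2 := hB'.trans e0
    have e' : (1 - B) * (h * A - B) = 0 := by linarith
    rcases mul_eq_zero.1 e' with q | q
    · have := p.hU'; linarith
    · linarith
  refine ⟨hBA, fun hev => ?_⟩
  have hcut : Tendsto (swCut a η (swE β 1 fun x => swG k (φ x) (w x))) l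
      (nhds (max (swG k A B / β) η)) := by
    refine (y.max tendsto_const_nhds).congr' ?_
    filter_upwards [hev] with t ht
    unfold swCut
    rw [if_pos ht]
  have y' := swE_lim (swCut_MB a (p.y_MB S.mφ S.mw) h0 h1) p.hα neg_one_sq' hl hcut
  have hA' : A = max (swG k A B / β) η / α :=
    tendsto_nhds_unique hA (y'.congr fun s => (S.eq1 s).symm)
  rw [eq_div_iff p.hα.ne'] at hA'
  have q : swG k A B / β ≤ A * α := hA' ▸ le_max_left _ _
  rw [div_le_iff₀ p.hβ, mul_assoc, p.e2] at q
  rcases A0.eq_or_lt with hz | hz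
  · exact Or.inl hz.symm
  · right
    unfold swG at q
    have q' := le_of_mul_le_mul_left q hz
    rw [hBA] at q'
    refine le_antisymm A1 ?_
    have e := p.hUeq
    have hk := p.hk
    have : 0 < 1 - k * h := by nlinarith [p.hk1, p.hh, p.hh1]
    by_contra hc
    push Not at hc
    have := mul_pos this (sub_pos.2 hc)
    linarith

lemma swTop (t : ℝ) : Tendsto (fun s => t + s) atTop atTop :=
  tendsto_atTop_add_const_left _ _ tendsto_id
lemma swBot (t : ℝ) : Tendsto (fun s => t + s) atBot atBot :=
  tendsto_atBot_add_const_left _ _ tendsto_id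

lemma SwMB.limTop {M : ℝ} {y : ℝ → ℝ} (h : SwMB M y) : ∃ A, Tendsto y atTop (nhds A) ∧ ∀ s, y s ≤ A :=
  have b : BddAbove (range y) := ⟨M, by rintro _ ⟨s, rfl⟩; exact h.le s⟩
  ⟨_, tendsto_atTop_ciSup h.mono b, fun s => le_ciSup b s⟩
lemma SwMB.limBot {M : ℝ} {y : ℝ → ℝ} (h : SwMB M y) : ∃ A, Tendsto y atBot (nhds A) ∧ ∀ s, A ≤ y s :=
  have b : BddBelow (range y) := ⟨0, by rintro _ ⟨s, rfl⟩; exact h.nonneg s⟩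
  ⟨_, tendsto_atBot_ciInf h.mono b, fun s => ciInf_le b s⟩

lemma SwSol.limTop (p : SwPar d r h k c U α β γ δ) {a : EReal} (ha : a ≠ ⊤) {η : ℝ} (h0 : 0 ≤ η)
    (h1 : η ≤ α * U) {φ w : ℝ → ℝ} (S : SwSol d r h k U α β γ δ a η φ w) {s : ℝ} (hs : 0 < φ s) :
    Tendsto φ atTop (nhds U) ∧ Tendsto w atTop (nhds (h * U)) := by
  obtain ⟨A, hA, lA⟩ := S.mφ.limTop
  obtain ⟨B, hB, lB⟩ := S.mw.limTop
  obtain ⟨e1, e2⟩ := S.lim p h0 h1 swTop hA hB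
  have e3 := e2 (by
    induction a with
    | bot => exact Eventually.of_forall fun t => EReal.bot_lt_coe t
    | coe a => filter_upwards [eventually_gt_atTop a] with t ht using EReal.coe_lt_coe_iff.2 ht
    | top => exact absurd rfl ha)
  rcases e3 with e3 | e3
  · have := lA s; linarith
  · rw [e3] at e1 hA; rw [e1] at hB
    exact ⟨hA, hB⟩

lemma sw_dense {f : ℕ → ℝ → ℝ} {L : ℝ} (hL : 0 ≤ L)
    (hf : ∀ n s t, |f n s - f n t| ≤ L * |s - t|)
    (hq : ∀ q : ℚ, ∃ x, Tendsto (fun n => f n q) atTop (nhds x)) :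
    ∃ g : ℝ → ℝ, ∀ s, Tendsto (fun n => f n s) atTop (nhds (g s)) := by
  have : ∀ s, ∃ x, Tendsto (fun n => f n s) atTop (nhds x) := by
    intro s
    apply cauchySeq_tendsto_of_complete
    rw [Metric.cauchySeq_iff']
    intro ε hε
    obtain ⟨q, hq1, hq2⟩ := exists_rat_btwn (show s < s + ε / (4 * (L + 1)) by
      have : 0 < ε / (4 * (L + 1)) := by positivity
      linarith)
    have hdist : L * |s - q| ≤ ε / 4 := by
      rw [abs_sub_comm, abs_of_pos (by linarith)]
      have h1 : (q:ℝ) - s ≤ ε / (4 * (L + 1)) := by linarith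
      calc L * (q - s) ≤ (L + 1) * (ε / (4 * (L + 1))) :=
            mul_le_mul (by linarith) h1 (by linarith) (by linarith)
        _ = ε / 4 := by field_simp
    obtain ⟨x, hx⟩ := hq q
    obtain ⟨N, hN⟩ := Metric.cauchySeq_iff'.1 hx.cauchySeq (ε / 4) (by linarith)
    refine ⟨N, fun n hn => ?_⟩
    have h1 := hN n hn
    rw [Real.dist_eq] at h1 ⊢
    have h2 := hf n s q
    have h3 := hf N s q
    have e : f n s - f N s = (f n s - f n q) + (f n q - f N q) - (f N s - f N q) := by ring
    rw [e]
    rw [abs_le] at h2 h3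
    rw [abs_lt] at h1 ⊢
    constructor <;> linarith [h1.1, h1.2, h2.1, h2.2, h3.1, h3.2]
  choose g hg using this
  exact ⟨g, hg⟩

lemma SwSol.compact (p : SwPar d r h k c U α β γ δ) {a : ℕ → EReal} {η : ℕ → ℝ}
    {φ w : ℕ → ℝ → ℝ} (h0 : ∀ n, 0 ≤ η n) (h1 : ∀ n, η n ≤ α * U)
    (hη : Tendsto η atTop (nhds 0))
    (S : ∀ n, SwSol d r h k U α β γ δ (a n) (η n) (φ n) (w n)) :
    ∃ (θ : ℕ → ℕ) (b : EReal) (f g : ℝ → ℝ), Tendsto (fun n => a (θ n)) atTop (nhds b) ∧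
      (∀ s, Tendsto (fun n => φ (θ n) s) atTop (nhds (f s))) ∧
      SwSol d r h k U α β γ δ b 0 f g := by
  have hαU : 0 ≤ α * U := mul_nonneg p.hα.le p.hU.le
  have hγU : 0 ≤ γ * (h * U) := mul_nonneg p.hγ.le (mul_nonneg p.hh.le p.hU.le)
  let X := EReal × (ℚ → Icc (0:ℝ) U) × (ℚ → Icc (0:ℝ) (h * U))
  let u : ℕ → X := fun n => (a n, fun q => ⟨φ n q, (S n).mφ.nonneg _, (S n).mφ.le _⟩,
    fun q => ⟨w n q, (S n).mw.nonneg _, (S n).mw.le _⟩)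
  obtain ⟨x, θ, hθ, hx⟩ := CompactSpace.tendsto_subseq u
  have x1 := (continuous_fst.tendsto x).comp hx
  have x2 := ((continuous_fst.comp continuous_snd).tendsto x).comp hx
  have x3 := ((continuous_snd.comp continuous_snd).tendsto x).comp hx
  have L1 : ∀ n s t, |φ n s - φ n t| ≤ α * U * |s - t| := fun n s t => by
    rw [(S n).eq1 s, (S n).eq1 t]
    exact swE_lip (swCut_MB (a n) (p.y_MB (S n).mφ (S n).mw) (h0 n) (h1 n)) p.hα neg_one_sq' s t
  have L2 : ∀ n s t, |w n s - w n t| ≤ γ * (h * U) * |s - t| := fun n s t => by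
    rw [(S n).eq2 s, (S n).eq2 t]
    exact swE_lip (p.z_MB (S n).mφ (S n).mw) p.hγ neg_one_sq' s t
  obtain ⟨f, hf⟩ := sw_dense (f := fun n => φ (θ n)) hαU (fun n => L1 (θ n)) (fun q =>
    ⟨_, (continuous_subtype_val.tendsto _).comp (((continuous_apply q).tendsto _).comp x2)⟩)
  obtain ⟨g, hg⟩ := sw_dense (f := fun n => w (θ n)) hγU (fun n => L2 (θ n)) (fun q =>
    ⟨_, (continuous_subtype_val.tendsto _).comp (((continuous_apply q).tendsto _).comp x3)⟩)
  have mf : SwMB U f := ⟨fun s t hst => le_of_tendsto_of_tendsto' (hf s) (hf t)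
      fun n => (S (θ n)).mφ.mono hst, fun s => ge_of_tendsto' (hf s) fun n => (S (θ n)).mφ.nonneg s,
      fun s => le_of_tendsto' (hf s) fun n => (S (θ n)).mφ.le s⟩
  have mg : SwMB (h * U) g := ⟨fun s t hst => le_of_tendsto_of_tendsto' (hg s) (hg t)
      fun n => (S (θ n)).mw.mono hst, fun s => ge_of_tendsto' (hg s) fun n => (S (θ n)).mw.nonneg s,
      fun s => le_of_tendsto' (hg s) fun n => (S (θ n)).mw.le s⟩
  have tG : ∀ t, Tendsto (fun n => swG k (φ (θ n) t) (w (θ n) t)) atTop (nhds (swG k (f t) (g t))) :=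
    fun t => (hf t).mul ((tendsto_const_nhds.sub (hf t)).add ((hg t).const_mul k))
  have tH : ∀ t, Tendsto (fun n => swH d r h (φ (θ n) t) (w (θ n) t)) atTop
      (nhds (swH d r h (f t) (g t))) :=
    fun t => (((((hg t).mul (tendsto_const_nhds.sub ((hf t).const_mul h))).add ((hg t).pow 2)).add
      ((hf t).const_mul h)).const_mul r).div_const d
  have ty := swE_tendsto (fun n => p.G_MB (S (θ n)).mφ (S (θ n)).mw) p.hβ (one_mul 1) ∅
    countable_empty (fun t _ => tG t)
  have tz := swE_tendsto (fun n => p.H_MB (S (θ n)).mφ (S (θ n)).mw) p.hδ (one_mul 1) ∅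
    countable_empty (fun t _ => tH t)
  have tz2 := swE_tendsto (fun n => p.z_MB (S (θ n)).mφ (S (θ n)).mw) p.hγ neg_one_sq' ∅
    countable_empty (fun t _ => tz t)
  have ηθ : Tendsto (fun n => η (θ n)) atTop (nhds 0) := hη.comp hθ.tendsto_atTop
  have tc : ∀ t : ℝ, t ∉ {t : ℝ | (t : EReal) = x.1} →
      Tendsto (fun n => swCut (a (θ n)) (η (θ n))
        (swE β 1 fun x => swG k (φ (θ n) x) (w (θ n) x)) t) atTop
        (nhds (swCut x.1 0 (swE β 1 fun x => swG k (f x) (g x)) t)) := by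
    intro t ht
    have ht' : (t : EReal) ≠ x.1 := ht
    unfold swCut
    refine Tendsto.max ?_ ηθ
    rcases lt_or_gt_of_ne ht' with hlt | hlt
    · rw [if_neg (not_lt.2 hlt.le)]
      refine tendsto_const_nhds.congr' ?_
      filter_upwards [x1.eventually_const_lt hlt] with n hn
      have hn' : (t : EReal) < a (θ n) := hn
      rw [if_neg (not_lt.2 hn'.le)]
    · rw [if_pos hlt]
      refine (ty t).congr' ?_
      filter_upwards [x1.eventually_lt_const hlt] with n hn
      have hn' : a (θ n) < (t : EReal) := hn
      rw [if_pos hn']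
  have ty2 := swE_tendsto (fun n => swCut_MB (a (θ n)) (p.y_MB (S (θ n)).mφ (S (θ n)).mw)
    (h0 (θ n)) (h1 (θ n))) p.hα neg_one_sq' {t : ℝ | (t : EReal) = x.1} (by
      apply Set.Subsingleton.countable
      intro s hs t ht
      exact EReal.coe_injective ((show (s:EReal) = x.1 from hs).trans (show (t:EReal) = x.1 from ht).symm)) tc
  refine ⟨θ, x.1, f, g, x1, hf, mf, mg, fun s => ?_, fun s => ?_⟩
  · exact tendsto_nhds_unique (hf s) ((ty2 s).congr fun n => ((S (θ n)).eq1 s).symm)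
  · exact tendsto_nhds_unique (hg s) ((tz2 s).congr fun n => ((S (θ n)).eq2 s).symm)

/-- values to the left of the cut -/
lemma SwSol.left (p : SwPar d r h k c U α β γ δ) {a : ℝ} {η : ℝ}
    {φ w : ℝ → ℝ} (S : SwSol d r h k U α β γ δ a η φ w) (h0 : 0 ≤ η) (s : ℝ) (hs : s ≤ a) :
    φ s = η / α := by
  rw [S.eq1, ← swE_const p.hα (-1) η s]
  refine MeasureTheory.setIntegral_congr_fun measurableSet_Ioi fun x hx => ?_
  have hx' : 0 < x := hx
  have : ¬ ((a : EReal) < ((s + -1 * x : ℝ) : EReal)) := by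
    rw [EReal.coe_lt_coe_iff]; linarith
  simp only [swCut]
  rw [if_neg this, max_eq_right h0]

lemma SwSol.cont (p : SwPar d r h k c U α β γ δ) {a : EReal} {η : ℝ} (h0 : 0 ≤ η)
    (h1 : η ≤ α * U) {φ w : ℝ → ℝ} (S : SwSol d r h k U α β γ δ a η φ w) : Continuous φ := by
  rw [funext S.eq1]
  exact swE_continuous (swCut_MB a (p.y_MB S.mφ S.mw) h0 h1) p.hα neg_one_sq'

lemma SwSol.wcont (p : SwPar d r h k c U α β γ δ) {a : EReal} {η : ℝ}
    {φ w : ℝ → ℝ} (S : SwSol d r h k U α β γ δ a η φ w) : Continuous w := by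
  rw [funext S.eq2]
  exact swE_continuous (p.z_MB S.mφ S.mw) p.hγ neg_one_sq'

/-- main dichotomy: a nontrivial profile, cut at `0` or not cut -/
lemma SwPar.exists_main (p : SwPar d r h k c U α β γ δ) :
    ∃ (a : EReal) (φ w : ℝ → ℝ), a ≤ 0 ∧ φ 0 = U / 2 ∧ SwSol d r h k U α β γ δ a 0 φ w := by
  have hαU : 0 < α * U := mul_pos p.hα p.hU
  have step : ∀ n : ℕ, ∃ (a : EReal) (φ w : ℝ → ℝ), a ≤ 0 ∧ φ 0 = U / 2 ∧
      SwSol d r h k U α β γ δ a (α * U / (n + 3)) φ w := by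
    intro n
    have hn : (0:ℝ) < n + 3 := by positivity
    have h0 : 0 ≤ α * U / (n + 3) := by positivity
    have h1 : α * U / (n + 3) ≤ α * U := div_le_self hαU.le (by linarith [n.cast_nonneg (α := ℝ)])
    obtain ⟨φ, w, S⟩ := p.exists_sol ((0:ℝ) : EReal) h0 h1
    have v0 := S.left p h0 0 le_rfl
    have v1 : φ 0 = U / (n + 3) := by
      rw [v0]; have := p.hα; field_simp
    have hU := p.hU
    have v2 : 0 < φ 0 := by rw [v1]; positivity
    have v3 : φ 0 ≤ U / 2 := by
      rw [v1]
      exact div_le_div_of_nonneg_left hU.le (by norm_num) (by linarith [n.cast_nonneg (α := ℝ)])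
    have lt := (S.limTop p (EReal.coe_ne_top 0) h0 h1 v2).1
    obtain ⟨t, ht, ht0⟩ := ((lt.eventually_const_lt (show U / 2 < U by linarith)).and
      (eventually_ge_atTop 0)).exists
    obtain ⟨s, hs, hs'⟩ := intermediate_value_Icc ht0 (S.cont p h0 h1).continuousOn ⟨v3, ht.le⟩
    refine ⟨((0 - s : ℝ) : EReal), _, _, ?_, ?_, S.shift s⟩
    · rw [← EReal.coe_zero, EReal.coe_le_coe_iff]; linarith [hs.1]
    · simpa using hs'
  choose a φ w ha hφ S using step
  obtain ⟨θ, b, f, g, hb, hf, Sf⟩ := SwSol.compact p (fun n => by positivity)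
    (fun n => div_le_self hαU.le (by linarith [n.cast_nonneg (α := ℝ)])) (by
      have : Tendsto (fun n : ℕ => (n:ℝ) + 3) atTop atTop :=
        tendsto_atTop_add_const_right _ _ tendsto_natCast_atTop_atTop
      exact tendsto_const_nhds.div_atTop this) S
  refine ⟨b, f, g, le_of_tendsto' hb fun n => ha _, ?_, Sf⟩
  have := hf 0
  simp only [hφ] at this
  exact tendsto_nhds_unique this tendsto_const_nhds
end

end

section

variable {d r h k c U α β γ δ : ℝ}

lemma sw_C2 {f f1 f2 : ℝ → ℝ} (h1 : ∀ s, HasDerivAt f (f1 s) s) (h2 : ∀ s, HasDerivAt f1 (f2 s) s)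
    (h3 : Continuous f2) : ContDiff ℝ 2 f := by
  have e1 : deriv f = f1 := funext fun s => (h1 s).deriv
  have e2 : deriv f1 = f2 := funext fun s => (h2 s).deriv
  have c1 : ContDiff ℝ 1 f1 :=
    contDiff_one_iff_deriv.2 ⟨fun s => (h2 s).differentiableAt, by rw [e2]; exact h3⟩
  have : ContDiff ℝ (1 + 1) f := by
    rw [contDiff_succ_iff_deriv]
    exact ⟨fun s => (h1 s).differentiableAt, by simp, by rw [e1]; exact c1⟩
  simpa [one_add_one_eq_two] using this

lemma swCut_eq {M : ℝ} {a : EReal} {y : ℝ → ℝ} (hy : SwMB M y) {s : ℝ} (hs : a < (s : EReal)) :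
    swCut a 0 y s = y s := by
  unfold swCut
  rw [if_pos hs]
  exact max_eq_left (hy.nonneg s)

lemma SwSol.Gcont (p : SwPar d r h k c U α β γ δ) {a : EReal} {φ w : ℝ → ℝ}
    (S : SwSol d r h k U α β γ δ a 0 φ w) : Continuous (fun x => swG k (φ x) (w x)) := by
  have h1 := S.cont p le_rfl (mul_pos p.hα p.hU).le
  have h2 := S.wcont p
  unfold swG
  fun_prop

lemma SwSol.Hcont (p : SwPar d r h k c U α β γ δ) {a : EReal} {φ w : ℝ → ℝ}
    (S : SwSol d r h k U α β γ δ a 0 φ w) : Continuous (fun x => swH d r h (φ x) (w x)) := by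
  have h1 := S.cont p le_rfl (mul_pos p.hα p.hU).le
  have h2 := S.wcont p
  unfold swH
  fun_prop

lemma SwSol.dphi (p : SwPar d r h k c U α β γ δ) {a : EReal} {φ w : ℝ → ℝ}
    (S : SwSol d r h k U α β γ δ a 0 φ w) {s : ℝ} (hs : a < (s : EReal)) :
    HasDerivAt φ (swE β 1 (fun x => swG k (φ x) (w x)) s - α * φ s) s := by
  have my := p.y_MB S.mφ S.mw
  have mc := swCut_MB a my le_rfl (mul_pos p.hα p.hU).le
  have cy := swE_continuous (p.G_MB S.mφ S.mw) p.hβ (one_mul 1)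
  have ev : ∀ᶠ t : ℝ in nhds s, a < (t : EReal) :=
    (isOpen_Ioi.preimage continuous_coe_real_ereal).mem_nhds hs
  have cc : ContinuousAt (swCut a 0 (swE β 1 fun x => swG k (φ x) (w x))) s := by
    refine cy.continuousAt.congr ?_
    filter_upwards [ev] with t ht
    exact (swCut_eq my ht).symm
  have key := swE_hasDeriv mc p.hα neg_one_sq' cc
  rw [← S.eq1 s, swCut_eq my hs, ← funext S.eq1] at key
  convert key using 1
  ring

lemma SwSol.dy (p : SwPar d r h k c U α β γ δ) {a : EReal} {φ w : ℝ → ℝ}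
    (S : SwSol d r h k U α β γ δ a 0 φ w) (s : ℝ) :
    HasDerivAt (swE β 1 (fun x => swG k (φ x) (w x)))
      (β * swE β 1 (fun x => swG k (φ x) (w x)) s - swG k (φ s) (w s)) s := by
  have key := swE_hasDeriv (p.G_MB S.mφ S.mw) p.hβ (one_mul 1) (S.Gcont p).continuousAt (s := s)
  rwa [one_mul] at key

lemma SwSol.dz (p : SwPar d r h k c U α β γ δ) {a : EReal} {φ w : ℝ → ℝ}
    (S : SwSol d r h k U α β γ δ a 0 φ w) (s : ℝ) :
    HasDerivAt (swE δ 1 (fun x => swH d r h (φ x) (w x)))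
      (δ * swE δ 1 (fun x => swH d r h (φ x) (w x)) s - swH d r h (φ s) (w s)) s := by
  have key := swE_hasDeriv (p.H_MB S.mφ S.mw) p.hδ (one_mul 1) (S.Hcont p).continuousAt (s := s)
  rwa [one_mul] at key

lemma SwSol.dw (p : SwPar d r h k c U α β γ δ) {a : EReal} {φ w : ℝ → ℝ}
    (S : SwSol d r h k U α β γ δ a 0 φ w) (s : ℝ) :
    HasDerivAt w (swE δ 1 (fun x => swH d r h (φ x) (w x)) s - γ * w s) s := by
  have cz := swE_continuous (p.H_MB S.mφ S.mw) p.hδ (one_mul 1)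
  have key := swE_hasDeriv (p.z_MB S.mφ S.mw) p.hγ neg_one_sq' cz.continuousAt (s := s)
  rw [← S.eq2 s, ← funext S.eq2] at key
  convert key using 1
  ring

lemma SwSol.phi_pos (p : SwPar d r h k c U α β γ δ) {a : EReal} {φ w : ℝ → ℝ}
    (S : SwSol d r h k U α β γ δ a 0 φ w) (hb : Tendsto φ atBot (nhds 0))
    (ht : Tendsto φ atTop (nhds U)) {s : ℝ} (hs : a < (s : EReal)) :
    0 < swE β 1 (fun x => swG k (φ x) (w x)) s - α * φ s := by
  by_contra hc
  push Not at hc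
  have my := p.y_MB S.mφ S.mw
  have mc := swCut_MB a my le_rfl (mul_pos p.hα p.hU).le
  have l1 : ∀ t ≤ s, φ s ≤ φ t := by
    intro t hts
    have := swE_const_left mc p.hα (s := s) (by rw [← S.eq1, swCut_eq my hs]; linarith) hts
    rwa [← S.eq1, ← S.eq1] at this
  have l2 : φ s ≤ 0 := ge_of_tendsto hb (by
    filter_upwards [eventually_le_atBot s] with t hts using l1 t hts)
  have l3 := S.mφ.nonneg s
  have l4 : φ s = 0 := le_antisymm l2 l3
  rw [l4] at hc
  obtain ⟨t, h1, h2⟩ := ((ht.eventually (lt_mem_nhds p.hU)).and (eventually_ge_atTop s)).exists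
  have := swE_pos (p.G_MB S.mφ S.mw) p.hβ h2 (by
    unfold swG
    have a1 := S.mφ.le t
    have a2 := mul_nonneg p.hk.le (S.mw.nonneg t)
    have := p.hU1; have := p.hk1
    exact mul_pos h1 (by linarith))
  linarith

lemma SwSol.w_pos (p : SwPar d r h k c U α β γ δ) {a : EReal} {φ w : ℝ → ℝ}
    (S : SwSol d r h k U α β γ δ a 0 φ w) (hb : Tendsto w atBot (nhds 0))
    (ht : Tendsto w atTop (nhds (h * U))) (s : ℝ) :
    0 < swE δ 1 (fun x => swH d r h (φ x) (w x)) s - γ * w s := by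
  by_contra hc
  push Not at hc
  have mz := p.z_MB S.mφ S.mw
  have l1 : ∀ t ≤ s, w s ≤ w t := by
    intro t hts
    have := swE_const_left mz p.hγ (s := s) (by rw [← S.eq2]; linarith) hts
    rwa [← S.eq2, ← S.eq2] at this
  have l2 : w s ≤ 0 := ge_of_tendsto hb (by
    filter_upwards [eventually_le_atBot s] with t hts using l1 t hts)
  have l3 := S.mw.nonneg s
  have l4 : w s = 0 := le_antisymm l2 l3
  rw [l4] at hc
  obtain ⟨t, h1, h2⟩ := ((ht.eventually (lt_mem_nhds (mul_pos p.hh p.hU))).and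
    (eventually_ge_atTop s)).exists
  have := swE_pos (p.H_MB S.mφ S.mw) p.hδ h2 (by
    unfold swH
    have a1 := S.mφ.le t
    have a2 := mul_nonneg p.hh.le (S.mφ.nonneg t)
    have a3 : h * φ t < 1 := lt_of_le_of_lt (mul_le_mul_of_nonneg_left a1 p.hh.le) p.hU'
    have a4 := mul_pos h1 (sub_pos.2 a3)
    have := p.hr; have := p.hd
    apply div_pos _ p.hd
    apply mul_pos p.hr
    nlinarith [sq_nonneg (w t)])
  linarith

/-- everything about `w` -/
lemma SwSol.psi (p : SwPar d r h k c U α β γ δ) {a : EReal} {φ w : ℝ → ℝ}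
    (S : SwSol d r h k U α β γ δ a 0 φ w) (hb : Tendsto w atBot (nhds 0))
    (ht : Tendsto w atTop (nhds (h * U))) :
    ContDiff ℝ 2 (fun s => 1 - w s) ∧ (∀ s, deriv (fun s => 1 - w s) s < 0) ∧
    (∀ s : ℝ, d * deriv (deriv (fun s => 1 - w s)) s - c * deriv (fun s => 1 - w s) s +
      r * (1 - w s) * (1 - (1 - w s) - h * φ s) = 0) := by
  set z := swE δ 1 (fun x => swH d r h (φ x) (w x)) with hz
  have d1 : ∀ s, HasDerivAt (fun s => 1 - w s) (-(z s - γ * w s)) s := fun s =>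
    (S.dw p s).const_sub 1
  have d2 : ∀ s, HasDerivAt (fun s => -(z s - γ * w s))
      (-((δ * z s - swH d r h (φ s) (w s)) - γ * (z s - γ * w s))) s := fun s =>
    ((S.dz p s).sub ((S.dw p s).const_mul γ)).neg
  have cz : Continuous z := swE_continuous (p.H_MB S.mφ S.mw) p.hδ (one_mul 1)
  have cw := S.wcont p
  have cH := S.Hcont p
  have e1 : deriv (fun s => 1 - w s) = fun s => -(z s - γ * w s) := funext fun s => (d1 s).deriv
  refine ⟨sw_C2 d1 d2 (by fun_prop), fun s => ?_, fun s => ?_⟩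
  · rw [e1]
    have := S.w_pos p hb ht s
    simp only [← hz] at this
    simp only
    linarith
  · rw [e1, (d2 s).deriv]
    have hd := p.hd
    have hc : c = d * (δ - γ) := by rw [p.e3]; field_simp
    have hr : 2 * r = d * (γ * δ) := by rw [p.e4]; field_simp
    have hH : d * swH d r h (φ s) (w s) = r * (w s * (1 - h * φ s) + w s ^ 2 + h * φ s) := by
      unfold swH; field_simp
    linear_combination hH + (z s - γ * w s) * hc + w s * hr

/-- the equation for `φ` -/
lemma SwSol.phi (p : SwPar d r h k c U α β γ δ) {a : EReal} {φ w : ℝ → ℝ}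
    (S : SwSol d r h k U α β γ δ a 0 φ w) {s : ℝ} (hs : a < (s : EReal)) :
    deriv (deriv φ) s - c * deriv φ s + φ s * (1 - φ s - k * (1 - w s)) = 0 := by
  have ev : ∀ᶠ t : ℝ in nhds s, a < (t : EReal) :=
    (isOpen_Ioi.preimage continuous_coe_real_ereal).mem_nhds hs
  have e1 : deriv φ =ᶠ[nhds s] fun t => swE β 1 (fun x => swG k (φ x) (w x)) t - α * φ t := by
    filter_upwards [ev] with t ht using (S.dphi p ht).deriv
  rw [e1.deriv_eq, (S.dphi p hs).deriv]
  have d2 := (S.dy p s).sub ((S.dphi p hs).const_mul α)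
  have := d2.deriv
  simp only [Pi.sub_def] at this
  rw [this]
  set Y := swE β 1 (fun x => swG k (φ x) (w x)) s
  unfold swG
  linear_combination (Y - α * φ s) * p.e1 + φ s * p.e2

lemma SwSol.entire (p : SwPar d r h k c (uStar h k) α β γ δ) (hv : h * uStar h k = 1 - vStar h k)
    {φ w : ℝ → ℝ} (S : SwSol d r h k (uStar h k) α β γ δ ⊥ 0 φ w) (h0 : φ 0 = uStar h k / 2) :
    IsEntireWave d r h k c φ (fun s => 1 - w s) := by
  have hU := p.hU
  have hαU := mul_pos p.hα p.hU
  obtain ⟨t1, t2⟩ := S.limTop p bot_ne_top le_rfl hαU.le (s := 0) (by rw [h0]; linarith)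
  obtain ⟨A, hA, lA⟩ := S.mφ.limBot
  obtain ⟨B, hB, lB⟩ := S.mw.limBot
  obtain ⟨e1, e2⟩ := S.lim p le_rfl hαU.le swBot hA hB
  have hA0 : A = 0 := by
    rcases e2 (Eventually.of_forall fun t => EReal.bot_lt_coe t) with q | q
    · exact q
    · have := lA 0; linarith
  rw [hA0, mul_zero] at e1
  rw [hA0] at hA
  rw [e1] at hB
  obtain ⟨q1, q2, q3⟩ := S.psi p hB t2
  have lt : ∀ s : ℝ, (⊥ : EReal) < s := fun s => EReal.bot_lt_coe s
  have cy : Continuous (swE β 1 (fun x => swG k (φ x) (w x))) :=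
    swE_continuous (p.G_MB S.mφ S.mw) p.hβ (one_mul 1)
  have cG := S.Gcont p
  have cφ := S.cont p le_rfl hαU.le
  refine ⟨sw_C2 (fun s => S.dphi p (lt s))
    (fun s => (S.dy p s).sub ((S.dphi p (lt s)).const_mul α)) (by fun_prop), q1,
    fun s => S.phi p (lt s), fun s => ?_, q3, q2, hA, ?_, t1, ?_⟩
  · rw [(S.dphi p (lt s)).deriv]
    exact S.phi_pos p hA t1 (lt s)
  · simpa using hB.const_sub 1
  · have := t2.const_sub 1
    rwa [hv, sub_sub_cancel] at this

lemma SwSol.semi (p : SwPar d r h k c (uStar h k) α β γ δ) (hv : h * uStar h k = 1 - vStar h k)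
    {φ w : ℝ → ℝ} (S : SwSol d r h k (uStar h k) α β γ δ (0 : ℝ) 0 φ w) {s0 : ℝ} (h0 : 0 < φ s0) :
    IsSemiWave d r h k c φ (fun s => 1 - w s) := by
  have hU := p.hU
  have hαU := mul_pos p.hα p.hU
  obtain ⟨t1, t2⟩ := S.limTop p (EReal.coe_ne_top 0) le_rfl hαU.le h0
  have hz : ∀ s ≤ (0:ℝ), φ s = 0 := fun s hs => by
    have := S.left p le_rfl s hs
    simpa using this
  have hA : Tendsto φ atBot (nhds 0) := by
    refine tendsto_const_nhds.congr' ?_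
    filter_upwards [eventually_le_atBot (0:ℝ)] with s hs using (hz s hs).symm
  obtain ⟨B, hB, lB⟩ := S.mw.limBot
  obtain ⟨e1, -⟩ := S.lim p le_rfl hαU.le swBot hA hB
  rw [mul_zero] at e1
  rw [e1] at hB
  obtain ⟨q1, q2, q3⟩ := S.psi p hB t2
  have lt : ∀ s : ℝ, 0 < s → ((0:ℝ) : EReal) < s := fun s hs => EReal.coe_lt_coe_iff.2 hs
  have cy : Continuous (swE β 1 (fun x => swG k (φ x) (w x))) :=
    swE_continuous (p.G_MB S.mφ S.mw) p.hβ (one_mul 1)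
  have cG := S.Gcont p
  have cφ := S.cont p le_rfl hαU.le
  have my := p.y_MB S.mφ S.mw
  have mc := swCut_MB (((0:ℝ) : EReal)) my le_rfl hαU.le
  refine ⟨cφ, ?_, hz, q1, fun s hs => S.phi p (lt s hs), fun s hs => ?_, q3, q2, ?_, t1, ?_⟩
  · set y := swE β 1 (fun x => swG k (φ x) (w x)) with hy
    have f1 : ∀ s, HasDerivAt (swE α (-1) y) (-1 * (α * swE α (-1) y s - y s)) s := fun s =>
      swE_hasDeriv my p.hα neg_one_sq' cy.continuousAt
    have f2 : ∀ s, HasDerivAt (fun s => -1 * (α * swE α (-1) y s - y s))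
        (-1 * (α * (-1 * (α * swE α (-1) y s - y s)) - (β * y s - swG k (φ s) (w s)))) s :=
      fun s => (((f1 s).const_mul α).sub (S.dy p s)).const_mul (-1)
    have cE : Continuous (swE α (-1) y) := swE_continuous my p.hα neg_one_sq'
    have C := sw_C2 f1 f2 (by fun_prop)
    have C' : ContDiff ℝ 2 (fun s => swE α (-1) y s - Real.exp (-α * s) * swE α (-1) y 0) :=
      C.sub (((contDiff_const.mul contDiff_id).exp).mul contDiff_const)
    refine C'.contDiffOn.congr fun s hs => ?_
    have hs' : (0:ℝ) ≤ s := hs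
    have g1 := swE_semi my p.hα (-1) s s
    have g2 := swE_semi mc p.hα (-1) s s
    have e0 : s + (-1) * s = 0 := by ring
    rw [e0] at g1 g2
    rw [← S.eq1, ← S.eq1, hz 0 le_rfl] at g2
    have g3 : (∫ x in (0:ℝ)..s, Real.exp (-α * x) * swCut ((0:ℝ) : EReal) 0 y (s + (-1) * x)) =
        ∫ x in (0:ℝ)..s, Real.exp (-α * x) * y (s + (-1) * x) := by
      rw [intervalIntegral.integral_of_le hs', intervalIntegral.integral_of_le hs',
        MeasureTheory.integral_Ioc_eq_integral_Ioo, MeasureTheory.integral_Ioc_eq_integral_Ioo]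
      refine MeasureTheory.setIntegral_congr_fun measurableSet_Ioo fun x hx => ?_
      have : 0 < s + (-1) * x := by have := hx.2; linarith
      simp only [swCut_eq my (lt _ this)]
    rw [g3] at g2
    linarith
  · rw [(S.dphi p (lt s hs)).deriv]
    exact S.phi_pos p hA t1 (lt s hs)
  · simpa using hB.const_sub 1
  · have := t2.const_sub 1
    rwa [hv, sub_sub_cancel] at this

lemma sw_strict_lt {f : ℝ → ℝ} {a : ℝ} {L : ℝ} (hf : ∀ s t, a ≤ s → s < t → f s < f t)
    (hL : Tendsto f atTop (nhds L)) {s : ℝ} (hs : a ≤ s) : f s < L :=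
  lt_of_lt_of_le (hf s (s + 1) hs (by linarith)) (ge_of_tendsto hL (by
    filter_upwards [eventually_gt_atTop (s + 1)] with t ht
    exact (hf _ _ (by linarith) ht).le))

/-- data for `ψ` -/
lemma sw_psi_data (hd : 0 < d) {φ ψ : ℝ → ℝ} (hv : h * uStar h k = 1 - vStar h k) (s1 : ContDiff ℝ 2 ψ)
    (o1 : ∀ s : ℝ, d * deriv (deriv ψ) s - c * deriv ψ s + r * ψ s * (1 - ψ s - h * φ s) = 0)
    (n1 : ∀ s, deriv ψ s < 0) (b1 : Tendsto ψ atBot (nhds 1))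
    (t1 : Tendsto ψ atTop (nhds (vStar h k))) :
    Monotone (fun s => 1 - ψ s) ∧ (∀ s, 0 ≤ 1 - ψ s) ∧ (∀ s, 1 - ψ s < h * uStar h k) ∧
    (∀ s, HasDerivAt (fun s => 1 - ψ s) (-deriv ψ s) s) ∧
    (∀ s, HasDerivAt (fun s => -deriv ψ s)
      ((c * (-deriv ψ s) + r * (1 - (1 - ψ s)) * ((1 - ψ s) - h * φ s)) / d) s) ∧
    Tendsto (fun s => 1 - ψ s) atBot (nhds 0) ∧
    Tendsto (fun s => 1 - ψ s) atTop (nhds (h * uStar h k)) := by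
  have anti : StrictAnti ψ := strictAnti_of_deriv_neg n1
  have tt : Tendsto (fun s => 1 - ψ s) atTop (nhds (h * uStar h k)) := by
    rw [hv]; exact t1.const_sub 1
  refine ⟨fun a b hab => by have := anti.antitone hab; simp only; linarith, fun s => ?_,
    fun s => ?_, fun s => ?_, fun s => ?_, ?_, tt⟩
  · have : ψ s ≤ 1 := ge_of_tendsto b1 (by
      filter_upwards [eventually_le_atBot s] with t hts using anti.antitone hts)
    linarith
  · exact sw_strict_lt (f := fun s => 1 - ψ s) (a := s)
      (fun a b _ hab => by have := anti hab; show 1 - ψ a < 1 - ψ b; linarith) tt le_rfl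
  · exact ((s1.differentiable (by norm_num)).differentiableAt).hasDerivAt.const_sub 1
  · have s2 : ContDiff ℝ 1 (deriv ψ) := ((contDiff_succ_iff_deriv (n := 1)).1
      (by simpa [one_add_one_eq_two] using s1)).2.2
    have := ((s2.differentiable (by norm_num)).differentiableAt (x := s)).hasDerivAt.neg
    have e : (c * (-deriv ψ s) + r * (1 - (1 - ψ s)) * ((1 - ψ s) - h * φ s)) / d =
        -deriv (deriv ψ) s := by
      rw [div_eq_iff hd.ne']
      linear_combination o1 s
    rw [e]
    exact this
  · simpa using b1.const_sub 1

lemma IsSemiWave.prof (hd : 0 < d) (hU : 0 < uStar h k) (hv : h * uStar h k = 1 - vStar h k)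
    {φ ψ : ℝ → ℝ} (S : IsSemiWave d r h k c φ ψ) :
    SwProf d r h k c (uStar h k) φ (deriv φ) (fun s => 1 - ψ s) (fun s => -deriv ψ s) ∧
    (∀ s > 0, 0 < φ s) := by
  obtain ⟨m, n, l, d1, d2, b, t⟩ :=
    sw_psi_data hd hv S.smooth_psi S.ode_psi S.psi_deriv_neg S.psi_atBot S.psi_atTop
  have sm : StrictMonoOn φ (Ici 0) := strictMonoOn_of_deriv_pos (convex_Ici 0) S.cont_phi.continuousOn
    (fun s hs => S.phi_deriv_pos s (by simpa using hs))
  have hp : ∀ s > 0, 0 < φ s := fun s hs => by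
    have := sm (mem_Ici.2 le_rfl) (mem_Ici.2 hs.le) hs
    rwa [S.phi_zero 0 le_rfl] at this
  have pos : ∀ s, 0 < φ s → 0 < s := fun s hs => by
    by_contra hc
    rw [S.phi_zero s (not_lt.1 hc)] at hs
    exact lt_irrefl _ hs
  have nn : ∀ s, 0 ≤ φ s := fun s => by
    rcases le_or_gt s 0 with q | q
    · rw [S.phi_zero s q]
    · exact (hp s q).le
  have sI : ContDiffOn ℝ 2 φ (Ioi 0) := S.smooth_phi.mono Ioi_subset_Ici_self
  have sI' : ContDiffOn ℝ 1 (deriv φ) (Ioi 0) :=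
    sI.deriv_of_isOpen isOpen_Ioi (by norm_num [one_add_one_eq_two])
  refine ⟨⟨S.cont_phi, fun s t hst => ?_, nn, fun s => ?_, m, n, l, fun s hs => ?_,
    fun s hs => ?_, d1, d2, S.phi_atTop, b, t⟩, hp⟩
  · rcases le_or_gt s 0 with q | q
    · rw [S.phi_zero s q]; exact nn t
    · exact sm.monotoneOn q.le (q.le.trans hst) hst
  · rcases le_or_gt s 0 with q | q
    · rw [S.phi_zero s q]; exact hU
    · exact sw_strict_lt (f := φ) (fun a b ha hab => sm ha (ha.trans hab.le) hab) S.phi_atTop q.le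
  · exact ((sI.differentiableOn (by norm_num)).differentiableAt
      (isOpen_Ioi.mem_nhds (pos s hs))).hasDerivAt
  · have := ((sI'.differentiableOn (by norm_num)).differentiableAt
      (isOpen_Ioi.mem_nhds (pos s hs))).hasDerivAt
    have e : c * deriv φ s - φ s * (1 - k - φ s + k * (1 - ψ s)) = deriv (deriv φ) s := by
      linear_combination -(S.ode_phi s (pos s hs))
    rw [e]
    exact this

lemma IsEntireWave.prof (hd : 0 < d) (hv : h * uStar h k = 1 - vStar h k)
    {φ ψ : ℝ → ℝ} (S : IsEntireWave d r h k c φ ψ) :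
    SwProf d r h k c (uStar h k) φ (deriv φ) (fun s => 1 - ψ s) (fun s => -deriv ψ s) ∧
    (∀ s, 0 < φ s) := by
  obtain ⟨m, n, l, d1, d2, b, t⟩ :=
    sw_psi_data hd hv S.smooth_Psi S.ode_Psi S.Psi_deriv_neg S.Psi_atBot S.Psi_atTop
  have sm : StrictMono φ := strictMono_of_deriv_pos S.Phi_deriv_pos
  have hp : ∀ s, 0 < φ s := fun s => by
    have h1 : 0 ≤ φ (s - 1) := le_of_tendsto S.Phi_atBot (by
      filter_upwards [eventually_le_atBot (s - 1)] with t ht using sm.monotone ht)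
    exact h1.trans_lt (sm (by linarith))
  have s2 : ContDiff ℝ 1 (deriv φ) := ((contDiff_succ_iff_deriv (n := 1)).1
      (by simpa [one_add_one_eq_two] using S.smooth_Phi)).2.2
  refine ⟨⟨S.smooth_Phi.continuous, sm.monotone, fun s => (hp s).le, fun s => ?_, m, n, l,
    fun s hs => ?_, fun s hs => ?_, d1, d2, S.Phi_atTop, b, t⟩, hp⟩
  · exact sw_strict_lt (f := φ) (a := s) (fun a b ha hab => sm hab) S.Phi_atTop le_rfl
  · exact ((S.smooth_Phi.differentiable (by norm_num)).differentiableAt).hasDerivAt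
  · have := ((s2.differentiable (by norm_num)).differentiableAt (x := s)).hasDerivAt
    have e : c * deriv φ s - φ s * (1 - k - φ s + k * (1 - ψ s)) = deriv (deriv φ) s := by
      linear_combination -(S.ode_Phi s)
    rw [e]
    exact this

lemma sw_limit {f g : ℝ → ℝ} (hg : Continuous g) (hle : ∀ τ > 0, ∀ s, f s ≤ g (s + τ)) (s : ℝ) :
    f s ≤ g s := by
  have h1 : Tendsto (fun τ => g (s + τ)) (nhdsWithin 0 (Ioi 0)) (nhds (g (s + 0))) :=
    ((hg.comp (continuous_const.add continuous_id)).tendsto (0:ℝ)).mono_left nhdsWithin_le_nhds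
  rw [add_zero] at h1
  exact ge_of_tendsto h1 (by
    filter_upwards [self_mem_nhdsWithin] with τ hτ using hle τ hτ s)

lemma sw_consts {h k : ℝ} (hh : h ∈ Set.Ioo (0:ℝ) 1) (hk : k ∈ Set.Ioo (0:ℝ) 1) :
    0 < uStar h k ∧ uStar h k < 1 ∧ 1 - k - uStar h k + k * (h * uStar h k) = 0 ∧
    h * uStar h k = 1 - vStar h k ∧ h * uStar h k < 1 := by
  obtain ⟨h0, h1⟩ := hh
  obtain ⟨k0, k1⟩ := hk
  have hp : 0 < 1 - h * k := by nlinarith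
  have u0 : 0 < uStar h k := div_pos (by linarith) hp
  have u1 : uStar h k < 1 := by
    unfold uStar
    rw [div_lt_one hp]; nlinarith
  refine ⟨u0, u1, ?_, ?_, by nlinarith⟩
  · have e : uStar h k * (1 - h * k) = 1 - k := div_mul_cancel₀ _ hp.ne'
    linear_combination -e
  · unfold uStar vStar; field_simp; ring

end

theorem stmt13 (d r h k cstar : ℝ) (hd : 0 < d) (hr : 0 < r)
    (hh : h ∈ Set.Ioo (0:ℝ) 1) (hk : k ∈ Set.Ioo (0:ℝ) 1)
    (hcstar : 2 * Real.sqrt (1 - k) ≤ cstar)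
    -- an entire wave with speed `c ≥ 0` exists iff `c ≥ cstar`
    (hiff : ∀ c : ℝ, 0 ≤ c →
      ((∃ Φ Ψ : ℝ → ℝ, IsEntireWave d r h k c Φ Ψ) ↔ cstar ≤ c)) :
    (∀ c : ℝ, 0 ≤ c → c < cstar →
      ∃! p : (ℝ → ℝ) × (ℝ → ℝ), IsSemiWave d r h k c p.1 p.2) ∧
    (∀ c : ℝ, cstar ≤ c → ¬ ∃ φ ψ : ℝ → ℝ, IsSemiWave d r h k c φ ψ) := by
  obtain ⟨u0, u1, hUeq, hv, hU'⟩ := sw_consts hh hk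
  obtain ⟨h0, h1⟩ := hh
  obtain ⟨k0, k1⟩ := hk
  constructor
  · intro c hc hlt
    have ex : ∃ φ ψ : ℝ → ℝ, IsSemiWave d r h k c φ ψ := by
      obtain ⟨α, β, hα, hβ, e1, e2⟩ := sw_roots c 2 (by norm_num)
      obtain ⟨γ, δ, hγ, hδ, e3, e4⟩ := sw_roots (c / d) (2 * r / d) (by positivity)
      have p : SwPar d r h k c (uStar h k) α β γ δ :=
        ⟨hd, hr, h0, h1, k0, k1, u0, u1, hUeq, hα, hβ, hγ, hδ, e1, e2, e3, e4⟩
      obtain ⟨a, φ, w, ha, hφ, S⟩ := p.exists_main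
      induction a using EReal.rec with
      | bot =>
        exact absurd ((hiff c hc).1 ⟨_, _, S.entire p hv hφ⟩) (not_le.2 hlt)
      | top => exact absurd ha (by simp)
      | coe a =>
        have S' := S.shift a
        rw [sub_self] at S'
        refine ⟨_, _, S'.semi p hv (s0 := -a) ?_⟩
        rw [neg_add_cancel, hφ]
        linarith
    obtain ⟨φ, ψ, S⟩ := ex
    refine ⟨(φ, ψ), S, ?_⟩
    have main : ∀ φ ψ φ' ψ' : ℝ → ℝ, IsSemiWave d r h k c φ ψ → IsSemiWave d r h k c φ' ψ' →
        (∀ s, φ s ≤ φ' s) ∧ (∀ s, 1 - ψ s ≤ 1 - ψ' s) := by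
      intro φ ψ φ' ψ' S S'
      obtain ⟨P, hp⟩ := S.prof hd u0 hv
      obtain ⟨P', hp'⟩ := S'.prof hd u0 hv
      have key := fun (τ : ℝ) (hτ : τ > 0) =>
        sw_slide hd hr h0 k0 hU' u0 u1 k1 h1 hUeq P P' S.phi_zero hp τ (hp' τ hτ)
      exact ⟨sw_limit P'.cont fun τ hτ => (key τ hτ).1, sw_limit P'.wcont fun τ hτ => (key τ hτ).2⟩
    rintro ⟨φ', ψ'⟩ S'
    obtain ⟨a1, a2⟩ := main _ _ _ _ S S'
    obtain ⟨b1, b2⟩ := main _ _ _ _ S' S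
    refine Prod.ext (funext fun s => le_antisymm (b1 s) (a1 s)) (funext fun s => ?_)
    have := a2 s
    have := b2 s
    simp only at *
    linarith
  · rintro c hc ⟨φ, ψ, S⟩
    have c0 : 0 ≤ c := le_trans (by positivity) (hcstar.trans hc)
    obtain ⟨Φ, Ψ, E⟩ := (hiff c c0).2 hc
    obtain ⟨P, hp⟩ := S.prof hd u0 hv
    obtain ⟨Q, hq⟩ := E.prof hd hv
    have key : ∀ τ, φ 1 ≤ Φ (1 + τ) := fun τ =>
      (sw_slide hd hr h0 k0 hU' u0 u1 k1 h1 hUeq P Q S.phi_zero hp τ (hq τ)).1 1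
    have l : Tendsto (fun τ => Φ (1 + τ)) atBot (nhds 0) := E.Phi_atBot.comp (swBot 1)
    have := ge_of_tendsto' l key
    have := hp 1 one_pos
    linarith
end
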